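/- Every continuous map f : SU(2) × SU(2) → SU(2) that is homotopic to the commutator map c(u,v) = uvu⁻¹v⁻¹ is surjective. -/

import Mathlib

/-- The special unitary group `SU(n)`: the subgroup of the unitary group
`U(n) = Matrix.unitaryGroup (Fin n) ℂ` consisting of matrices of determinant `1`. -/
def SU (n : ℕ) : Subgroup (Matrix.unitaryGroup (Fin n) ℂ) where
  carrier := {A | (A : Matrix (Fin n) (Fin n) ℂ).det = 1}
  mul_mem' := by
    intro a b ha hb
    simp only [Set.mem_setOf_eq] at *
    simp [Matrix.UnitaryGroup.mul_val, Matrix.det_mul, ha, hb]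
  one_mem' := by simp
  inv_mem' := by
    intro a ha
    simp only [Set.mem_setOf_eq] at *
    show ((a⁻¹ : Matrix.unitaryGroup (Fin n) ℂ) : Matrix (Fin n) (Fin n) ℂ).det = 1
    rw [Matrix.UnitaryGroup.inv_val, Matrix.star_eq_conjTranspose, Matrix.det_conjTranspose, ha]
    simp

set_option linter.all false

namespace BK
open Matrix Kronecker

/-- Finitely generated projective module given by an idempotent matrix. -/
structure Pj (R : Type) [CommRing R] : Type 1 where
  ι : Type
  [ft : Fintype ι]
  [de : DecidableEq ι]
  e : Matrix ι ι R
  idem : e * e = e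

attribute [instance] Pj.ft Pj.de

section ringpart
variable {R S : Type} [CommRing R] [CommRing S]

/-- Murray-von Neumann equivalence. -/
def Eqv (p q : Pj R) : Prop :=
  ∃ (x : Matrix p.ι q.ι R) (y : Matrix q.ι p.ι R), x * y = p.e ∧ y * x = q.e

theorem Eqv.refl (p : Pj R) : Eqv p p := ⟨p.e, p.e, p.idem, p.idem⟩
theorem Eqv.symm {p q : Pj R} : Eqv p q → Eqv q p := fun ⟨x, y, h1, h2⟩ => ⟨y, x, h2, h1⟩
theorem Eqv.trans {p q r : Pj R} : Eqv p q → Eqv q r → Eqv p r := by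
  rintro ⟨x, y, h1, h2⟩ ⟨x', y', h3, h4⟩
  refine ⟨x * x', y' * y, ?_, ?_⟩
  · calc x * x' * (y' * y) = x * (x' * y') * y := by simp only [Matrix.mul_assoc]
      _ = (x * y) * (x * y) := by rw [h3, ← h2]; simp only [Matrix.mul_assoc]
      _ = p.e := by rw [h1, p.idem]
  · calc y' * y * (x * x') = y' * (y * x) * x' := by simp only [Matrix.mul_assoc]
      _ = (y' * x') * (y' * x') := by rw [h2, ← h3]; simp only [Matrix.mul_assoc]
      _ = r.e := by rw [h4, r.idem]

/-- can choose `x`, `y` in the corners -/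
theorem Eqv.corner {p q : Pj R} (h : Eqv p q) :
    ∃ (x : Matrix p.ι q.ι R) (y : Matrix q.ι p.ι R), x * y = p.e ∧ y * x = q.e ∧
      p.e * x = x ∧ x * q.e = x ∧ q.e * y = y ∧ y * p.e = y := by
  obtain ⟨x, y, h1, h2⟩ := h
  have hp := p.idem
  have hq := q.idem
  have e1 : p.e * x = x * q.e := by rw [← h1, ← h2, Matrix.mul_assoc]
  have e2 : q.e * y = y * p.e := by rw [← h1, ← h2, Matrix.mul_assoc]
  refine ⟨p.e * x, q.e * y, ?_, ?_, ?_, ?_, ?_, ?_⟩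
  · rw [e2, Matrix.mul_assoc, ← Matrix.mul_assoc x, h1, hp, hp]
  · rw [e1, Matrix.mul_assoc, ← Matrix.mul_assoc y, h2, hq, hq]
  · rw [← Matrix.mul_assoc, hp]
  · rw [e1, Matrix.mul_assoc, hq]
  · rw [← Matrix.mul_assoc, hq]
  · rw [e2, Matrix.mul_assoc, hp]

theorem Eqv.of_equiv {p q : Pj R} (σ : p.ι ≃ q.ι) (h : ∀ i j, q.e (σ i) (σ j) = p.e i j) :
    Eqv p q := by
  refine ⟨p.e.submatrix id σ.symm, p.e.submatrix σ.symm id, ?_, ?_⟩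
  · rw [Matrix.submatrix_mul_equiv, p.idem]; rfl
  · have : p.e.submatrix σ.symm id * p.e.submatrix id σ.symm = (p.e * p.e).submatrix σ.symm σ.symm := by
      ext i j; simp [Matrix.mul_apply]
    rw [this, p.idem]
    ext i j
    rw [← σ.apply_symm_apply i, ← σ.apply_symm_apply j, h]; simp

/-- direct sum -/
abbrev Pj.add (p q : Pj R) : Pj R where
  ι := p.ι ⊕ q.ι
  e := fromBlocks p.e 0 0 q.e
  idem := by simp [fromBlocks_multiply, p.idem, q.idem]

/-- tensor product -/
abbrev Pj.mul (p q : Pj R) : Pj R where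
  ι := p.ι × q.ι
  e := p.e ⊗ₖ q.e
  idem := by rw [← mul_kronecker_mul, p.idem, q.idem]

/-- trivial module -/
abbrev Pj.triv (R : Type) [CommRing R] (ι : Type) [Fintype ι] [DecidableEq ι] : Pj R where
  ι := ι
  e := 1
  idem := by simp

abbrev Pj.map (f : R →+* S) (p : Pj R) : Pj S where
  ι := p.ι
  e := p.e.map f
  idem := by rw [← Matrix.map_mul, p.idem]

/-- complement -/
abbrev Pj.compl (p : Pj R) : Pj R where
  ι := p.ι
  e := 1 - p.e
  idem := by rw [Matrix.sub_mul, Matrix.mul_sub, Matrix.mul_sub, p.idem]; simp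

instance setoid (R : Type) [CommRing R] : Setoid (Pj R) where
  r := Eqv
  iseqv := ⟨Eqv.refl, Eqv.symm, Eqv.trans⟩

theorem Eqv.add {p q p' q' : Pj R} : Eqv p p' → Eqv q q' → Eqv (p.add q) (p'.add q') := by
  rintro ⟨x, y, h1, h2⟩ ⟨x', y', h3, h4⟩
  exact ⟨fromBlocks x 0 0 x', fromBlocks y 0 0 y',
    by simp [fromBlocks_multiply, h1, h3, Pj.add], by simp [fromBlocks_multiply, h2, h4, Pj.add]⟩

theorem Eqv.mul {p q p' q' : Pj R} : Eqv p p' → Eqv q q' → Eqv (p.mul q) (p'.mul q') := by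
  rintro ⟨x, y, h1, h2⟩ ⟨x', y', h3, h4⟩
  exact ⟨x ⊗ₖ x', y ⊗ₖ y',
    by rw [← mul_kronecker_mul, h1, h3], by rw [← mul_kronecker_mul, h2, h4]⟩

theorem Eqv.map (f : R →+* S) {p q : Pj R} : Eqv p q → Eqv (p.map f) (q.map f) := by
  rintro ⟨x, y, h1, h2⟩
  exact ⟨x.map f, y.map f, by rw [← Matrix.map_mul, h1], by rw [← Matrix.map_mul, h2]⟩

variable (R) in
/-- isomorphism classes -/
def V : Type 1 := Quotient (setoid R)

def V.mk (p : Pj R) : V R := Quotient.mk _ p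

theorem V.mk_eq {p q : Pj R} : V.mk p = V.mk q ↔ Eqv p q := Quotient.eq

theorem V.ind {P : V R → Prop} (h : ∀ p, P (V.mk p)) (a : V R) : P a := Quotient.ind h a

instance : Add (V R) := ⟨Quotient.map₂ Pj.add (fun _ _ h _ _ h' => Eqv.add h h')⟩
instance : Mul (V R) := ⟨Quotient.map₂ Pj.mul (fun _ _ h _ _ h' => Eqv.mul h h')⟩
instance : Zero (V R) := ⟨V.mk (Pj.triv R Empty)⟩
instance : One (V R) := ⟨V.mk (Pj.triv R Unit)⟩

theorem V.add_mk (p q : Pj R) : V.mk p + V.mk q = V.mk (p.add q) := rfl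
theorem V.mul_mk (p q : Pj R) : V.mk p * V.mk q = V.mk (p.mul q) := rfl
theorem V.zero_mk : (0 : V R) = V.mk (Pj.triv R Empty) := rfl
theorem V.one_mk : (1 : V R) = V.mk (Pj.triv R Unit) := rfl

instance : CommSemiring (V R) where
  add_assoc a b c := by
    induction a using V.ind; induction b using V.ind; induction c using V.ind
    refine V.mk_eq.2 (Eqv.of_equiv (Equiv.sumAssoc _ _ _) ?_)
    rintro ((i | i) | i) ((j | j) | j) <;> rfl
  zero_add a := by
    induction a using V.ind
    refine V.mk_eq.2 (Eqv.of_equiv (Equiv.emptySum Empty _) ?_)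
    rintro (i | i) (j | j)
    · exact i.elim
    · exact i.elim
    · exact j.elim
    · rfl
  add_zero a := by
    induction a using V.ind
    refine V.mk_eq.2 (Eqv.of_equiv (Equiv.sumEmpty _ Empty) ?_)
    rintro (i | i) (j | j)
    · rfl
    · exact j.elim
    · exact i.elim
    · exact i.elim
  add_comm a b := by
    induction a using V.ind; induction b using V.ind
    refine V.mk_eq.2 (Eqv.of_equiv (Equiv.sumComm _ _) ?_)
    rintro (i | i) (j | j) <;> rfl
  mul_assoc a b c := by
    induction a using V.ind; induction b using V.ind; induction c using V.ind
    refine V.mk_eq.2 (Eqv.of_equiv (Equiv.prodAssoc _ _ _) ?_)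
    rintro ⟨⟨i, i'⟩, i''⟩ ⟨⟨j, j'⟩, j''⟩
    simp [Pj.mul, mul_assoc]
  mul_comm a b := by
    induction a using V.ind; induction b using V.ind
    refine V.mk_eq.2 (Eqv.of_equiv (Equiv.prodComm _ _) ?_)
    rintro ⟨i, i'⟩ ⟨j, j'⟩
    simp [Pj.mul, mul_comm]
  one_mul a := by
    induction a using V.ind
    refine V.mk_eq.2 (Eqv.of_equiv (Equiv.punitProd _) ?_)
    rintro ⟨i, i'⟩ ⟨j, j'⟩
    simp [Pj.mul, Pj.triv]
  mul_one a := by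
    induction a using V.ind
    refine V.mk_eq.2 (Eqv.of_equiv (Equiv.prodPUnit _) ?_)
    rintro ⟨i, i'⟩ ⟨j, j'⟩
    simp [Pj.mul, Pj.triv]
  zero_mul a := by
    induction a using V.ind
    refine V.mk_eq.2 (Eqv.of_equiv (Equiv.equivOfIsEmpty (Empty × _) Empty) ?_)
    rintro ⟨i, i'⟩ ⟨j, j'⟩
    exact i.elim
  mul_zero a := by
    induction a using V.ind
    refine V.mk_eq.2 (Eqv.of_equiv (Equiv.equivOfIsEmpty (_ × Empty) Empty) ?_)
    rintro ⟨i, i'⟩ ⟨j, j'⟩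
    exact i'.elim
  left_distrib a b c := by
    induction a using V.ind; induction b using V.ind; induction c using V.ind
    refine V.mk_eq.2 (Eqv.of_equiv (Equiv.prodSumDistrib _ _ _) ?_)
    rintro ⟨i, i' | i'⟩ ⟨j, j' | j'⟩ <;> simp [Pj.mul, Pj.add, Equiv.prodSumDistrib]
  right_distrib a b c := by
    induction a using V.ind; induction b using V.ind; induction c using V.ind
    refine V.mk_eq.2 (Eqv.of_equiv (Equiv.sumProdDistrib _ _ _) ?_)
    rintro ⟨i | i, i'⟩ ⟨j | j, j'⟩ <;> simp [Pj.mul, Pj.add, Equiv.sumProdDistrib]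
  nsmul := nsmulRec
  npow := npowRec

def V.map (f : R →+* S) : V R →+* V S where
  toFun := Quotient.map (Pj.map f) (fun _ _ h => Eqv.map f h)
  map_zero' := V.mk_eq.2 (Eqv.of_equiv (Equiv.refl _) (by intro i; exact i.elim))
  map_one' := V.mk_eq.2 (Eqv.of_equiv (Equiv.refl _) (by intro i j; simp [Pj.map, Pj.triv]))
  map_add' a b := by
    induction a using V.ind; induction b using V.ind
    refine V.mk_eq.2 (Eqv.of_equiv (Equiv.refl _) ?_)
    rintro (i | i) (j | j) <;> simp [Pj.map, Pj.add]
  map_mul' a b := by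
    induction a using V.ind; induction b using V.ind
    refine V.mk_eq.2 (Eqv.of_equiv (Equiv.refl _) ?_)
    rintro ⟨i, i'⟩ ⟨j, j'⟩; simp [Pj.map, Pj.mul]

theorem V.map_mk (f : R →+* S) (p : Pj R) : V.map f (V.mk p) = V.mk (p.map f) := rfl

end ringpart

/-! Grothendieck ring of a commutative semiring -/
section groth
open Algebra

/-- Grothendieck completion -/
def Gr (A : Type 1) [CommSemiring A] : Type 1 := GrothendieckAddGroup A

variable {A B : Type 1} [CommSemiring A] [CommSemiring B]

noncomputable instance : AddCommGroup (Gr A) := inferInstanceAs (AddCommGroup (GrothendieckAddGroup A))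

noncomputable def Gr.of : A →+ Gr A := GrothendieckAddGroup.of
noncomputable def Gr.lift {G : Type*} [AddCommGroup G] (f : A →+ G) : Gr A →+ G :=
  GrothendieckAddGroup.lift f

theorem Gr.lift_of {G : Type*} [AddCommGroup G] (f : A →+ G) (a : A) : Gr.lift f (Gr.of a) = f a := by
  have := GrothendieckAddGroup.lift.symm_apply_apply f
  exact DFunLike.congr_fun this a

theorem Gr.exists_sub (x : Gr A) : ∃ a b, x = Gr.of a - Gr.of b := by
  obtain ⟨⟨a, b, hb⟩, hx⟩ : ∃ y : A × (⊤ : AddSubmonoid A), x = AddLocalization.mk y.1 y.2 :=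
    AddLocalization.ind (p := fun x => ∃ y : A × (⊤ : AddSubmonoid A), x = AddLocalization.mk y.1 y.2) (fun y => ⟨y, rfl⟩) x
  refine ⟨a, b, ?_⟩
  rw [eq_sub_iff_add_eq, hx]
  refine (AddLocalization.mk_add (S := (⊤ : AddSubmonoid A)) a b ⟨b, hb⟩ 0).trans ?_
  refine (AddLocalization.mk_eq_mk_iff.2 (AddLocalization.r_iff_exists.2 ⟨0, ?_⟩) :
    AddLocalization.mk (a + b) (⟨b, hb⟩ + 0) = AddLocalization.mk a (0 : (⊤ : AddSubmonoid A)))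
  simp [add_comm]

theorem Gr.of_eq {a b : A} : Gr.of a = Gr.of b ↔ ∃ c, a + c = b + c := by
  have : (Gr.of a = Gr.of b) ↔ (AddLocalization.mk a (0 : (⊤ : AddSubmonoid A)) = AddLocalization.mk b 0) := Iff.rfl
  rw [this, AddLocalization.mk_eq_mk_iff, AddLocalization.r_iff_exists]
  constructor
  · rintro ⟨c, h⟩; exact ⟨c, by simpa [add_comm] using h⟩
  · rintro ⟨c, h⟩; exact ⟨⟨c, trivial⟩, by simpa [add_comm] using h⟩

noncomputable def Gr.mulHom : Gr A →+ Gr A →+ Gr A :=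
  Gr.lift
    { toFun := fun a => Gr.lift (Gr.of.comp (AddMonoidHom.mulLeft a))
      map_zero' := by
        ext x; obtain ⟨a, b, rfl⟩ := Gr.exists_sub x; simp [Gr.lift_of]
      map_add' := fun a b => by
        ext x; obtain ⟨a, b, rfl⟩ := Gr.exists_sub x; simp [Gr.lift_of, add_mul]; abel }

noncomputable instance : Mul (Gr A) := ⟨fun x y => Gr.mulHom x y⟩
noncomputable instance : One (Gr A) := ⟨Gr.of 1⟩

theorem Gr.of_mul (a b : A) : Gr.of a * Gr.of b = Gr.of (a * b) := by
  show Gr.mulHom _ _ = _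
  simp [Gr.mulHom, Gr.lift_of]

theorem Gr.mul_add' (x y z : Gr A) : x * (y + z) = x * y + x * z := map_add _ _ _
theorem Gr.add_mul' (x y z : Gr A) : (x + y) * z = x * z + y * z := by
  show Gr.mulHom _ _ = Gr.mulHom _ _ + Gr.mulHom _ _
  simp
theorem Gr.mul_sub' (x y z : Gr A) : x * (y - z) = x * y - x * z := map_sub _ _ _
theorem Gr.sub_mul' (x y z : Gr A) : (x - y) * z = x * z - y * z := by
  show Gr.mulHom _ _ = Gr.mulHom _ _ - Gr.mulHom _ _
  simp

noncomputable instance : CommRing (Gr A) where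
  __ : AddCommGroup (Gr A) := inferInstance
  mul_assoc x y z := by
    obtain ⟨a, b, rfl⟩ := Gr.exists_sub x
    obtain ⟨c, d, rfl⟩ := Gr.exists_sub y
    obtain ⟨e, f, rfl⟩ := Gr.exists_sub z
    simp only [Gr.mul_sub', Gr.sub_mul', Gr.of_mul, mul_assoc]
    try abel
  mul_comm x y := by
    obtain ⟨a, b, rfl⟩ := Gr.exists_sub x
    obtain ⟨c, d, rfl⟩ := Gr.exists_sub y
    simp only [Gr.mul_sub', Gr.sub_mul', Gr.of_mul, mul_comm c, mul_comm d]
    try abel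
  one_mul x := by
    obtain ⟨a, b, rfl⟩ := Gr.exists_sub x
    show Gr.of 1 * _ = _
    simp only [Gr.mul_sub', Gr.of_mul, one_mul]
  mul_one x := by
    obtain ⟨a, b, rfl⟩ := Gr.exists_sub x
    show _ * Gr.of 1 = _
    simp only [Gr.sub_mul', Gr.of_mul, mul_one]
  zero_mul x := by show Gr.mulHom _ _ = _; simp
  mul_zero x := by show Gr.mulHom _ _ = _; simp
  left_distrib := Gr.mul_add'
  right_distrib := Gr.add_mul'

/-- lift to rings -/
noncomputable def Gr.liftRing {G : Type*} [CommRing G] (f : A →+* G) : Gr A →+* G where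
  __ := Gr.lift f.toAddMonoidHom
  map_one' := by
    show Gr.lift f.toAddMonoidHom (Gr.of 1) = 1
    rw [Gr.lift_of]; simp
  map_mul' x y := by
    show Gr.lift f.toAddMonoidHom _ = Gr.lift f.toAddMonoidHom _ * Gr.lift f.toAddMonoidHom _
    obtain ⟨a, b, rfl⟩ := Gr.exists_sub x
    obtain ⟨c, d, rfl⟩ := Gr.exists_sub y
    simp only [Gr.mul_sub', Gr.sub_mul', Gr.of_mul, map_sub, Gr.lift_of]
    simp
    ring

noncomputable def Gr.ofRing : A →+* Gr A where
  __ := Gr.of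
  map_one' := rfl
  map_mul' a b := (Gr.of_mul a b).symm

theorem Gr.liftRing_of {G : Type*} [CommRing G] (f : A →+* G) (a : A) :
    Gr.liftRing f (Gr.of a) = f a := Gr.lift_of _ _

end groth

section kk
variable {R S T : Type} [CommRing R] [CommRing S] [CommRing T]

/-- K-theory -/
abbrev K (R : Type) [CommRing R] : Type 1 := Gr (V R)

/-- class of a projection -/
noncomputable def cls (p : Pj R) : K R := Gr.of (V.mk p)

theorem cls_eq_of {p q : Pj R} (h : Eqv p q) : cls p = cls q := by
  unfold cls; rw [V.mk_eq.2 h]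

theorem cls_add (p q : Pj R) : cls (p.add q) = cls p + cls q := by
  unfold cls; rw [← map_add]; rfl

theorem cls_mul (p q : Pj R) : cls (p.mul q) = cls p * cls q := by
  unfold cls; rw [Gr.of_mul]; rfl

theorem cls_unit : cls (Pj.triv R Unit) = 1 := rfl

theorem K.exists_sub (x : K R) : ∃ p q : Pj R, x = cls p - cls q := by
  obtain ⟨a, b, rfl⟩ := Gr.exists_sub x
  induction a using V.ind; induction b using V.ind
  exact ⟨_, _, rfl⟩

/-- functoriality -/
noncomputable def K.map (f : R →+* S) : K R →+* K S := Gr.liftRing (Gr.ofRing.comp (V.map f))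

theorem K.map_cls (f : R →+* S) (p : Pj R) : K.map f (cls p) = cls (p.map f) := by
  unfold K.map cls
  rw [Gr.liftRing_of]; rfl

theorem K.map_map (f : R →+* S) (g : S →+* T) (x : K R) : K.map g (K.map f x) = K.map (g.comp f) x := by
  obtain ⟨p, q, rfl⟩ := K.exists_sub x
  simp only [map_sub, K.map_cls]; rfl

theorem K.map_id (x : K R) : K.map (RingHom.id R) x = x := by
  obtain ⟨p, q, rfl⟩ := K.exists_sub x
  simp only [map_sub, K.map_cls]; rfl

/-- sums of orthogonal idempotents -/
theorem cls_orth {ι : Type} [Fintype ι] [DecidableEq ι] (f g : Matrix ι ι R) (hf : f * f = f)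
    (hg : g * g = g) (hfg : f * g = 0) (hgf : g * f = 0) (hs : (f + g) * (f + g) = f + g) :
    cls ⟨ι, f + g, hs⟩ = cls ⟨ι, f, hf⟩ + cls ⟨ι, g, hg⟩ := by
  rw [← cls_add]
  refine cls_eq_of ⟨fromCols f g, fromRows f g, ?_, ?_⟩
  · rw [fromCols_mul_fromRows, hf, hg]
  · rw [fromRows_mul_fromCols, hf, hg, hfg, hgf]

theorem cls_compl (p : Pj R) : cls p + cls p.compl = cls (Pj.triv R p.ι) := by
  have := cls_orth p.e (1 - p.e) p.idem p.compl.idem (by rw [Matrix.mul_sub, p.idem]; simp)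
    (by rw [Matrix.sub_mul, p.idem]; simp) (by simp)
  rw [show cls p + cls p.compl = _ from this.symm]
  congr 1
  simp [Pj.triv]

theorem cls_triv (ι : Type) [Fintype ι] [DecidableEq ι] :
    cls (Pj.triv R ι) = (Fintype.card ι : K R) := by
  suffices h : ∀ n : ℕ, cls (Pj.triv R (Fin n)) = (n : K R) by
    rw [← h]
    refine cls_eq_of (Eqv.of_equiv (Fintype.equivFin ι) ?_)
    intro i j; simp [Pj.triv, Matrix.one_apply]
  intro n
  induction n with
  | zero =>
    rw [Nat.cast_zero, ← map_zero (Gr.of (A := V R)), V.zero_mk]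
    exact cls_eq_of (Eqv.of_equiv (Equiv.equivOfIsEmpty (Fin 0) Empty) (by intro i; exact i.elim0))
  | succ n ih =>
    rw [Nat.cast_succ, ← ih, ← cls_unit, ← cls_add]
    refine cls_eq_of (Eqv.of_equiv (finSumFinEquiv (m := n) (n := 1) |>.symm.trans (Equiv.sumCongr (Equiv.refl _) (Equiv.ofUnique _ _))) ?_)
    intro i j
    have : (Pj.add (Pj.triv R (Fin n)) (Pj.triv R Unit)).e = 1 := by simp [Pj.add, Pj.triv]
    rw [this]
    simp only [Pj.triv, Matrix.one_apply, EmbeddingLike.apply_eq_iff_eq]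

theorem cls_zero (ι : Type) [Fintype ι] [DecidableEq ι] (h) :
    cls (R := R) ⟨ι, 0, h⟩ = 0 := by
  rw [← map_zero (Gr.of (A := V R)), V.zero_mk]
  refine cls_eq_of ⟨0, 0, by simp, ?_⟩
  ext i; exact i.elim

/-- stable equivalence -/
theorem cls_eq_iff {p q : Pj R} : cls p = cls q ↔
    ∃ n : ℕ, Eqv (p.add (Pj.triv R (Fin n))) (q.add (Pj.triv R (Fin n))) := by
  constructor
  · intro h
    obtain ⟨c, hc⟩ := Gr.of_eq.1 h
    induction c using V.ind with
    | h r =>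
    have key : ∀ s : Pj R, Eqv (r.add s) (Pj.triv R (Fin (Fintype.card r.ι))) ∨ True := fun _ => Or.inr trivial
    have h1 : V.mk r + V.mk r.compl = V.mk (Pj.triv R (Fin (Fintype.card r.ι))) := by
      refine V.mk_eq.2 (Eqv.trans (q := Pj.triv R r.ι) ⟨fromRows r.e r.compl.e, fromCols r.e r.compl.e, ?_, ?_⟩ ?_)
      · have a1 : r.e * (1 - r.e) = 0 := by rw [Matrix.mul_sub, r.idem]; simp
        have a2 : (1 - r.e) * r.e = 0 := by rw [Matrix.sub_mul, r.idem]; simp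
        rw [fromRows_mul_fromCols, r.idem, r.compl.idem]
        simp [Pj.add, Pj.compl, a1, a2]
      · rw [fromCols_mul_fromRows, r.idem, r.compl.idem]
        simp [Pj.compl, Pj.triv]
      · refine Eqv.of_equiv (Fintype.equivFin r.ι) ?_
        intro i j; simp [Pj.triv, Matrix.one_apply]
    refine ⟨Fintype.card r.ι, V.mk_eq.1 ?_⟩
    rw [← V.add_mk, ← V.add_mk, ← h1, ← add_assoc, ← add_assoc, hc]
  · rintro ⟨n, h⟩
    have := cls_eq_of h
    rw [cls_add, cls_add] at this
    exact add_right_cancel this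

/-! trace -/
def V.tr : V R →+* R where
  toFun := Quotient.lift (fun p => p.e.trace) (by
    rintro p q ⟨x, y, h1, h2⟩
    simp only [← h1, ← h2]; exact Matrix.trace_mul_comm x y)
  map_zero' := by show Matrix.trace (1 : Matrix Empty Empty R) = 0; simp
  map_one' := by show Matrix.trace (1 : Matrix Unit Unit R) = 1; simp
  map_add' a b := by
    induction a using V.ind; induction b using V.ind
    show Matrix.trace (fromBlocks _ _ _ _) = Matrix.trace _ + Matrix.trace _
    simp [Matrix.trace]
  map_mul' a b := by
    induction a using V.ind; induction b using V.ind
    exact Matrix.trace_kronecker _ _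

noncomputable def K.tr : K R →+* R := Gr.liftRing V.tr
theorem K.tr_cls (p : Pj R) : K.tr (cls p) = p.e.trace := Gr.liftRing_of _ _
end kk
end BK

namespace BK
open Matrix Kronecker

section psi
variable {R S : Type} [CommRing R] [CommRing S] [Invertible (2 : R)] [Invertible (2 : S)]

/-- the flip -/
def flip (R : Type) [CommRing R] (ι : Type) [Fintype ι] [DecidableEq ι] : Matrix (ι × ι) (ι × ι) R :=
  (1 : Matrix (ι × ι) (ι × ι) R).submatrix Prod.swap id

variable {ι κ : Type} [Fintype ι] [DecidableEq ι] [Fintype κ] [DecidableEq κ]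

theorem flip_mul_apply {m : Type} (M : Matrix (ι × ι) m R) (a : ι × ι) (b : m) :
    (flip R ι * M) a b = M a.swap b := by
  simp [flip, Matrix.mul_apply, Matrix.one_apply]

theorem mul_flip_apply {m : Type} (M : Matrix m (ι × ι) R) (a : m) (b : ι × ι) :
    (M * flip R ι) a b = M a b.swap := by
  simp only [flip, Matrix.mul_apply, Matrix.submatrix_apply, Matrix.one_apply, id]
  rw [Finset.sum_eq_single b.swap]
  · simp
  · intro c _ hc
    rw [if_neg, mul_zero]
    intro h; apply hc; rw [← h]; simp
  · simp

theorem flip_flip : flip R ι * flip R ι = 1 := by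
  ext a b
  rw [flip_mul_apply]
  simp only [flip, submatrix_apply]; rw [Prod.swap_swap]; rfl

theorem flip_kron (A B : Matrix ι κ R) : flip R ι * (A ⊗ₖ B) = (B ⊗ₖ A) * flip R κ := by
  ext a b
  rw [flip_mul_apply, mul_flip_apply]
  simp [mul_comm]

/-- symmetrizer / antisymmetrizer -/
def sgP (σ : ℤˣ) (R : Type) [CommRing R] [Invertible (2 : R)] (ι : Type) [Fintype ι] [DecidableEq ι] :
    Matrix (ι × ι) (ι × ι) R := (⅟2 : R) • (1 + ((σ : ℤ) : R) • flip R ι)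

theorem sq_unit (σ : ℤˣ) : ((σ : ℤ) : R) * ((σ : ℤ) : R) = 1 := by
  rw [← Int.cast_mul, ← Units.val_mul, Int.units_mul_self]; simp

theorem sgP_flip (σ : ℤˣ) : ((σ : ℤ) : R) • (sgP σ R ι * flip R ι) = sgP σ R ι := by
  simp only [sgP, Matrix.smul_mul, Matrix.add_mul, flip_flip, Matrix.one_mul, smul_add, smul_smul]
  rw [add_comm]
  congr 2
  · rw [mul_left_comm, sq_unit, mul_one]
  · ring

theorem flip_sgP (σ : ℤˣ) : ((σ : ℤ) : R) • (flip R ι * sgP σ R ι) = sgP σ R ι := by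
  simp only [sgP, Matrix.mul_smul, Matrix.mul_add, flip_flip, Matrix.mul_one, smul_add, smul_smul]
  rw [add_comm]
  congr 2
  · rw [mul_left_comm, sq_unit, mul_one]
  · ring

theorem sgP_idem (σ : ℤˣ) : sgP σ R ι * sgP σ R ι = sgP σ R ι := by
  conv_lhs => rhs; rw [sgP]
  rw [Matrix.mul_smul, Matrix.mul_add, Matrix.mul_smul, sgP_flip, Matrix.mul_one, ← two_smul R, smul_smul]
  simp

theorem sgP_kron (σ : ℤˣ) (A : Matrix ι κ R) : sgP σ R ι * (A ⊗ₖ A) = (A ⊗ₖ A) * sgP σ R κ := by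
  simp only [sgP, Matrix.smul_mul, Matrix.mul_smul, Matrix.add_mul, Matrix.mul_add, flip_kron, Matrix.one_mul, Matrix.mul_one]

/-- Symmetric/exterior square -/
abbrev Sq (σ : ℤˣ) (p : Pj R) : Pj R where
  ι := p.ι × p.ι
  e := sgP σ R p.ι * (p.e ⊗ₖ p.e)
  idem := by
    rw [Matrix.mul_assoc, ← Matrix.mul_assoc (p.e ⊗ₖ p.e), ← sgP_kron, Matrix.mul_assoc, ← mul_kronecker_mul,
      p.idem, ← Matrix.mul_assoc, sgP_idem]

theorem Eqv.sq (σ : ℤˣ) {p q : Pj R} : Eqv p q → Eqv (Sq σ p) (Sq σ q) := by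
  rintro ⟨x, y, h1, h2⟩
  refine ⟨sgP σ R p.ι * (x ⊗ₖ x), sgP σ R q.ι * (y ⊗ₖ y), ?_, ?_⟩
  · rw [Matrix.mul_assoc, ← Matrix.mul_assoc (x ⊗ₖ x), ← sgP_kron, Matrix.mul_assoc, ← mul_kronecker_mul,
      h1, ← Matrix.mul_assoc, sgP_idem]
  · rw [Matrix.mul_assoc, ← Matrix.mul_assoc (y ⊗ₖ y), ← sgP_kron, Matrix.mul_assoc, ← mul_kronecker_mul,
      h2, ← Matrix.mul_assoc, sgP_idem]

theorem cls_sq_orth (σ : ℤˣ) (P Q : Matrix ι ι R) (hP : P * P = P) (hQ : Q * Q = Q)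
    (hPQ : P * Q = 0) (hQP : Q * P = 0) (hs : (P + Q) * (P + Q) = P + Q) :
    cls (Sq σ ⟨ι, P + Q, hs⟩) = cls (Sq σ ⟨ι, P, hP⟩) + cls (Sq σ ⟨ι, Q, hQ⟩) +
      cls ⟨ι, P, hP⟩ * cls ⟨ι, Q, hQ⟩ := by
  set s := sgP σ R ι with hsdef
  -- mixed part
  have e1 : ∀ A B : Matrix ι ι R, s * (A ⊗ₖ B + B ⊗ₖ A) = (A ⊗ₖ B + B ⊗ₖ A) * s := by
    intro A B
    simp only [hsdef, sgP, Matrix.smul_mul, Matrix.mul_smul, Matrix.add_mul, Matrix.mul_add, flip_kron, Matrix.one_mul, Matrix.mul_one]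
    simp only [smul_add]; abel
  have m1 : (P ⊗ₖ Q + Q ⊗ₖ P) * (P ⊗ₖ Q + Q ⊗ₖ P) = P ⊗ₖ Q + Q ⊗ₖ P := by
    simp only [Matrix.add_mul, Matrix.mul_add, ← mul_kronecker_mul, hP, hQ, hPQ, hQP]
    simp
  have hM : (s * (P ⊗ₖ Q + Q ⊗ₖ P)) * (s * (P ⊗ₖ Q + Q ⊗ₖ P)) = s * (P ⊗ₖ Q + Q ⊗ₖ P) := by
    rw [Matrix.mul_assoc, ← Matrix.mul_assoc _ s, ← e1, Matrix.mul_assoc, m1, ← Matrix.mul_assoc, sgP_idem]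
  have hmix : cls ⟨ι × ι, s * (P ⊗ₖ Q + Q ⊗ₖ P), hM⟩ = cls ⟨ι, P, hP⟩ * cls ⟨ι, Q, hQ⟩ := by
    rw [← cls_mul]
    have k1 : (P ⊗ₖ Q) * flip R ι = flip R ι * (Q ⊗ₖ P) := (flip_kron _ _).symm
    refine cls_eq_of ⟨s * (P ⊗ₖ Q), (2 : R) • ((P ⊗ₖ Q) * s), ?_, ?_⟩
    · have : s * (P ⊗ₖ Q) * ((2 : R) • ((P ⊗ₖ Q) * s)) = (2 : R) • (s * ((P ⊗ₖ Q) * s)) := by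
        rw [Matrix.mul_smul, Matrix.mul_assoc, ← Matrix.mul_assoc (P ⊗ₖ Q), ← mul_kronecker_mul, hP, hQ]
      rw [this]
      have h2 : (2 : R) • ((P ⊗ₖ Q) * s) = P ⊗ₖ Q + ((σ : ℤ) : R) • (flip R ι * (Q ⊗ₖ P)) := by
        simp only [hsdef, sgP, Matrix.mul_smul, Matrix.mul_add, Matrix.mul_one, k1, smul_smul, mul_invOf_self, one_smul]
      show _ = s * (P ⊗ₖ Q + Q ⊗ₖ P)
      rw [← Matrix.mul_smul, h2, Matrix.mul_add, Matrix.mul_add, Matrix.mul_smul, ← Matrix.mul_assoc, ← Matrix.smul_mul, sgP_flip]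
    · have h3 : (2 : R) • s = 1 + ((σ : ℤ) : R) • flip R ι := by
        simp [hsdef, sgP, smul_smul]
      have : ((2 : R) • ((P ⊗ₖ Q) * s)) * (s * (P ⊗ₖ Q)) = (P ⊗ₖ Q) * ((2 : R) • s) * (P ⊗ₖ Q) := by
        rw [Matrix.smul_mul, Matrix.mul_assoc, ← Matrix.mul_assoc s, sgP_idem, Matrix.mul_smul, Matrix.smul_mul, Matrix.mul_assoc]
      rw [this, h3, Matrix.mul_add, Matrix.add_mul, Matrix.mul_one, ← mul_kronecker_mul, hP, hQ, Matrix.mul_smul, k1,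
        Matrix.smul_mul, Matrix.mul_assoc, ← mul_kronecker_mul, hPQ, hQP]
      simp
  have c1 : (s * (P ⊗ₖ P) + s * (Q ⊗ₖ Q)) * (s * (P ⊗ₖ P) + s * (Q ⊗ₖ Q)) = s * (P ⊗ₖ P) + s * (Q ⊗ₖ Q) := by
    rw [← Matrix.mul_add]
    have : (P ⊗ₖ P + Q ⊗ₖ Q) * s = s * (P ⊗ₖ P + Q ⊗ₖ Q) := by
      rw [Matrix.mul_add, Matrix.add_mul, sgP_kron, sgP_kron]
    rw [Matrix.mul_assoc, ← Matrix.mul_assoc _ s, this, Matrix.mul_assoc, ← Matrix.mul_assoc s s, sgP_idem]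
    congr 1
    simp only [Matrix.add_mul, Matrix.mul_add, ← mul_kronecker_mul, hP, hQ, hPQ, hQP]
    simp
  have c2 := cls_orth (s * (P ⊗ₖ P)) (s * (Q ⊗ₖ Q)) (Sq σ ⟨ι, P, hP⟩).idem (Sq σ ⟨ι, Q, hQ⟩).idem
    (by rw [sgP_kron, Matrix.mul_assoc, ← Matrix.mul_assoc s s, sgP_idem, ← Matrix.mul_assoc, ← sgP_kron, Matrix.mul_assoc, ← mul_kronecker_mul, hPQ]; simp)
    (by rw [sgP_kron, Matrix.mul_assoc, ← Matrix.mul_assoc s s, sgP_idem, ← Matrix.mul_assoc, ← sgP_kron, Matrix.mul_assoc, ← mul_kronecker_mul, hQP]; simp)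
    c1
  have e3 : (s * (P ⊗ₖ P) + s * (Q ⊗ₖ Q)) + s * (P ⊗ₖ Q + Q ⊗ₖ P) = s * ((P + Q) ⊗ₖ (P + Q)) := by
    simp only [add_kronecker, kronecker_add, Matrix.mul_add]; abel
  have e2 : ∀ A B, ((s * A) * (s * B) : Matrix (ι × ι) (ι × ι) R) = (s * A) * (s * B) := fun _ _ => rfl
  have z1 : (s * (P ⊗ₖ P) + s * (Q ⊗ₖ Q)) * (s * (P ⊗ₖ Q + Q ⊗ₖ P)) = 0 := by
    have : (P ⊗ₖ P + Q ⊗ₖ Q) * s = s * (P ⊗ₖ P + Q ⊗ₖ Q) := by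
      rw [Matrix.mul_add, Matrix.add_mul, sgP_kron, sgP_kron]
    rw [← Matrix.mul_add, Matrix.mul_assoc, ← Matrix.mul_assoc _ s, this, Matrix.mul_assoc]
    have : (P ⊗ₖ P + Q ⊗ₖ Q) * (P ⊗ₖ Q + Q ⊗ₖ P) = 0 := by
      simp only [Matrix.add_mul, Matrix.mul_add, ← mul_kronecker_mul, hP, hQ, hPQ, hQP]
      simp
    rw [this]; simp
  have z2 : (s * (P ⊗ₖ Q + Q ⊗ₖ P)) * (s * (P ⊗ₖ P) + s * (Q ⊗ₖ Q)) = 0 := by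
    rw [← Matrix.mul_add, Matrix.mul_assoc, ← Matrix.mul_assoc _ s, ← e1, Matrix.mul_assoc]
    have : (P ⊗ₖ Q + Q ⊗ₖ P) * (P ⊗ₖ P + Q ⊗ₖ Q) = 0 := by
      simp only [Matrix.add_mul, Matrix.mul_add, ← mul_kronecker_mul, hP, hQ, hPQ, hQP]
      simp
    rw [this]; simp
  have c3 := cls_orth _ _ c1 hM z1 z2 (by rw [e3]; exact (Sq σ ⟨ι, P + Q, hs⟩).idem)
  rw [← hmix, ← c2, ← c3]
  congr 1
  simp only [Sq, ← hsdef, e3]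

theorem eqv_left (p : Pj R) (κ : Type) [Fintype κ] [DecidableEq κ] (h) :
    Eqv p ⟨p.ι ⊕ κ, fromBlocks p.e 0 0 0, h⟩ :=
  ⟨fromCols p.e 0, fromRows p.e 0, by rw [fromCols_mul_fromRows, p.idem]; simp,
    by rw [fromRows_mul_fromCols, p.idem]; simp⟩

theorem eqv_right (p : Pj R) (κ : Type) [Fintype κ] [DecidableEq κ] (h) :
    Eqv p ⟨κ ⊕ p.ι, fromBlocks 0 0 0 p.e, h⟩ :=
  ⟨fromCols 0 p.e, fromRows 0 p.e, by rw [fromCols_mul_fromRows, p.idem]; simp,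
    by rw [fromRows_mul_fromCols, p.idem]; simp⟩

theorem cls_sq_add (σ : ℤˣ) (p q : Pj R) :
    cls (Sq σ (p.add q)) = cls (Sq σ p) + cls (Sq σ q) + cls p * cls q := by
  have hP : (fromBlocks p.e 0 0 0 : Matrix (p.ι ⊕ q.ι) (p.ι ⊕ q.ι) R) * fromBlocks p.e 0 0 0 = fromBlocks p.e 0 0 0 := by
    simp [fromBlocks_multiply, p.idem]
  have hQ : (fromBlocks 0 0 0 q.e : Matrix (p.ι ⊕ q.ι) (p.ι ⊕ q.ι) R) * fromBlocks 0 0 0 q.e = fromBlocks 0 0 0 q.e := by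
    simp [fromBlocks_multiply, q.idem]
  have hs : (fromBlocks p.e 0 0 0 + fromBlocks 0 0 0 q.e : Matrix (p.ι ⊕ q.ι) (p.ι ⊕ q.ι) R) = fromBlocks p.e 0 0 q.e := by
    simp [fromBlocks_add]
  have := cls_sq_orth σ _ _ hP hQ (by simp [fromBlocks_multiply]) (by simp [fromBlocks_multiply])
    (by rw [hs]; exact (p.add q).idem)
  rw [cls_eq_of (eqv_left p q.ι hP), cls_eq_of (eqv_right q p.ι hQ), cls_eq_of (Eqv.sq σ (eqv_left p q.ι hP)),
    cls_eq_of (Eqv.sq σ (eqv_right q p.ι hQ)), ← this]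
  congr 1
  simp only [Sq, hs]

/-- second Adams operation -/
noncomputable def psiV : V R →+ K R where
  toFun := Quotient.lift (fun p => cls (Sq 1 p) - cls (Sq (-1) p)) (fun p q h => by
    simp only [cls_eq_of (Eqv.sq 1 h), cls_eq_of (Eqv.sq (-1) h)])
  map_zero' := by
    show cls _ - cls _ = 0
    rw [sub_eq_zero]
    refine cls_eq_of (Eqv.of_equiv (Equiv.refl (Empty × Empty)) ?_)
    intro i; exact i.1.elim
  map_add' a b := by
    induction a using V.ind; induction b using V.ind
    show cls (Sq 1 (Pj.add _ _)) - cls (Sq (-1) (Pj.add _ _)) = (cls _ - cls _) + (cls _ - cls _)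
    rw [cls_sq_add, cls_sq_add]; abel

noncomputable def psi : K R →+ K R := Gr.lift psiV

theorem psi_cls (p : Pj R) : psi (cls p) = cls (Sq 1 p) - cls (Sq (-1) p) := Gr.lift_of _ _

theorem map_flip (f : R →+* S) : (flip R ι).map f = flip S ι := by
  ext a b; simp [flip, Matrix.one_apply]

theorem map_sgP (f : R →+* S) (σ : ℤˣ) : (sgP σ R ι).map f = sgP σ S ι := by
  have h2 : f (⅟2 : R) = (⅟2 : S) := by
    have : (2 : S) * f (⅟2 : R) = 1 := by
      rw [← map_ofNat f 2, ← map_mul]; simp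
    rw [← invOf_mul_cancel_left (2 : S) (f (⅟2 : R)), this, mul_one]
  ext a b
  have h3 : f (flip R ι a b) = flip S ι a b := by rw [← map_flip f]; rfl
  simp only [sgP, map_apply, Matrix.smul_apply, Matrix.add_apply, smul_eq_mul, map_mul, map_add, h2, h3, map_intCast]
  congr 2
  simp [Matrix.one_apply]

theorem psi_map (f : R →+* S) (x : K R) : psi (K.map f x) = K.map f (psi x) := by
  have key : ∀ p : Pj R, psi (K.map f (cls p)) = K.map f (psi (cls p)) := by
    intro p
    have : ∀ σ : ℤˣ, cls (Sq σ (p.map f)) = cls ((Sq σ p).map f) := by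
      intro σ
      refine cls_eq_of (Eqv.of_equiv (Equiv.refl _) ?_)
      have : ((Sq σ p).map f).e = (Sq σ (p.map f)).e := by
        simp only [Sq, Pj.map, Matrix.map_mul, map_sgP]
        congr 1
        ext a b; simp
      intro i j
      rw [this]; rfl
    rw [K.map_cls, psi_cls, psi_cls, map_sub, K.map_cls, K.map_cls, this, this]
  obtain ⟨p, q, rfl⟩ := K.exists_sub x
  simp only [map_sub, key]

theorem sgP_add : sgP 1 R ι + sgP (-1) R ι = 1 := by
  simp only [sgP, ← smul_add]
  have : (1 + (((1 : ℤˣ) : ℤ) : R) • flip R ι + (1 + (((-1 : ℤˣ) : ℤ) : R) • flip R ι)) = (2 : R) • (1 : Matrix (ι × ι) (ι × ι) R) := by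
    rw [two_smul]; simp; abel
  rw [this, smul_smul]; simp

theorem sgP_mul_neg (σ : ℤˣ) : sgP σ R ι * sgP (-σ) R ι = 0 := by
  have h := sgP_add (R := R) (ι := ι)
  rcases Int.units_eq_one_or σ with rfl | rfl
  · rw [eq_sub_of_add_eq' h, Matrix.mul_sub, sgP_idem]; simp
  · rw [neg_neg, eq_sub_of_add_eq h, Matrix.mul_sub, sgP_idem]; simp

theorem cls_sq_sum (p : Pj R) : cls (Sq 1 p) + cls (Sq (-1) p) = cls p * cls p := by
  have hz1 : (Sq 1 p).e * (Sq (-1) p).e = 0 := by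
    simp only [Sq]
    rw [Matrix.mul_assoc, ← Matrix.mul_assoc (p.e ⊗ₖ p.e), ← sgP_kron, Matrix.mul_assoc, ← Matrix.mul_assoc, sgP_mul_neg]
    simp
  have hz2 : (Sq (-1) p).e * (Sq 1 p).e = 0 := by
    have h5 := sgP_mul_neg (R := R) (ι := p.ι) (-1)
    rw [neg_neg] at h5
    simp only [Sq]
    rw [Matrix.mul_assoc, ← Matrix.mul_assoc (p.e ⊗ₖ p.e), ← sgP_kron, Matrix.mul_assoc, ← Matrix.mul_assoc, h5]
    simp
  have hs : (Sq 1 p).e + (Sq (-1) p).e = p.e ⊗ₖ p.e := by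
    simp only [Sq]; rw [← Matrix.add_mul, sgP_add, Matrix.one_mul]
  have hs3 : ((Sq 1 p).e + (Sq (-1) p).e) * ((Sq 1 p).e + (Sq (-1) p).e) = (Sq 1 p).e + (Sq (-1) p).e := by
    rw [hs, ← mul_kronecker_mul, p.idem]
  have := cls_orth (ι := p.ι × p.ι) (Sq 1 p).e (Sq (-1) p).e (Sq 1 p).idem (Sq (-1) p).idem hz1
    hz2 hs3
  rw [← cls_mul, ← this]
  congr 1
  simp only [hs]

theorem psi_cls' (p : Pj R) : psi (cls p) = cls p * cls p - 2 * cls (Sq (-1) p) := by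
  rw [psi_cls, ← cls_sq_sum]; ring

theorem tr_psi (x : K R) : K.tr (psi x) = K.tr x := by
  have key : ∀ p : Pj R, K.tr (psi (cls p)) = K.tr (cls p) := by
    intro p
    rw [psi_cls, map_sub, K.tr_cls, K.tr_cls, K.tr_cls, ← Matrix.trace_sub]
    have : (Sq 1 p).e - (Sq (-1) p).e = flip R p.ι * (p.e ⊗ₖ p.e) := by
      simp only [Sq]
      rw [← Matrix.sub_mul]
      congr 1
      simp only [sgP, ← smul_sub]
      have : (1 + (((1 : ℤˣ) : ℤ) : R) • flip R p.ι - (1 + (((-1 : ℤˣ) : ℤ) : R) • flip R p.ι)) = (2 : R) • flip R p.ι := by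
        rw [two_smul]; simp; 
      rw [this, smul_smul]; simp
    have h2 : Matrix.trace (flip R p.ι * (p.e ⊗ₖ p.e)) = Matrix.trace (p.e * p.e) := by
      simp only [Matrix.trace, Matrix.diag, flip_mul_apply]
      simp only [Matrix.mul_apply, Fintype.sum_prod_type, Prod.swap, kroneckerMap_apply]
      refine Finset.sum_congr rfl fun a _ => Finset.sum_congr rfl fun b _ => mul_comm _ _
    have h3 : (Sq 1 p).e.trace - (Sq (-1) p).e.trace = p.e.trace := by
      rw [← Matrix.trace_sub, this, h2, p.idem]
    rw [Matrix.trace_sub]; exact h3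
  obtain ⟨p, q, rfl⟩ := K.exists_sub x
  simp only [map_sub, key]

theorem psi_mul_line (x : K R) (h : Pj R) (hh : ∀ i j k l, h.e i j * h.e k l = h.e k j * h.e i l) :
    psi (x * cls h) = psi x * (cls h * cls h) := by
  have key : ∀ p : Pj R, psi (cls p * cls h) = psi (cls p) * (cls h * cls h) := by
    intro p
    have : ∀ σ : ℤˣ, cls (Sq σ (p.mul h)) = cls (Sq σ p) * (cls h * cls h) := by
      intro σ
      rw [← cls_mul, ← cls_mul]
      refine cls_eq_of (Eqv.of_equiv (Equiv.prodProdProdComm _ _ _ _) ?_)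
      rintro ⟨⟨i, k⟩, ⟨j, l⟩⟩ ⟨⟨i', k'⟩, ⟨j', l'⟩⟩
      simp only [Sq, sgP, Matrix.smul_mul, Matrix.add_mul, Matrix.one_mul, Matrix.smul_apply, Matrix.add_apply,
        flip_mul_apply, Equiv.prodProdProdComm_apply, kroneckerMap_apply, Prod.swap, smul_eq_mul]
      have := hh l k' k l'
      linear_combination (-⅟2 * (((σ : ℤ) : R)) * p.e j i' * p.e i j') * this
    rw [← cls_mul, psi_cls, psi_cls, this, this]; ring
  obtain ⟨p, q, rfl⟩ := K.exists_sub x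
  simp only [map_sub, key, sub_mul]

end psi
end BK

namespace BK
open Matrix Kronecker Topology

abbrev I01 : Type := unitInterval

/-- pullback of functions -/
noncomputable abbrev pb {X Y : Type} [TopologicalSpace X] [TopologicalSpace Y] (f : C(X, Y)) : C(Y, ℂ) →+* C(X, ℂ) :=
  (ContinuousMap.compRightAlgHom ℂ ℂ f).toRingHom

theorem pb_apply {X Y : Type} [TopologicalSpace X] [TopologicalSpace Y] (f : C(X, Y)) (g : C(Y, ℂ)) (x : X) :
    pb f g x = g (f x) := rfl

/-- evaluation -/
noncomputable abbrev ev {X : Type} [TopologicalSpace X] (x : X) : C(X, ℂ) →+* ℂ :=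
  (ContinuousMap.evalAlgHom ℂ ℂ x).toRingHom

theorem ev_apply {X : Type} [TopologicalSpace X] (x : X) (f : C(X, ℂ)) : ev x f = f x := rfl

noncomputable instance inv2 {X : Type} [TopologicalSpace X] : Invertible (2 : C(X, ℂ)) where
  invOf := ContinuousMap.const X (1/2)
  invOf_mul_self := by ext x; show (1/2 : ℂ) * 2 = 1; norm_num
  mul_invOf_self := by ext x; show (2 : ℂ) * (1/2) = 1; norm_num

section mats
variable {X Y : Type} [TopologicalSpace X] [TopologicalSpace Y]
variable {ι κ : Type} [Fintype ι] [DecidableEq ι] [Fintype κ] [DecidableEq κ]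

theorem mat_ext {A B : Matrix ι κ C(X, ℂ)} (h : ∀ x, A.map (ev x) = B.map (ev x)) : A = B := by
  ext i j x
  exact congrFun (congrFun (h x) i) j

theorem isUnit_mat_iff {A : Matrix ι ι C(X, ℂ)} : IsUnit A ↔ ∀ x, (A.map (ev x)).det ≠ 0 := by
  rw [Matrix.isUnit_iff_isUnit_det, ContinuousMap.isUnit_iff_forall_ne_zero]
  refine forall_congr' fun x => ?_
  have : A.det x = (A.map (ev x)).det := by
    exact RingHom.map_det (ev x) A
  rw [this]

theorem isUnit_mat_iff' {A : Matrix ι ι C(X, ℂ)} : IsUnit A ↔ ∀ x, IsUnit (A.map (ev x)) := by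
  rw [isUnit_mat_iff]
  refine forall_congr' fun x => ?_
  rw [Matrix.isUnit_iff_isUnit_det, isUnit_iff_ne_zero]

theorem isUnit_of_ker {A : Matrix ι ι C(X, ℂ)} (h : ∀ x (v : ι → ℂ), A.map (ev x) *ᵥ v = 0 → v = 0) : IsUnit A := by
  rw [isUnit_mat_iff]
  intro x hx
  obtain ⟨v, hv, h0⟩ := Matrix.exists_mulVec_eq_zero_iff.2 hx
  exact hv (h x v h0)

end mats

theorem Eqv.of_conj {R : Type} [CommRing R] {ι : Type} [Fintype ι] [DecidableEq ι] {e e' v w : Matrix ι ι R} (he he')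
    (h1 : v * w = 1) (h2 : w * v = 1) (h : e * v = v * e') :
    Eqv (R := R) ⟨ι, e, he⟩ ⟨ι, e', he'⟩ := by
  refine ⟨v * e', e' * w, ?_, ?_⟩
  · rw [Matrix.mul_assoc, ← Matrix.mul_assoc e', he', ← Matrix.mul_assoc, ← h, Matrix.mul_assoc, h1, Matrix.mul_one]
  · rw [Matrix.mul_assoc, ← Matrix.mul_assoc w, h2, Matrix.one_mul, he']

section homotopy
variable {Y : Type} [TopologicalSpace Y] [CompactSpace Y]

/-- inclusion at time `t` -/
abbrev atT (Y : Type) [TopologicalSpace Y] (t : I01) : C(Y, I01 × Y) := ⟨fun y => (t, y), by fun_prop⟩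

theorem eqv_local (p : Pj C(I01 × Y, ℂ)) (t0 : I01) :
    ∀ᶠ t in 𝓝 t0, Eqv (p.map (pb (atT Y t))) (p.map (pb (atT Y t0))) := by
  let r : C(I01 × Y, I01 × Y) := ⟨fun x => (t0, x.2), by fun_prop⟩
  let e' := p.e.map (pb r)
  let v := p.e * e' + (1 - p.e) * (1 - e')
  let D : C(I01 × Y, ℂ) := v.det
  have he' : e' * e' = e' := (p.map (pb r)).idem
  have hv : p.e * v = v * e' := by
    simp only [v, Matrix.mul_add, Matrix.add_mul, Matrix.mul_sub, Matrix.sub_mul, Matrix.mul_one, Matrix.one_mul, ← Matrix.mul_assoc, p.idem]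
    simp only [Matrix.mul_assoc, he']
    abel
  have hrt : ∀ t, e'.map (pb (atT Y t)) = p.e.map (pb (atT Y t0)) := by
    intro t; ext i j y; rfl
  have hD0 : ∀ y, D (t0, y) = 1 := by
    intro y
    have h1 : v.map (pb (atT Y t0)) = 1 := by
      have : v.map (pb (atT Y t0)) = (pb (atT Y t0)).mapMatrix v := rfl
      rw [this]
      simp only [v, map_add, map_mul, map_sub, map_one, RingHom.mapMatrix_apply, hrt]
      have hq := (p.map (pb (atT Y t0))).idem
      simp only [Matrix.mul_sub, Matrix.sub_mul, Matrix.mul_one, Matrix.one_mul]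
      rw [hq]; abel
    have h2 : pb (atT Y t0) D = 1 := by
      rw [RingHom.map_det, RingHom.mapMatrix_apply, h1, Matrix.det_one]
    exact DFunLike.congr_fun h2 y
  have hev : ∀ᶠ t in 𝓝 t0, ∀ y ∈ (Set.univ : Set Y), D (t, y) ≠ 0 := by
    refine isCompact_univ.eventually_forall_of_forall_eventually ?_
    intro y _
    have : ContinuousAt (fun z : I01 × Y => D z) (t0, y) := D.continuous.continuousAt
    exact this.eventually_ne (by rw [hD0]; exact one_ne_zero)
  filter_upwards [hev] with t ht
  have hu : IsUnit (v.map (pb (atT Y t))) := by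
    rw [Matrix.isUnit_iff_isUnit_det, ContinuousMap.isUnit_iff_forall_ne_zero]
    intro y
    have : (v.map (pb (atT Y t))).det = pb (atT Y t) D := (RingHom.map_det (pb (atT Y t)) v).symm
    rw [this]
    exact ht y trivial
  obtain ⟨u, hu⟩ := hu
  refine Eqv.of_conj (v := v.map (pb (atT Y t))) (w := (↑u⁻¹ : Matrix _ _ _)) _ _ ?_ ?_ ?_
  · rw [← hu]; exact u.mul_inv
  · rw [← hu]; exact u.inv_mul
  · rw [← Matrix.map_mul, hv, Matrix.map_mul, hrt]

theorem eqv_homotopy (p : Pj C(I01 × Y, ℂ)) (s t : I01) :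
    Eqv (p.map (pb (atT Y s))) (p.map (pb (atT Y t))) := by
  have : IsLocallyConstant (fun t => V.mk (p.map (pb (atT Y t)))) := by
    rw [IsLocallyConstant.iff_eventually_eq]
    intro t0
    filter_upwards [eqv_local p t0] with t ht using V.mk_eq.2 ht
  exact V.mk_eq.1 (this.apply_eq_of_preconnectedSpace s t)

theorem kmap_homotopy (x : K C(I01 × Y, ℂ)) (s t : I01) :
    K.map (pb (atT Y s)) x = K.map (pb (atT Y t)) x := by
  obtain ⟨p, q, rfl⟩ := K.exists_sub x
  simp only [map_sub, K.map_cls, cls_eq_of (eqv_homotopy p s t), cls_eq_of (eqv_homotopy q s t)]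

end homotopy

/-! descent -/
theorem exists_desc {W X : Type} [TopologicalSpace W] [TopologicalSpace X] [CompactSpace W] [T2Space X]
    (π : C(W, X)) (hs : Function.Surjective π) (f : C(W, ℂ)) (h : ∀ w w', π w = π w' → f w = f w') :
    ∃ g : C(X, ℂ), pb π g = f := by
  have hq : IsQuotientMap π := IsQuotientMap.of_surjective_continuous hs π.continuous
  refine ⟨hq.lift f (fun a b hab => h a b hab), ?_⟩
  exact hq.lift_comp f _

theorem pb_inj {W X : Type} [TopologicalSpace W] [TopologicalSpace X] 
    (π : C(W, X)) (hs : Function.Surjective π) : Function.Injective (pb π) := by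
  intro f g h
  ext x
  obtain ⟨w, rfl⟩ := hs x
  exact DFunLike.congr_fun h w

theorem mat_desc {W X : Type} [TopologicalSpace W] [TopologicalSpace X] [CompactSpace W] [T2Space X]
    (π : C(W, X)) (hs : Function.Surjective π) {ι κ : Type} (f : Matrix ι κ C(W, ℂ))
    (h : ∀ w w', π w = π w' → f.map (ev w) = f.map (ev w')) :
    ∃ g : Matrix ι κ C(X, ℂ), g.map (pb π) = f := by
  have := fun i j => exists_desc π hs (f i j) (fun w w' hw => congrFun (congrFun (h w w' hw) i) j)
  choose g hg using this
  exact ⟨g, by ext1 i j; exact hg i j⟩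

theorem mat_pb_inj {W X : Type} [TopologicalSpace W] [TopologicalSpace X] 
    (π : C(W, X)) (hs : Function.Surjective π) {ι κ : Type} {f g : Matrix ι κ C(X, ℂ)}
    (h : f.map (pb π) = g.map (pb π)) : f = g := by
  ext1 i j
  exact pb_inj π hs (congrFun (congrFun h i) j)

end BK

namespace BK
open Matrix Kronecker Topology

/-- polar coordinates on the sphere -/
noncomputable def polRaw (x : I01 × Circle) : ℂ × I01 :=
  ((Real.sqrt (x.1 * (1 - x.1)) : ℂ) * x.2, x.1)

theorem polRaw_cont : Continuous polRaw := by
  unfold polRaw; fun_prop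

/-- the two-sphere, as the image of polar coordinates -/
abbrev S2 : Type := Set.range polRaw

noncomputable def pol : C(I01 × Circle, S2) := ⟨fun x => ⟨polRaw x, x, rfl⟩, by
  exact polRaw_cont.subtype_mk _⟩

instance : CompactSpace S2 := isCompact_iff_compactSpace.1 (isCompact_range polRaw_cont)

theorem pol_surj : Function.Surjective pol := by
  rintro ⟨_, x, rfl⟩; exact ⟨x, rfl⟩

theorem pol_eq {s s' : I01} {z z' : Circle} (h : pol (s, z) = pol (s', z')) :
    s = s' ∧ (z = z' ∨ s = 0 ∨ s = 1) := by
  have h1 : polRaw (s, z) = polRaw (s', z') := congrArg Subtype.val h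
  have h2 : s = s' := congrArg Prod.snd h1
  refine ⟨h2, ?_⟩
  subst h2
  have h3 : (Real.sqrt (s * (1 - s)) : ℂ) * z = (Real.sqrt (s * (1 - s)) : ℂ) * z' := congrArg Prod.fst h1
  by_cases h0 : Real.sqrt (s * (1 - s)) = 0
  · right
    rw [Real.sqrt_eq_zero (mul_nonneg s.2.1 (by linarith [s.2.2]))] at h0
    rcases mul_eq_zero.1 h0 with h | h
    · left; exact Subtype.ext h
    · right; exact Subtype.ext (by show (s : ℝ) = 1; linarith)
  · left
    exact Subtype.ext (mul_left_cancel₀ (by exact_mod_cast h0) h3)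

theorem pol_zero (z z' : Circle) : pol (0, z) = pol (0, z') := by
  apply Subtype.ext; simp [pol, polRaw]

theorem pol_one (z z' : Circle) : pol (1, z) = pol (1, z') := by
  apply Subtype.ext; simp [pol, polRaw]

section rings
variable (Y : Type) [TopologicalSpace Y]

abbrev RA : Type := C(Y, ℂ)
abbrev RS : Type := C(Y × S2, ℂ)
abbrev RW : Type := C(Y × (I01 × Circle), ℂ)
abbrev RL : Type := C(Y × Circle, ℂ)

noncomputable abbrev mpol : C(Y × (I01 × Circle), Y × S2) := ⟨fun x => (x.1, pol x.2), by fun_prop⟩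
noncomputable abbrev mat0 (s : I01) : C(Y × Circle, Y × (I01 × Circle)) := ⟨fun x => (x.1, (s, x.2)), by fun_prop⟩
noncomputable abbrev mj : C(Y × (I01 × Circle), Y × Circle) := ⟨fun x => (x.1, x.2.2), by fun_prop⟩
noncomputable abbrev mpr : C(Y × S2, Y) := ⟨fun x => x.1, by fun_prop⟩
noncomputable abbrev mpl : C(Y × Circle, Y) := ⟨fun x => x.1, by fun_prop⟩
noncomputable abbrev mk1 : C(Y, Y × Circle) := ⟨fun x => (x, 1), by fun_prop⟩
noncomputable abbrev mN : C(Y, Y × S2) := ⟨fun x => (x, pol (0, 1)), by fun_prop⟩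
noncomputable abbrev mS : C(Y, Y × S2) := ⟨fun x => (x, pol (1, 1)), by fun_prop⟩

variable {Y}

theorem mpol_surj : Function.Surjective (mpol Y) := by
  rintro ⟨y, x⟩
  obtain ⟨w, rfl⟩ := pol_surj x
  exact ⟨(y, w), rfl⟩

variable [CompactSpace Y] [T2Space Y] {ι κ μ : Type}

/-- good matrices: independent of the angle at the poles -/
def Good (G : Matrix ι κ (RW Y)) : Prop :=
  (∀ y z z', G.map (ev (y, ((0 : I01), z))) = G.map (ev (y, ((0 : I01), z')))) ∧
  (∀ y z z', G.map (ev (y, ((1 : I01), z))) = G.map (ev (y, ((1 : I01), z'))))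

theorem Good.desc {G : Matrix ι κ (RW Y)} (h : Good G) : ∃ g : Matrix ι κ (RS Y), g.map (pb (mpol Y)) = G := by
  refine mat_desc _ mpol_surj G ?_
  rintro ⟨y, s, z⟩ ⟨y', s', z'⟩ hw
  have h1 : y = y' := congrArg Prod.fst hw
  have h2 : pol (s, z) = pol (s', z') := congrArg Prod.snd hw
  subst h1
  obtain ⟨rfl, rfl | rfl | rfl⟩ := pol_eq h2
  · rfl
  · exact h.1 _ _ _
  · exact h.2 _ _ _

theorem good_pol (g : Matrix ι κ (RS Y)) : Good (g.map (pb (mpol Y))) := by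
  constructor
  · intro y z z'; ext i j
    show g i j (y, pol (0, z)) = g i j (y, pol (0, z'))
    rw [pol_zero z z']
  · intro y z z'; ext i j
    show g i j (y, pol (1, z)) = g i j (y, pol (1, z'))
    rw [pol_one z z']

theorem Good.mul [Fintype κ] {G : Matrix ι κ (RW Y)} {G' : Matrix κ μ (RW Y)} (h : Good G) (h' : Good G') : Good (G * G') := by
  constructor
  · intro y z z'; rw [Matrix.map_mul, Matrix.map_mul, h.1 y z z', h'.1 y z z']
  · intro y z z'; rw [Matrix.map_mul, Matrix.map_mul, h.2 y z z', h'.2 y z z']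

/-- convenient criterion -/
theorem good_of {G : Matrix ι κ (RW Y)} (G0 G1 : Matrix ι κ (RA Y))
    (h0 : G.map (pb (mat0 Y 0)) = G0.map (pb (mpl Y))) (h1 : G.map (pb (mat0 Y 1)) = G1.map (pb (mpl Y))) : Good G := by
  constructor
  · intro y z z'; ext i j
    have a := DFunLike.congr_fun (congrFun (congrFun h0 i) j) (y, z)
    have b := DFunLike.congr_fun (congrFun (congrFun h0 i) j) (y, z')
    exact a.trans b.symm
  · intro y z z'; ext i j
    have a := DFunLike.congr_fun (congrFun (congrFun h1 i) j) (y, z)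
    have b := DFunLike.congr_fun (congrFun (congrFun h1 i) j) (y, z')
    exact a.trans b.symm

/-- a polar frame -/
structure Fr (p : Pj (RS Y)) [Fintype κ] [DecidableEq κ] (X : Matrix p.ι κ (RW Y)) (Z : Matrix κ p.ι (RW Y)) : Prop where
  one : Z * X = 1
  eq : X * Z = p.e.map (pb (mpol Y))

variable [Fintype κ] [DecidableEq κ]

theorem Fr.cmp {p p' : Pj (RS Y)} {X : Matrix p.ι κ (RW Y)} {Z : Matrix κ p.ι (RW Y)}
    {X' : Matrix p'.ι κ (RW Y)} {Z' : Matrix κ p'.ι (RW Y)} (h : Fr p X Z) (h' : Fr p' X' Z')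
    (g : Good (X * Z')) (g' : Good (X' * Z)) : Eqv p p' := by
  obtain ⟨x, hx⟩ := g.desc
  obtain ⟨y, hy⟩ := g'.desc
  refine ⟨x, y, mat_pb_inj _ mpol_surj ?_, mat_pb_inj _ mpol_surj ?_⟩
  · rw [Matrix.map_mul, hx, hy, ← h.eq, Matrix.mul_assoc, ← Matrix.mul_assoc Z', h'.one, Matrix.one_mul]
  · rw [Matrix.map_mul, hx, hy, ← h'.eq, Matrix.mul_assoc, ← Matrix.mul_assoc Z, h.one, Matrix.one_mul]

theorem Fr.exists [Fintype ι] [DecidableEq ι] {X : Matrix ι κ (RW Y)} {Z : Matrix κ ι (RW Y)} (h : Z * X = 1)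
    (g : Good (X * Z)) : ∃ (e : Matrix ι ι (RS Y)) (he : e * e = e), e.map (pb (mpol Y)) = X * Z ∧ Fr ⟨ι, e, he⟩ X Z := by
  obtain ⟨e, he⟩ := g.desc
  refine ⟨e, mat_pb_inj _ mpol_surj ?_, he, ⟨h, he.symm⟩⟩
  rw [Matrix.map_mul, he, Matrix.mul_assoc, ← Matrix.mul_assoc Z, h, Matrix.one_mul]

end rings

section clutch
variable {Y : Type} [TopologicalSpace Y] [CompactSpace Y] [T2Space Y]
variable {ι κ : Type} [Fintype ι] [DecidableEq ι] [Fintype κ] [DecidableEq κ]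

noncomputable def cc (Y : Type) [TopologicalSpace Y] : RW Y := ⟨fun x => (Real.sqrt (1 - x.2.1) : ℂ), by fun_prop⟩
noncomputable def sn (Y : Type) [TopologicalSpace Y] : RW Y := ⟨fun x => (Real.sqrt (x.2.1) : ℂ), by fun_prop⟩

theorem cc_sn : cc Y * cc Y + sn Y * sn Y = 1 := by
  ext x
  show (Real.sqrt (1 - x.2.1) : ℂ) * (Real.sqrt (1 - x.2.1) : ℂ) + (Real.sqrt (x.2.1) : ℂ) * (Real.sqrt (x.2.1) : ℂ) = 1
  have h1 : Real.sqrt (1 - x.2.1) * Real.sqrt (1 - x.2.1) = 1 - x.2.1 := Real.mul_self_sqrt (by linarith [x.2.1.2.2])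
  have h2 : Real.sqrt (x.2.1) * Real.sqrt (x.2.1) = x.2.1 := Real.mul_self_sqrt x.2.1.2.1
  rw [← Complex.ofReal_mul, ← Complex.ofReal_mul, h1, h2]; push_cast; ring

theorem cc_0 : pb (mat0 Y 0) (cc Y) = 1 := by
  ext x; simp [cc, ContinuousMap.compRightAlgHom]
theorem cc_1 : pb (mat0 Y 1) (cc Y) = 0 := by
  ext x; simp [cc, ContinuousMap.compRightAlgHom]
theorem sn_0 : pb (mat0 Y 0) (sn Y) = 0 := by
  ext x; simp [sn, ContinuousMap.compRightAlgHom]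
theorem sn_1 : pb (mat0 Y 1) (sn Y) = 1 := by
  ext x; simp [sn, ContinuousMap.compRightAlgHom]

theorem map_one' {R S : Type} [CommRing R] [CommRing S] (f : R →+* S) : (1 : Matrix ι ι R).map f = 1 := by
  simp

section gen
variable {R S : Type} [CommRing R] [CommRing S]

theorem map_smul' (f : R →+* S) (r : R) (A : Matrix ι κ R) : (r • A).map f = f r • A.map f := by
  ext i j; simp

def frX (c s : R) (A : Matrix ι ι R) : Matrix (ι ⊕ ι) ι R := fromRows (c • 1) (s • A)
def frZ (c s : R) (A : Matrix ι ι R) : Matrix ι (ι ⊕ ι) R := fromCols (c • 1) (s • A)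

theorem frZX {c s : R} {A A' : Matrix ι ι R} (h : A' * A = 1) (hc : c * c + s * s = 1) : frZ c s A' * frX c s A = 1 := by
  rw [frZ, frX, fromCols_mul_fromRows, Matrix.smul_mul, Matrix.mul_smul, Matrix.smul_mul, Matrix.mul_smul, h,
    Matrix.mul_one, smul_smul, smul_smul, ← add_smul, hc, one_smul]

theorem frXZ (c s : R) (A A' : Matrix ι ι R) :
    frX c s A * frZ c s A' = fromBlocks ((c * c) • 1) ((c * s) • A') ((s * c) • A) ((s * s) • (A * A')) := by
  rw [frZ, frX, fromRows_mul_fromCols]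
  simp only [Matrix.smul_mul, Matrix.mul_smul, Matrix.mul_one, Matrix.one_mul, smul_smul, mul_comm]

theorem frX_map (f : R →+* S) (c s : R) (A : Matrix ι ι R) : (frX c s A).map f = frX (f c) (f s) (A.map f) := by
  rw [frX, fromRows_map, map_smul', map_smul', map_one', frX]
theorem frZ_map (f : R →+* S) (c s : R) (A : Matrix ι ι R) : (frZ c s A).map f = frZ (f c) (f s) (A.map f) := by
  rw [frZ, fromCols_map, map_smul', map_smul', map_one', frZ]
theorem frX_10 (A : Matrix ι ι R) : frX 1 0 A = fromRows 1 0 := by simp [frX]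
theorem frX_01 (A : Matrix ι ι R) : frX 0 1 A = fromRows 0 A := by simp [frX]
theorem frZ_10 (A : Matrix ι ι R) : frZ 1 0 A = fromCols 1 0 := by simp [frZ]
theorem frZ_01 (A : Matrix ι ι R) : frZ 0 1 A = fromCols 0 A := by simp [frZ]
end gen

/-- clutching frames -/
noncomputable def clX (α : (Matrix ι ι (RL Y))ˣ) : Matrix (ι ⊕ ι) ι (RW Y) :=
  frX (cc Y) (sn Y) ((α : Matrix ι ι (RL Y)).map (pb (mj Y)))
noncomputable def clZ (α : (Matrix ι ι (RL Y))ˣ) : Matrix ι (ι ⊕ ι) (RW Y) :=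
  frZ (cc Y) (sn Y) (((α⁻¹ : (Matrix ι ι (RL Y))ˣ) : Matrix ι ι (RL Y)).map (pb (mj Y)))

theorem clZX (α : (Matrix ι ι (RL Y))ˣ) : clZ α * clX α = 1 := by
  refine frZX ?_ cc_sn
  rw [← Matrix.map_mul, α.inv_mul, map_one']

theorem map_j (A : Matrix ι κ (RL Y)) (s : I01) : (A.map (pb (mj Y))).map (pb (mat0 Y s)) = A := by
  ext i j x; rfl

theorem clX_0 (α : (Matrix ι ι (RL Y))ˣ) : (clX α).map (pb (mat0 Y 0)) = fromRows 1 0 := by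
  rw [clX, frX_map, cc_0, sn_0, frX_10]
theorem clX_1 (α : (Matrix ι ι (RL Y))ˣ) : (clX α).map (pb (mat0 Y 1)) = fromRows 0 α := by
  rw [clX, frX_map, cc_1, sn_1, frX_01, map_j]
theorem clZ_0 (α : (Matrix ι ι (RL Y))ˣ) : (clZ α).map (pb (mat0 Y 0)) = fromCols 1 0 := by
  rw [clZ, frZ_map, cc_0, sn_0, frZ_10]
theorem clZ_1 (α : (Matrix ι ι (RL Y))ˣ) : (clZ α).map (pb (mat0 Y 1)) = fromCols 0 (α⁻¹ : (Matrix ι ι (RL Y))ˣ) := by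
  rw [clZ, frZ_map, cc_1, sn_1, frZ_01, map_j]

theorem cl_good (α : (Matrix ι ι (RL Y))ˣ) : Good (clX α * clZ α) := by
  refine good_of (fromBlocks 1 0 0 0) (fromBlocks 0 0 0 1) ?_ ?_
  · rw [Matrix.map_mul, clX_0, clZ_0, fromRows_mul_fromCols, fromBlocks_map]; simp
  · rw [Matrix.map_mul, clX_1, clZ_1, fromRows_mul_fromCols, fromBlocks_map]; simp

/-- clutching construction -/
noncomputable def clE (α : (Matrix ι ι (RL Y))ˣ) : Matrix (ι ⊕ ι) (ι ⊕ ι) (RS Y) :=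
  (Fr.exists (clZX α) (cl_good α)).choose

theorem clE_idem (α : (Matrix ι ι (RL Y))ˣ) : clE α * clE α = clE α :=
  (Fr.exists (clZX α) (cl_good α)).choose_spec.choose

noncomputable abbrev cl (α : (Matrix ι ι (RL Y))ˣ) : Pj (RS Y) where
  ι := ι ⊕ ι
  e := clE α
  idem := clE_idem α

theorem cl_e (α : (Matrix ι ι (RL Y))ˣ) : (clE α).map (pb (mpol Y)) = clX α * clZ α :=
  (Fr.exists (clZX α) (cl_good α)).choose_spec.choose_spec.1

theorem cl_fr (α : (Matrix ι ι (RL Y))ˣ) : Fr (cl α) (clX α) (clZ α) :=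
  (Fr.exists (clZX α) (cl_good α)).choose_spec.choose_spec.2

noncomputable def kap (α : (Matrix ι ι (RL Y))ˣ) : K (RS Y) := cls (cl α)

end clutch
end BK

namespace BK
open Matrix Kronecker Topology

section umap
variable {R S T : Type} [CommRing R] [CommRing S] [CommRing T]
variable {ι κ : Type} [Fintype ι] [DecidableEq ι] [Fintype κ] [DecidableEq κ]

abbrev umap (f : R →+* S) : (Matrix ι ι R)ˣ →* (Matrix ι ι S)ˣ := Units.map (f.mapMatrix (m := ι)).toMonoidHom

theorem umap_val (f : R →+* S) (α : (Matrix ι ι R)ˣ) : ((umap f α : (Matrix ι ι S)ˣ) : Matrix ι ι S) = (α : Matrix ι ι R).map f := rfl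
theorem umap_inv (f : R →+* S) (α : (Matrix ι ι R)ˣ) :
    (((umap f α)⁻¹ : (Matrix ι ι S)ˣ) : Matrix ι ι S) = ((α⁻¹ : (Matrix ι ι R)ˣ) : Matrix ι ι R).map f := rfl

/-- block sum -/
def udiag (α : (Matrix ι ι R)ˣ) (β : (Matrix κ κ R)ˣ) : (Matrix (ι ⊕ κ) (ι ⊕ κ) R)ˣ where
  val := fromBlocks α 0 0 β
  inv := fromBlocks (α⁻¹ : (Matrix ι ι R)ˣ) 0 0 (β⁻¹ : (Matrix κ κ R)ˣ)
  val_inv := by simp [fromBlocks_multiply]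
  inv_val := by simp [fromBlocks_multiply]

/-- unipotent -/
def uunip (N : Matrix ι ι R) (h : N * N = 0) : (Matrix ι ι R)ˣ where
  val := 1 + N
  inv := 1 - N
  val_inv := by simp [Matrix.add_mul, Matrix.mul_sub, h]
  inv_val := by simp [Matrix.mul_add, Matrix.sub_mul, h]
end umap

section clutch
variable {Y Y' : Type} [TopologicalSpace Y] [CompactSpace Y] [T2Space Y] [TopologicalSpace Y'] [CompactSpace Y'] [T2Space Y']
variable {ι κ : Type} [Fintype ι] [DecidableEq ι] [Fintype κ] [DecidableEq κ]

theorem cl_e' (α : (Matrix ι ι (RL Y))ˣ) : (clE α).map (pb (mpol Y)) =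
    fromBlocks ((cc Y * cc Y) • (1 : Matrix ι ι C(Y × (I01 × Circle), ℂ)))
      ((cc Y * sn Y) • ((α⁻¹ : (Matrix ι ι (RL Y))ˣ) : Matrix ι ι (RL Y)).map (pb (mj Y)))
      ((sn Y * cc Y) • (α : Matrix ι ι (RL Y)).map (pb (mj Y))) ((sn Y * sn Y) • 1) := by
  rw [cl_e, clX, clZ, frXZ, ← Matrix.map_mul, α.mul_inv, map_one']

/-- pointwise formula -/
theorem cl_ev (α : (Matrix ι ι (RL Y))ˣ) (y : Y) (s : I01) (z : Circle) : (clE α).map (ev (y, pol (s, z))) =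
    fromBlocks ((cc Y (y, s, z) * cc Y (y, s, z)) • (1 : Matrix ι ι ℂ))
      ((cc Y (y, s, z) * sn Y (y, s, z)) • ((α⁻¹ : (Matrix ι ι (RL Y))ˣ) : Matrix ι ι (RL Y)).map (ev (y, z)))
      ((sn Y (y, s, z) * cc Y (y, s, z)) • (α : Matrix ι ι (RL Y)).map (ev (y, z))) ((sn Y (y, s, z) * sn Y (y, s, z)) • 1) := by
  have : (clE α).map (ev (y, pol (s, z))) = ((clE α).map (pb (mpol Y))).map (ev (y, s, z)) := rfl
  rw [this, cl_e', fromBlocks_map]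
  congr 1 <;> ext i j <;> simp [Matrix.one_apply] <;> try rfl
  · split_ifs <;> rfl
  · split_ifs <;> rfl

theorem mat_ext_pol {A B : Matrix ι κ (RS Y)} (h : ∀ y s z, A.map (ev (y, pol (s, z))) = B.map (ev (y, pol (s, z)))) : A = B := by
  apply mat_ext
  rintro ⟨y, x⟩
  obtain ⟨⟨s, z⟩, rfl⟩ := pol_surj x
  exact h y s z

abbrev gS (g : C(Y', Y)) : C(Y' × S2, Y × S2) := ⟨fun x => (g x.1, x.2), by fun_prop⟩
noncomputable abbrev gL (g : C(Y', Y)) : C(Y' × Circle, Y × Circle) := ⟨fun x => (g x.1, x.2), by fun_prop⟩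

theorem cl_map (g : C(Y', Y)) (α : (Matrix ι ι (RL Y))ˣ) :
    (clE (umap (pb (gL g)) α)) = (clE α).map (pb (gS g)) := by
  refine mat_ext_pol (Y := Y') (ι := ι ⊕ ι) (κ := ι ⊕ ι) ?_
  intro y s z
  have : ((clE α).map (pb (gS g))).map (ev (y, pol (s, z))) = (clE α).map (ev (g y, pol (s, z))) := rfl
  rw [cl_ev, this, cl_ev]; rfl

theorem kap_map (g : C(Y', Y)) (α : (Matrix ι ι (RL Y))ˣ) :
    K.map (pb (gS g)) (kap α) = kap (umap (pb (gL g)) α) := by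
  rw [kap, kap, K.map_cls]
  refine (cls_eq_of (Eqv.of_equiv (Equiv.refl (ι ⊕ ι)) ?_))
  intro i j
  exact congrFun (congrFun (cl_map g α) i) j

theorem kap_homotopy (α : (Matrix ι ι (RL (I01 × Y)))ˣ) (s t : I01) :
    kap (umap (pb (gL (atT Y s))) α) = kap (umap (pb (gL (atT Y t))) α) := by
  rw [← kap_map, ← kap_map]
  let m : C(I01 × (Y × S2), (I01 × Y) × S2) := ⟨fun x => ((x.1, x.2.1), x.2.2), by fun_prop⟩
  have h : ∀ t, K.map (pb (gS (atT Y t))) (kap α) = K.map (pb (atT (Y × S2) t)) (K.map (pb m) (kap α)) := by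
    intro t; rw [K.map_map]; rfl
  rw [h, h]; exact kmap_homotopy _ _ _

theorem kap_path {α β : (Matrix ι ι (RL Y))ˣ} (F : Matrix ι ι (RL (I01 × Y))) (hF : IsUnit F)
    (h0 : F.map (pb (gL (atT Y 0))) = α) (h1 : F.map (pb (gL (atT Y 1))) = β) : kap α = kap β := by
  obtain ⟨u, rfl⟩ := hF
  have e0 : umap (pb (gL (atT Y 0))) u = α := Units.ext h0
  have e1 : umap (pb (gL (atT Y 1))) u = β := Units.ext h1
  rw [← e0, ← e1]; exact kap_homotopy _ _ _

/-- straight segment between matrices -/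
noncomputable def seg (A B : Matrix ι κ (RL Y)) : Matrix ι κ (RL (I01 × Y)) := Matrix.of fun i j =>
  ⟨fun x => A i j (x.1.2, x.2) + (((x.1.1 : ℝ) : ℂ)) * (B i j (x.1.2, x.2) - A i j (x.1.2, x.2)), by fun_prop⟩

theorem seg_ev (A B : Matrix ι κ (RL Y)) (t : I01) (y : Y) (z : Circle) :
    (seg A B).map (ev ((t, y), z)) = A.map (ev (y, z)) + ((t : ℝ) : ℂ) • (B.map (ev (y, z)) - A.map (ev (y, z))) := by
  ext i j; rfl

theorem seg_0 (A B : Matrix ι κ (RL Y)) : (seg A B).map (pb (gL (atT Y 0))) = A := by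
  ext i j x; simp [seg, pb_apply]
theorem seg_1 (A B : Matrix ι κ (RL Y)) : (seg A B).map (pb (gL (atT Y 1))) = B := by
  ext i j x; simp [seg, pb_apply]

theorem seg_unit {A B : Matrix ι ι (RL Y)}
    (h : ∀ t : I01, ∀ x, IsUnit (A.map (ev x) + ((t : ℝ) : ℂ) • (B.map (ev x) - A.map (ev x)))) : IsUnit (seg A B) := by
  rw [isUnit_mat_iff']
  rintro ⟨⟨t, y⟩, z⟩
  rw [seg_ev]; exact h t (y, z)

theorem kap_seg {α β : (Matrix ι ι (RL Y))ˣ}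
    (h : ∀ t : I01, ∀ x, IsUnit ((α : Matrix ι ι (RL Y)).map (ev x) + ((t : ℝ) : ℂ) • ((β : Matrix ι ι (RL Y)).map (ev x) - (α : Matrix ι ι (RL Y)).map (ev x)))) :
    kap α = kap β := kap_path (seg α β) (seg_unit h) (seg_0 _ _) (seg_1 _ _)

theorem kap_mul_unip (α : (Matrix ι ι (RL Y))ˣ) (N : Matrix ι ι (RL Y)) (h : N * N = 0) :
    kap α = kap (α * uunip N h) := by
  refine kap_seg ?_
  intro t x
  have hN : (N.map (ev x)) * (N.map (ev x)) = 0 := by rw [← Matrix.map_mul, h]; ext; rfl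
  have h1 : IsUnit ((α : Matrix ι ι (RL Y)).map (ev x)) := (umap (ev x) α).isUnit
  have h2 := (uunip ((((t : ℝ) : ℂ)) • N.map (ev x)) (by rw [Matrix.smul_mul, Matrix.mul_smul, hN]; simp)).isUnit
  have := h1.mul h2
  convert this using 1
  have h3 : ((α * uunip N h : (Matrix ι ι (RL Y))ˣ) : Matrix ι ι (RL Y)) = α * (1 + N) := rfl
  have h4 : (α * (1 + N) : Matrix ι ι (RL Y)).map (ev x) = (α : Matrix ι ι (RL Y)).map (ev x) * (1 + N.map (ev x)) := by
    rw [Matrix.map_mul]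
    congr 1
    ext i j; simp [Matrix.one_apply]; split_ifs <;> rfl
  rw [h3, h4]
  show _ = (α : Matrix ι ι (RL Y)).map (ev x) * (1 + (((t : ℝ) : ℂ)) • N.map (ev x))
  simp [Matrix.mul_add]

theorem kap_add (α : (Matrix ι ι (RL Y))ˣ) (β : (Matrix κ κ (RL Y))ˣ) : kap (udiag α β) = kap α + kap β := by
  rw [kap, kap, kap, ← cls_add]
  refine cls_eq_of (Eqv.of_equiv (Equiv.sumSumSumComm ι κ ι κ) ?_)
  have : (fromBlocks (clE α) 0 0 (clE β)).submatrix (Equiv.sumSumSumComm ι κ ι κ) (Equiv.sumSumSumComm ι κ ι κ) = (clE (udiag α β)) := by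
    refine mat_ext_pol (Y := Y) (ι := (ι ⊕ κ) ⊕ (ι ⊕ κ)) (κ := (ι ⊕ κ) ⊕ (ι ⊕ κ)) ?_
    intro y s z
    rw [cl_ev, ← submatrix_map, fromBlocks_map, cl_ev, cl_ev]
    ext i j
    rcases i with (i | i) | (i | i) <;> rcases j with (j | j) | (j | j) <;> simp [udiag, Matrix.one_apply] <;> try rfl
  intro i j
  exact congrFun (congrFun this i) j

theorem kap_const (g : (Matrix ι ι (RA Y))ˣ) : kap (umap (pb (mpl Y)) g) = (Fintype.card ι : K (RS Y)) := by
  rw [← cls_triv, kap]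
  have hf : Fr (Pj.triv (RS Y) ι) (1 : Matrix ι ι (RW Y)) 1 := ⟨by simp, by simp⟩
  refine cls_eq_of (Fr.cmp (cl_fr _) hf ?_ ?_)
  · refine good_of (fromRows 1 0) (fromRows 0 (g : Matrix ι ι (RA Y))) ?_ ?_
    · rw [Matrix.mul_one, clX_0]; ext (i | i) j : 2 <;> simp [Matrix.one_apply]
    · rw [Matrix.mul_one, clX_1]; ext (i | i) j : 2 <;> simp [Matrix.one_apply]
  · refine good_of (fromCols 1 0) (fromCols 0 ((g⁻¹ : (Matrix ι ι (RA Y))ˣ) : Matrix ι ι (RA Y))) ?_ ?_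
    · rw [Matrix.one_mul, clZ_0]; ext i (j | j) : 2 <;> simp [Matrix.one_apply]
    · rw [Matrix.one_mul, clZ_1]; ext i (j | j) : 2 <;> simp [Matrix.one_apply]

theorem kap_one : kap (1 : (Matrix ι ι (RL Y))ˣ) = (Fintype.card ι : K (RS Y)) := by
  rw [← kap_const (1 : (Matrix ι ι (RA Y))ˣ), map_one]

end clutch
end BK

namespace BK
open Matrix Kronecker Topology

section gen
variable {R S : Type} [CommRing R] [CommRing S] {ι κ : Type} [Fintype ι] [DecidableEq ι] [Fintype κ] [DecidableEq κ]

def uup (B : Matrix ι κ R) : (Matrix (ι ⊕ κ) (ι ⊕ κ) R)ˣ := uunip (fromBlocks 0 B 0 0) (by simp [fromBlocks_multiply])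
def ulo (B : Matrix κ ι R) : (Matrix (ι ⊕ κ) (ι ⊕ κ) R)ˣ := uunip (fromBlocks 0 0 B 0) (by simp [fromBlocks_multiply])

theorem uup_val (B : Matrix ι κ R) : (uup B : Matrix (ι ⊕ κ) (ι ⊕ κ) R) = fromBlocks 1 B 0 1 := by
  show 1 + _ = _
  rw [← fromBlocks_one, fromBlocks_add]; simp
theorem ulo_val (B : Matrix κ ι R) : (ulo B : Matrix (ι ⊕ κ) (ι ⊕ κ) R) = fromBlocks 1 0 B 1 := by
  show 1 + _ = _
  rw [← fromBlocks_one, fromBlocks_add]; simp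

theorem whitehead (β : (Matrix ι ι R)ˣ) :
    udiag β β⁻¹ = uup (β : Matrix ι ι R) * ulo (-((β⁻¹ : (Matrix ι ι R)ˣ) : Matrix ι ι R)) * uup (β : Matrix ι ι R) *
      uup (-1 : Matrix ι ι R) * ulo (1 : Matrix ι ι R) * uup (-1 : Matrix ι ι R) := by
  apply Units.ext
  simp only [Units.val_mul, uup_val, ulo_val]
  show fromBlocks (β : Matrix ι ι R) 0 0 ((β⁻¹ : (Matrix ι ι R)ˣ) : Matrix ι ι R) = _
  simp [fromBlocks_multiply]

theorem map_one_sub (f : R →+* S) (q : Matrix ι ι R) : (1 - q).map f = 1 - q.map f := by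
  simpa using map_sub f.mapMatrix 1 q

/-- `z q + (1 - q)` -/
def Lu (z : Rˣ) (q : Matrix ι ι R) (h : q * q = q) : (Matrix ι ι R)ˣ where
  val := (z : R) • q + (1 - q)
  inv := ((z⁻¹ : Rˣ) : R) • q + (1 - q)
  val_inv := by
    simp only [Matrix.add_mul, Matrix.mul_add, Matrix.smul_mul, Matrix.mul_smul, Matrix.mul_sub, Matrix.sub_mul, h,
      Matrix.mul_one, Matrix.one_mul, smul_smul, sub_self, smul_zero]
    simp [smul_smul]
  inv_val := by
    simp only [Matrix.add_mul, Matrix.mul_add, Matrix.smul_mul, Matrix.mul_smul, Matrix.mul_sub, Matrix.sub_mul, h,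
      Matrix.mul_one, Matrix.one_mul, smul_smul, sub_self, smul_zero]
    simp [smul_smul]

end gen

section clutch
variable {Y Y' : Type} [TopologicalSpace Y] [CompactSpace Y] [T2Space Y] [TopologicalSpace Y'] [CompactSpace Y'] [T2Space Y']
variable {ι κ : Type} [Fintype ι] [DecidableEq ι] [Fintype κ] [DecidableEq κ]

theorem kap_mul (α β : (Matrix ι ι (RL Y))ˣ) : kap (α * β) + (Fintype.card ι : K (RS Y)) = kap α + kap β := by
  rw [← kap_one (ι := ι), ← kap_add, ← kap_add]
  have : udiag (α * β) 1 = udiag α β * udiag β β⁻¹ := by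
    apply Units.ext
    show fromBlocks (α * β : Matrix ι ι (RL Y)) 0 0 1 = fromBlocks (α : Matrix ι ι (RL Y)) 0 0 β * fromBlocks (β : Matrix ι ι (RL Y)) 0 0 ((β⁻¹ : (Matrix ι ι (RL Y))ˣ) : Matrix ι ι (RL Y))
    simp [fromBlocks_multiply]
  rw [this, whitehead]
  simp only [← mul_assoc]
  simp only [uup, ulo]
  rw [← kap_mul_unip, ← kap_mul_unip, ← kap_mul_unip, ← kap_mul_unip, ← kap_mul_unip, ← kap_mul_unip]

theorem kap_inv (α : (Matrix ι ι (RL Y))ˣ) : kap α⁻¹ = 2 * (Fintype.card ι : K (RS Y)) - kap α := by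
  have := kap_mul α α⁻¹
  rw [mul_inv_cancel, kap_one] at this
  linear_combination -this

variable (Y) in
/-- the coordinate on the circle -/
noncomputable def zu : (RL Y)ˣ where
  val := ⟨fun x => (x.2 : ℂ), by fun_prop⟩
  inv := ⟨fun x => ((x.2⁻¹ : Circle) : ℂ), by fun_prop⟩
  val_inv := by ext x; simp
  inv_val := by ext x; simp

theorem zu_ap (x : Y × Circle) : (zu Y : RL Y) x = x.2 := rfl
theorem zu_inv_ap (x : Y × Circle) : (((zu Y)⁻¹ : (RL Y)ˣ) : RL Y) x = ((x.2⁻¹ : Circle) : ℂ) := rfl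

noncomputable def Lq (q : Matrix ι ι (RA Y)) (h : q * q = q) : (Matrix ι ι (RL Y))ˣ :=
  Lu (zu Y) (q.map (pb (mpl Y))) (by rw [← Matrix.map_mul, h])

theorem Lq_ev (q : Matrix ι ι (RA Y)) (h : q * q = q) (y : Y) (z : Circle) :
    (Lq q h : Matrix ι ι (RL Y)).map (ev (y, z)) = (z : ℂ) • q.map (ev y) + (1 - q.map (ev y)) := by
  ext i j; simp [Lq, Lu, zu_ap, Matrix.one_apply, pb_apply]; split_ifs <;> simp

theorem Lq_inv_ev (q : Matrix ι ι (RA Y)) (h : q * q = q) (y : Y) (z : Circle) :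
    (((Lq q h)⁻¹ : (Matrix ι ι (RL Y))ˣ) : Matrix ι ι (RL Y)).map (ev (y, z)) = ((z⁻¹ : Circle) : ℂ) • q.map (ev y) + (1 - q.map (ev y)) := by
  show (((zu Y)⁻¹ : (RL Y)ˣ) • q.map (pb (mpl Y)) + (1 - q.map (pb (mpl Y))) : Matrix ι ι (RL Y)).map (ev (y, z)) = _
  ext i j; simp [Matrix.one_apply, pb_apply, Units.smul_def, zu_inv_ap]; split_ifs <;> simp

variable (Y) in
/-- scalar loop -/
noncomputable def zU : (Matrix Unit Unit (RL Y))ˣ := Lq 1 (by simp)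
variable (Y) in
/-- Hopf class -/
noncomputable def Hh : K (RS Y) := kap (zU Y)

theorem compl_idem {R : Type} [CommRing R] {q : Matrix ι ι R} (h : q * q = q) : (1 - q) * (1 - q) = 1 - q := by
  simp [Matrix.mul_sub, Matrix.sub_mul, h]

def unitSumEquiv (ι : Type) : (Unit ⊕ Unit) × ι ≃ ι ⊕ ι :=
  (Equiv.sumProdDistrib Unit Unit ι).trans (Equiv.sumCongr (Equiv.punitProd ι) (Equiv.punitProd ι))

theorem zU_ev (y : Y) (z : Circle) :
    (zU Y : Matrix Unit Unit (RL Y)).map (ev (y, z)) = (z : ℂ) • 1 := by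
  rw [zU, Lq_ev]; ext i j; simp
theorem zU_inv_ev (y : Y) (z : Circle) :
    (((zU Y)⁻¹ : (Matrix Unit Unit (RL Y))ˣ) : Matrix Unit Unit (RL Y)).map (ev (y, z)) = ((z⁻¹ : Circle) : ℂ) • 1 := by
  rw [zU, Lq_inv_ev]; ext i j; simp

theorem kap_L (q : Matrix ι ι (RA Y)) (h : q * q = q) : kap (Lq q h) =
    K.map (pb (mpr Y)) (cls ⟨ι, q, h⟩) * Hh Y + K.map (pb (mpr Y)) (cls ⟨ι, 1 - q, compl_idem h⟩) := by
  have h1 : cls (cl (1 : (Matrix Unit Unit (RL Y))ˣ)) = 1 := by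
    have := kap_one (Y := Y) (ι := Unit); simpa [kap] using this
  rw [Hh, kap, kap, K.map_cls, K.map_cls, mul_comm, ← cls_mul, ← one_mul (cls (Pj.map _ ⟨ι, 1 - q, _⟩)), ← h1, ← cls_mul]
  have hq := h
  set q' := q.map (pb (mpr Y)) with hq'
  have hqq : q' * q' = q' := by rw [hq', ← Matrix.map_mul, h]
  have hqc : (1 - q).map (pb (mpr Y)) = 1 - q' := by
    rw [map_one_sub]
  have i1 : (clE (zU Y) ⊗ₖ q') * (clE (zU Y) ⊗ₖ q') = clE (zU Y) ⊗ₖ q' := by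
    rw [← mul_kronecker_mul, clE_idem, hqq]
  have i2 : (clE (1 : (Matrix Unit Unit (RL Y))ˣ) ⊗ₖ (1 - q')) * (clE (1 : (Matrix Unit Unit (RL Y))ˣ) ⊗ₖ (1 - q')) = clE (1 : (Matrix Unit Unit (RL Y))ˣ) ⊗ₖ (1 - q') := by
    rw [← mul_kronecker_mul, clE_idem, compl_idem hqq]
  have z1 : (clE (zU Y) ⊗ₖ q') * (clE (1 : (Matrix Unit Unit (RL Y))ˣ) ⊗ₖ (1 - q')) = 0 := by
    rw [← mul_kronecker_mul, Matrix.mul_sub, hqq]; simp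
  have z2 : (clE (1 : (Matrix Unit Unit (RL Y))ˣ) ⊗ₖ (1 - q')) * (clE (zU Y) ⊗ₖ q') = 0 := by
    rw [← mul_kronecker_mul, Matrix.sub_mul, hqq]; simp
  have hs : (clE (zU Y) ⊗ₖ q' + clE (1 : (Matrix Unit Unit (RL Y))ˣ) ⊗ₖ (1 - q')) * (clE (zU Y) ⊗ₖ q' + clE (1 : (Matrix Unit Unit (RL Y))ˣ) ⊗ₖ (1 - q'))
      = clE (zU Y) ⊗ₖ q' + clE (1 : (Matrix Unit Unit (RL Y))ˣ) ⊗ₖ (1 - q') := by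
    rw [Matrix.mul_add, Matrix.add_mul, Matrix.add_mul, i1, i2, z1, z2]; simp
  have key := cls_orth _ _ i1 i2 z1 z2 hs
  have e2 : cls (Pj.mul (cl (1 : (Matrix Unit Unit (RL Y))ˣ)) (Pj.map (pb (mpr Y)) ⟨ι, 1 - q, compl_idem h⟩)) = cls ⟨(Unit ⊕ Unit) × ι, _, i2⟩ := by
    refine cls_eq_of (Eqv.of_equiv (Equiv.refl _) ?_)
    intro i j
    show (clE (1 : (Matrix Unit Unit (RL Y))ˣ) ⊗ₖ (1 - q')) i j = (clE (1 : (Matrix Unit Unit (RL Y))ˣ) ⊗ₖ ((1 - q).map (pb (mpr Y)))) i j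
    rw [hqc]
  rw [e2]
  refine Eq.trans ?_ key
  refine cls_eq_of (Eqv.symm (Eqv.of_equiv (unitSumEquiv ι) ?_))
  have main : (clE (Lq q h)).submatrix (unitSumEquiv ι) (unitSumEquiv ι) = clE (zU Y) ⊗ₖ q' + clE (1 : (Matrix Unit Unit (RL Y))ˣ) ⊗ₖ (1 - q') := by
    refine mat_ext_pol ?_
    intro y s z
    have a1 : (clE (zU Y) ⊗ₖ q' + clE (1 : (Matrix Unit Unit (RL Y))ˣ) ⊗ₖ (1 - q')).map (ev (y, pol (s, z))) =
      (clE (zU Y)).map (ev (y, pol (s, z))) ⊗ₖ q'.map (ev (y, pol (s, z))) + (clE (1 : (Matrix Unit Unit (RL Y))ˣ)).map (ev (y, pol (s, z))) ⊗ₖ (1 - q'.map (ev (y, pol (s, z)))) := by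
      ext i j; simp [Matrix.one_apply]; split_ifs <;> simp
    have a2 : q'.map (ev (y, pol (s, z))) = q.map (ev y) := rfl
    rw [a1, ← submatrix_map, cl_ev, cl_ev, cl_ev, Lq_ev, Lq_inv_ev, a2, zU_ev, zU_inv_ev]
    ext ⟨(i | i), i'⟩ ⟨(j | j), j'⟩ <;> simp [unitSumEquiv, Equiv.sumProdDistrib, Matrix.one_apply] <;> (try split_ifs) <;> ring
  intro i j
  exact congrFun (congrFun main i) j

theorem kap_N (α : (Matrix ι ι (RL Y))ˣ) : K.map (pb (mN Y)) (kap α) = (Fintype.card ι : K (RA Y)) := by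
  rw [kap, K.map_cls, ← cls_triv]
  have : (clE α).map (pb (mN Y)) = fromBlocks 1 0 0 0 := by
    refine mat_ext ?_
    intro y
    have : ((clE α).map (pb (mN Y))).map (ev y) = (clE α).map (ev (y, pol (0, 1))) := rfl
    rw [this, cl_ev, fromBlocks_map]
    have c0 : cc Y (y, 0, 1) = 1 := by simp [cc]
    have s0 : sn Y (y, 0, 1) = 0 := by simp [sn]
    rw [c0, s0]; simp
  refine cls_eq_of (Eqv.symm ((eqv_left (Pj.triv (RA Y) ι) ι (by simp [fromBlocks_multiply])).trans ?_))
  refine Eqv.of_equiv (Equiv.refl _) ?_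
  intro i j
  exact congrFun (congrFun this i) j

theorem Hh_N : K.map (pb (mN Y)) (Hh Y) = 1 := by
  rw [Hh, kap_N]; simp

theorem zU_map (g : C(Y', Y)) : umap (pb (gL g)) (zU Y) = zU Y' := by
  apply Units.ext
  refine mat_ext ?_
  rintro ⟨y, z⟩
  rw [zU_ev]
  have : (umap (pb (gL g)) (zU Y) : Matrix Unit Unit (RL Y')).map (ev (y, z)) = (zU Y : Matrix Unit Unit (RL Y)).map (ev (g y, z)) := rfl
  rw [this, zU_ev]

theorem Hh_map (g : C(Y', Y)) : K.map (pb (gS g)) (Hh Y) = Hh Y' := by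
  rw [Hh, kap_map, zU_map, Hh]

theorem pr_map (g : C(Y', Y)) (a : K (RA Y)) : K.map (pb (gS g)) (K.map (pb (mpr Y)) a) = K.map (pb (mpr Y')) (K.map (pb g) a) := by
  rw [K.map_map, K.map_map]; rfl

theorem pr_N (a : K (RA Y)) : K.map (pb (mN Y)) (K.map (pb (mpr Y)) a) = a := by
  rw [K.map_map]
  have : (pb (mN Y)).comp (pb (mpr Y)) = RingHom.id _ := by ext; rfl
  rw [this, K.map_id]

theorem Hh_line (i j k l : Unit ⊕ Unit) : clE (zU Y) i j * clE (zU Y) k l = clE (zU Y) k j * clE (zU Y) i l := by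
  ext ⟨y, x⟩
  obtain ⟨⟨s, z⟩, rfl⟩ := pol_surj x
  have : ∀ a b, clE (zU Y) a b (y, pol (s, z)) = _ := fun a b => congrFun (congrFun (cl_ev (zU Y) y s z) a) b
  simp only [ContinuousMap.mul_apply, this, zU_ev, zU_inv_ev]
  have hz0 : (z : ℂ) ≠ 0 := Circle.coe_ne_zero z
  rcases i with i | i <;> rcases j with j | j <;> rcases k with k | k <;> rcases l with l | l <;> simp <;> 
    first | ring1 | (field_simp)

theorem psi_one {R : Type} [CommRing R] [Invertible (2 : R)] : psi (1 : K R) = 1 := by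
  rw [← cls_unit, psi_cls']
  have : cls (Sq (-1) (Pj.triv R Unit)) = 0 := by
    have : (Sq (-1) (Pj.triv R Unit)).e = 0 := by
      ext ⟨a, b⟩ ⟨c, d⟩
      have : (a, b).swap = (c, d) := Prod.ext (Subsingleton.elim (α := Unit) _ _) (Subsingleton.elim (α := Unit) _ _)
      have h1 : (1 : Matrix (Unit × Unit) (Unit × Unit) R) (a, b).swap (id (c, d)) = 1 := by rw [this]; exact Matrix.one_apply_eq _
      simp [Sq, sgP, flip]
      erw [h1]; simp
    rw [← cls_zero (R := R) (Unit × Unit) (by simp)]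
    refine cls_eq_of (Eqv.of_equiv (Equiv.refl _) ?_)
    intro i j
    exact (congrFun (congrFun this i) j).symm
  rw [this, cls_unit]; ring

theorem psi_mul_Hh (x : K (RS Y)) : psi (x * Hh Y) = psi x * (Hh Y * Hh Y) := by
  exact psi_mul_line x (cl (zU Y)) Hh_line

theorem clX_l (α : (Matrix Unit Unit (RL Y))ˣ) (i j : Unit) (y : Y) (s : I01) (z : Circle) : clX α (Sum.inl i) j (y, s, z) = cc Y (y, s, z) := by
  simp [clX, frX]
theorem clX_r (α : (Matrix Unit Unit (RL Y))ˣ) (i j : Unit) (y : Y) (s : I01) (z : Circle) : clX α (Sum.inr i) j (y, s, z) = sn Y (y, s, z) * (α : Matrix Unit Unit (RL Y)).map (ev (y, z)) i j := by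
  simp [clX, frX]
theorem clZ_l (α : (Matrix Unit Unit (RL Y))ˣ) (i j : Unit) (y : Y) (s : I01) (z : Circle) : clZ α j (Sum.inl i) (y, s, z) = cc Y (y, s, z) := by
  simp [clZ, frZ]
theorem clZ_r (α : (Matrix Unit Unit (RL Y))ˣ) (i j : Unit) (y : Y) (s : I01) (z : Circle) : clZ α j (Sum.inr i) (y, s, z) = sn Y (y, s, z) * ((α⁻¹ : (Matrix Unit Unit (RL Y))ˣ) : Matrix Unit Unit (RL Y)).map (ev (y, z)) i j := by
  simp [clZ, frZ]

theorem Hh_sq : Hh Y * Hh Y = 2 * Hh Y - 1 := by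
  have h1 := kap_mul (zU Y) (zU Y)
  have h2 : kap (zU Y * zU Y) = Hh Y * Hh Y := by
    rw [Hh, kap, kap, ← cls_mul]
    have hf := cl_fr (zU Y)
    have hf2 : Fr (Pj.mul (cl (zU Y)) (cl (zU Y))) (κ := Unit) (Matrix.of fun i j => clX (zU Y) i.1 () * clX (zU Y) i.2 ())
        (Matrix.of fun i j => clZ (zU Y) () j.1 * clZ (zU Y) () j.2) := by
      have a1 := congrFun (congrFun hf.one ()) ()
      rw [Matrix.mul_apply] at a1
      constructor
      · ext1 i j
        simp only [Matrix.mul_apply, Matrix.of_apply, Fintype.sum_prod_type]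
        have : (1 : Matrix Unit Unit (RW Y)) i j = (1 : Matrix Unit Unit (RW Y)) () () * (1 : Matrix Unit Unit (RW Y)) () () := by simp
        rw [this, ← a1, Finset.sum_mul_sum]
        refine Finset.sum_congr rfl fun a _ => Finset.sum_congr rfl fun b _ => by ring
      · ext1 i j
        have a2 := fun i j => congrFun (congrFun hf.eq i) j
        simp only [Matrix.mul_apply, Finset.univ_unique, Finset.sum_singleton] at a2
        have e : (Pj.mul (cl (zU Y)) (cl (zU Y))).e.map (pb (mpol Y)) i j = (clE (zU Y)).map (pb (mpol Y)) i.1 j.1 * (clE (zU Y)).map (pb (mpol Y)) i.2 j.2 := by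
          simp
        rw [e, ← a2, ← a2]
        simp only [Matrix.mul_apply, Matrix.of_apply, Finset.univ_unique, Finset.sum_singleton]
        ring_nf
    have c0 : ∀ (y : Y) (z : Circle), cc Y (y, 0, z) = 1 := by intro y z; simp [cc]
    have s0 : ∀ (y : Y) (z : Circle), sn Y (y, 0, z) = 0 := by intro y z; simp [sn]
    have c1 : ∀ (y : Y) (z : Circle), cc Y (y, 1, z) = 0 := by intro y z; simp [cc]
    have s1 : ∀ (y : Y) (z : Circle), sn Y (y, 1, z) = 1 := by intro y z; simp [sn]
    have cz : ∀ z : Circle, (z : ℂ) * (z : ℂ)⁻¹ = 1 := fun z => mul_inv_cancel₀ (Circle.coe_ne_zero z)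
    have m1 : ∀ (y : Y) (z : Circle), ((zU Y * zU Y : (Matrix Unit Unit (RL Y))ˣ) : Matrix Unit Unit (RL Y)).map (ev (y, z)) () () = z * z := by
      intro y z
      rw [Units.val_mul, Matrix.map_mul, zU_ev]; simp
    have m2 : ∀ (y : Y) (z : Circle), (((zU Y * zU Y)⁻¹ : (Matrix Unit Unit (RL Y))ˣ) : Matrix Unit Unit (RL Y)).map (ev (y, z)) () () = (z : ℂ)⁻¹ * (z : ℂ)⁻¹ := by
      intro y z
      rw [_root_.mul_inv_rev, Units.val_mul, Matrix.map_mul, zU_inv_ev]; simp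
    have n1 : ∀ (y : Y) (z : Circle), ((zU Y : (Matrix Unit Unit (RL Y))ˣ) : Matrix Unit Unit (RL Y)).map (ev (y, z)) () () = z := by
      intro y z
      rw [zU_ev]; simp
    have n2 : ∀ (y : Y) (z : Circle), (((zU Y)⁻¹ : (Matrix Unit Unit (RL Y))ˣ) : Matrix Unit Unit (RL Y)).map (ev (y, z)) () () = (z : ℂ)⁻¹ := by
      intro y z
      rw [zU_inv_ev]; simp
    refine cls_eq_of (Fr.cmp (cl_fr _) hf2 ?_ ?_)
    · have key : ∀ y s z i j, ((clX (zU Y * zU Y) * (Matrix.of fun i j => clZ (zU Y) () j.1 * clZ (zU Y) () j.2 : Matrix Unit ((Unit ⊕ Unit) × (Unit ⊕ Unit)) (RW Y))).map (ev (y, s, z))) i j = clX (zU Y * zU Y) i () (y, s, z) * (clZ (zU Y) () j.1 (y, s, z) * clZ (zU Y) () j.2 (y, s, z)) := by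
        intro y s z i j
        simp [Matrix.mul_apply, ev]
      refine ⟨fun y z z' => ?_, fun y z z' => ?_⟩
      · ext i ⟨j, k⟩
        refine (key y 0 z i (j, k)).trans (Eq.trans ?_ (key y 0 z' i (j, k)).symm)
        rcases i with i | i <;> rcases j with j | j <;> rcases k with k | k <;> simp [clX_l, clX_r, clZ_l, clZ_r, c0, s0]
      · ext i ⟨j, k⟩
        refine (key y 1 z i (j, k)).trans (Eq.trans ?_ (key y 1 z' i (j, k)).symm)
        have e : ∀ z : Circle, (z : ℂ) * z * ((z : ℂ)⁻¹ * (z : ℂ)⁻¹) = 1 := fun z => by rw [mul_mul_mul_comm, cz, one_mul]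
        rcases i with i | i <;> rcases j with j | j <;> rcases k with k | k <;> simp only [clX_l, clX_r, clZ_l, clZ_r, c1, s1, m1, n2, one_mul, zero_mul, mul_zero, e]
    · have key : ∀ y s z i j, (((Matrix.of fun i j => clX (zU Y) i.1 () * clX (zU Y) i.2 () : Matrix ((Unit ⊕ Unit) × (Unit ⊕ Unit)) Unit (RW Y)) * clZ (zU Y * zU Y)).map (ev (y, s, z))) i j = (clX (zU Y) i.1 () (y, s, z) * clX (zU Y) i.2 () (y, s, z)) * clZ (zU Y * zU Y) () j (y, s, z) := by
        intro y s z i j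
        simp [Matrix.mul_apply, ev]
      refine ⟨fun y z z' => ?_, fun y z z' => ?_⟩
      · ext ⟨j, k⟩ i
        refine (key y 0 z (j, k) i).trans (Eq.trans ?_ (key y 0 z' (j, k) i).symm)
        rcases i with i | i <;> rcases j with j | j <;> rcases k with k | k <;> simp [clX_l, clX_r, clZ_l, clZ_r, c0, s0]
      · ext ⟨j, k⟩ i
        refine (key y 1 z (j, k) i).trans (Eq.trans ?_ (key y 1 z' (j, k) i).symm)
        have e : ∀ z : Circle, (z : ℂ) * z * ((z : ℂ)⁻¹ * (z : ℂ)⁻¹) = 1 := fun z => by rw [mul_mul_mul_comm, cz, one_mul]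
        rcases i with i | i <;> rcases j with j | j <;> rcases k with k | k <;> simp only [clX_l, clX_r, clZ_l, clZ_r, c1, s1, n1, m2, one_mul, zero_mul, mul_zero, e]
  rw [h2, Fintype.card_unit, Nat.cast_one] at h1
  rw [← Hh] at h1
  linear_combination h1

end clutch
end BK

namespace BK
open Matrix Kronecker Topology

section laurent
variable {Y Y' : Type} [TopologicalSpace Y] [CompactSpace Y] [T2Space Y] [TopologicalSpace Y'] [CompactSpace Y'] [T2Space Y']
variable {ι κ : Type} [Fintype ι] [DecidableEq ι] [Fintype κ] [DecidableEq κ]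

/-- integer powers of the loop coordinate -/
noncomputable def zp (Y : Type) [TopologicalSpace Y] (k : ℤ) : RL Y := ⟨fun x => ((x.2 ^ k : Circle) : ℂ), (by fun_prop : Continuous (fun z : Circle => (z : ℂ))).comp (Continuous.zpow (G := Circle) continuous_snd k)⟩

theorem zp_ap (k : ℤ) (x : Y × Circle) : zp Y k x = ((x.2 ^ k : Circle) : ℂ) := rfl

theorem zp_zero : zp Y 0 = 1 := by ext x; simp [zp_ap]
theorem zp_add (k l : ℤ) : zp Y (k + l) = zp Y k * zp Y l := by
  ext x; rw [ContinuousMap.mul_apply, zp_ap, zp_ap, zp_ap, _root_.zpow_add, Circle.coe_mul]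
theorem zp_eq (k : ℤ) : (((zu Y) ^ k : (RL Y)ˣ) : RL Y) = zp Y k := by
  induction k using Int.induction_on with
  | zero => simp [zp_zero]
  | succ n ih => rw [_root_.zpow_add_one, Units.val_mul, ih, zp_add]; congr 1; ext x; simp [zp_ap, zu_ap]
  | pred n ih => rw [_root_.zpow_sub_one, Units.val_mul, ih, sub_eq_add_neg, zp_add]; congr 1; ext x; simp [zp_ap, zu_inv_ap]

noncomputable def evL (Y : Type) [TopologicalSpace Y] : LaurentPolynomial (RA Y) →+* RL Y := LaurentPolynomial.eval₂ (pb (mpl Y)) (zu Y)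

theorem evL_mono (a : RA Y) (n : ℤ) : evL Y (LaurentPolynomial.C a * LaurentPolynomial.T n) = pb (mpl Y) a * zp Y n := by
  rw [map_mul, evL, LaurentPolynomial.eval₂_C, LaurentPolynomial.eval₂_T, zp_eq]

theorem evL_star (f : LaurentPolynomial (RA Y)) : ∃ g, star (evL Y f) = evL Y g := by
  induction f using LaurentPolynomial.induction_on' with
  | add p q hp hq =>
    obtain ⟨a, ha⟩ := hp
    obtain ⟨b, hb⟩ := hq
    exact ⟨a + b, by rw [map_add, star_add, ha, hb, map_add]⟩
  | C_mul_T n a =>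
    refine ⟨LaurentPolynomial.C (star a) * LaurentPolynomial.T (-n), ?_⟩
    rw [evL_mono, evL_mono]
    ext x
    simp [zp_ap, ← Circle.coe_inv_eq_conj, mul_comm]

noncomputable def lauAlg (Y : Type) [TopologicalSpace Y] [CompactSpace Y] [T2Space Y] : StarSubalgebra ℂ (RL Y) where
  carrier := Set.range (evL Y)
  mul_mem' := by rintro _ _ ⟨a, rfl⟩ ⟨b, rfl⟩; exact ⟨a * b, map_mul _ _ _⟩
  add_mem' := by rintro _ _ ⟨a, rfl⟩ ⟨b, rfl⟩; exact ⟨a + b, map_add _ _ _⟩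
  algebraMap_mem' := by
    intro r
    refine ⟨LaurentPolynomial.C (algebraMap ℂ (RA Y) r), ?_⟩
    rw [evL, LaurentPolynomial.eval₂_C]; rfl
  star_mem' := by rintro _ ⟨a, rfl⟩; obtain ⟨g, hg⟩ := evL_star a; exact ⟨g, hg.symm⟩

theorem evL_dense (f : RL Y) {ε : ℝ} (hε : 0 < ε) : ∃ g, ‖f - evL Y g‖ < ε := by
  have h := ContinuousMap.starSubalgebra_topologicalClosure_eq_top_of_separatesPoints (lauAlg Y) ?_
  · have h1 : f ∈ (lauAlg Y).topologicalClosure := by rw [h]; trivial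
    have h2 : f ∈ closure (lauAlg Y : Set (RL Y)) := h1
    obtain ⟨g, ⟨a, rfl⟩, hg⟩ := Metric.mem_closure_iff.1 h2 ε hε
    exact ⟨a, by rwa [dist_eq_norm] at hg⟩
  · rintro ⟨y, z⟩ ⟨y', z'⟩ hne
    by_cases hy : y = y'
    · subst hy
      have hz : z ≠ z' := by rintro rfl; exact hne rfl
      refine ⟨_, ⟨evL Y (LaurentPolynomial.T 1), ⟨_, rfl⟩, rfl⟩, ?_⟩
      have : evL Y (LaurentPolynomial.T 1) = zp Y 1 := by rw [evL, LaurentPolynomial.eval₂_T, zp_eq]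
      rw [this]
      simp [zp_ap]
      exact fun h => hz (Circle.ext h)
    · obtain ⟨f, h0, h1, _⟩ := exists_continuous_zero_one_of_isClosed (isClosed_singleton (x := y)) (isClosed_singleton (x := y'))
        (by simpa using hy)
      refine ⟨_, ⟨evL Y (LaurentPolynomial.C ⟨fun y => (f y : ℂ), by fun_prop⟩), ⟨_, rfl⟩, rfl⟩, ?_⟩
      rw [evL, LaurentPolynomial.eval₂_C]
      have e0 : f y = 0 := h0 (by simp)
      have e1 : f y' = 1 := h1 (by simp)
      show (f y : ℂ) ≠ (f y' : ℂ)
      rw [e0, e1]; simp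

/-- average over the circle -/
noncomputable def avg (f : RL Y) : RA Y :=
  ⟨fun y => (2 * Real.pi : ℂ)⁻¹ * ∫ θ in (0:ℝ)..(2 * Real.pi), f (y, Circle.exp θ), by
    refine continuous_const.mul ?_
    refine intervalIntegral.continuous_parametric_intervalIntegral_of_continuous' ?_ _ _
    fun_prop⟩

theorem avg_ap (f : RL Y) (y : Y) : avg f y = (2 * Real.pi : ℂ)⁻¹ * ∫ θ in (0:ℝ)..(2 * Real.pi), f (y, Circle.exp θ) := rfl

theorem avg_int (f : RL Y) (y : Y) : IntervalIntegrable (fun θ : ℝ => f (y, Circle.exp θ)) MeasureTheory.volume 0 (2 * Real.pi) := by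
  refine Continuous.intervalIntegrable ?_ _ _
  fun_prop

theorem avg_add (f g : RL Y) : avg (f + g) = avg f + avg g := by
  ext y
  rw [ContinuousMap.add_apply, avg_ap, avg_ap, avg_ap, ← mul_add, ← intervalIntegral.integral_add (avg_int f y) (avg_int g y)]
  rfl

noncomputable def avgH (Y : Type) [TopologicalSpace Y] [CompactSpace Y] [T2Space Y] : RL Y →+ RA Y := AddMonoidHom.mk' avg avg_add

theorem avgH_ap (f : RL Y) : avgH Y f = avg f := rfl

theorem avg_mul (a : RA Y) (f : RL Y) : avg (pb (mpl Y) a * f) = a * avg f := by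
  ext y
  rw [ContinuousMap.mul_apply, avg_ap, avg_ap, mul_left_comm (a y), ← intervalIntegral.integral_const_mul (a y)]
  rfl

theorem avg_zp (k : ℤ) : avg (zp Y k) = if k = 0 then 1 else 0 := by
  ext y
  rw [avg_ap]
  have e : ∀ θ : ℝ, zp Y k (y, Circle.exp θ) = Complex.exp ((k * Complex.I) * θ) := by
    intro θ
    rw [zp_ap, Circle.coe_zpow, Circle.coe_exp, ← Complex.exp_int_mul]
    congr 1; ring
  simp only [e]
  have hpi : (2 * Real.pi : ℂ) ≠ 0 := by
    have := Real.pi_ne_zero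
    exact mul_ne_zero two_ne_zero (by exact_mod_cast this)
  split_ifs with h
  · subst h
    simp
    field_simp
  · rw [integral_exp_mul_complex (mul_ne_zero (by exact_mod_cast h) Complex.I_ne_zero)]
    have : Complex.exp (k * Complex.I * ((2 * Real.pi : ℝ) : ℂ)) = 1 := by
      rw [Complex.exp_eq_one_iff]
      exact ⟨k, by push_cast; ring⟩
    rw [this]; simp

theorem avg_map (g : C(Y', Y)) (f : RL Y) : avg (pb (gL g) f) = pb g (avg f) := by
  ext y; rfl

theorem avg_norm (f : RL Y) (y : Y) : ‖avg f y‖ ≤ ‖f‖ := by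
  rw [avg_ap, norm_mul]
  have := intervalIntegral.norm_integral_le_of_norm_le_const (a := (0:ℝ)) (b := 2 * Real.pi) (C := ‖f‖) (f := fun θ : ℝ => f (y, Circle.exp θ)) (fun θ _ => f.norm_coe_le_norm _)
  rw [norm_inv]
  have hp : ‖(2 * Real.pi : ℂ)‖ = 2 * Real.pi := by
    simp [abs_of_pos Real.pi_pos]
  have hpos : 0 < 2 * Real.pi := by positivity
  rw [hp, inv_mul_le_iff₀ hpos]
  rw [sub_zero, abs_of_pos hpos] at this
  linarith

theorem avg_lau (g : LaurentPolynomial (RA Y)) : ∃ N : ℕ, ∀ k : ℤ, N < k.natAbs → avg (zp Y k * evL Y g) = 0 := by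
  induction g using LaurentPolynomial.induction_on' with
  | add p q hp hq =>
    obtain ⟨a, ha⟩ := hp
    obtain ⟨b, hb⟩ := hq
    refine ⟨max a b, fun k hk => ?_⟩
    rw [map_add, mul_add, avg_add, ha k (lt_of_le_of_lt (le_max_left _ _) hk), hb k (lt_of_le_of_lt (le_max_right _ _) hk), add_zero]
  | C_mul_T n a =>
    refine ⟨n.natAbs, fun k hk => ?_⟩
    rw [evL_mono, mul_left_comm, avg_mul, ← zp_add, avg_zp, if_neg, mul_zero]
    omega

theorem norm_zp_mul (k : ℤ) (f : RL Y) : ‖zp Y k * f‖ ≤ ‖f‖ := by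
  rw [ContinuousMap.norm_le _ (norm_nonneg _)]
  intro x
  rw [ContinuousMap.mul_apply, norm_mul, zp_ap, Circle.norm_coe, one_mul]
  exact f.norm_coe_le_norm x

/-- Riemann--Lebesgue -/
theorem avg_small (f : RL Y) {ε : ℝ} (hε : 0 < ε) : ∃ N : ℕ, ∀ k : ℤ, N < k.natAbs → ∀ y, ‖avg (zp Y k * f) y‖ < ε := by
  obtain ⟨g, hg⟩ := evL_dense f hε
  obtain ⟨N, hN⟩ := avg_lau g
  refine ⟨N, fun k hk y => ?_⟩
  have : zp Y k * f = zp Y k * (f - evL Y g) + zp Y k * evL Y g := by ring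
  rw [this, avg_add, hN k hk, add_zero]
  exact lt_of_le_of_lt (avg_norm _ _) (lt_of_le_of_lt (norm_zp_mul _ _) hg)

/-- polynomial loops -/
noncomputable def Pz (M : ℕ) (p : ℕ → Matrix ι ι (RA Y)) : Matrix ι ι (RL Y) :=
  Matrix.of fun i j => ∑ l ∈ Finset.range (M + 1), zp Y l * pb (mpl Y) (p l i j)

theorem poly_dense (F : Matrix ι ι (RL Y)) {ε : ℝ} (hε : 0 < ε) : ∃ (n M : ℕ) (p : ℕ → Matrix ι ι (RA Y)),
    n < M ∧ ∀ i j, ‖zp Y n * F i j - Pz M p i j‖ < ε := by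
  choose g hg using fun ij : ι × ι => evL_dense (F ij.1 ij.2) hε
  choose m q hq using fun ij : ι × ι => LaurentPolynomial.exists_T_pow (g ij)
  let n := ∑ ij, m ij
  have hn : ∀ ij, m ij ≤ n := fun ij => Finset.single_le_sum (f := m) (fun _ _ => Nat.zero_le _) (Finset.mem_univ ij)
  let r : ι × ι → Polynomial (RA Y) := fun ij => q ij * Polynomial.X ^ (n - m ij)
  let M := ∑ ij, (r ij).natDegree + n + 1
  have hM : ∀ ij, (r ij).natDegree < M + 1 := fun ij => by
    have := Finset.single_le_sum (f := fun ij => (r ij).natDegree) (fun _ _ => Nat.zero_le _) (Finset.mem_univ ij)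
    simp only [M]; omega
  refine ⟨n, M, fun l => Matrix.of fun i j => (r (i, j)).coeff l, by simp only [M]; omega, fun i j => ?_⟩
  have e1 : (Polynomial.toLaurent (r (i, j))) = g (i, j) * LaurentPolynomial.T n := by
    simp only [r]
    rw [map_mul, hq, Polynomial.toLaurent_X_pow, LaurentPolynomial.mul_T_assoc]
    congr 2
    have := hn (i, j)
    push_cast [Nat.cast_sub this]; ring
  have e2 : Pz M (fun l => Matrix.of fun i j => (r (i, j)).coeff l) i j = zp Y n * evL Y (g (i, j)) := by
    have : evL Y (Polynomial.toLaurent (r (i, j))) = evL Y (g (i, j)) * zp Y n := by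
      rw [e1, map_mul]; congr 1; rw [evL, LaurentPolynomial.eval₂_T, zp_eq]
    rw [mul_comm, ← this, evL, LaurentPolynomial.eval₂_toLaurent, Polynomial.eval₂_eq_sum_range' _ (hM (i, j))]
    rw [Pz, Matrix.of_apply]
    refine Finset.sum_congr rfl fun l _ => ?_
    rw [mul_comm, ← zp_eq]; simp
  rw [e2, ← mul_sub]
  exact lt_of_le_of_lt (norm_zp_mul _ _) (hg (i, j))

noncomputable def zS (n : ℕ) : (Matrix ι ι (RL Y))ˣ := (Lq 1 (by simp)) ^ n

theorem zS_ev (n : ℕ) (F : (Matrix ι ι (RL Y))ˣ) (x : Y × Circle) :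
    ((zS n * F : (Matrix ι ι (RL Y))ˣ) : Matrix ι ι (RL Y)).map (ev x) = zp Y n x • (F : Matrix ι ι (RL Y)).map (ev x) := by
  have h : ∀ n : ℕ, ((zS n : (Matrix ι ι (RL Y))ˣ) : Matrix ι ι (RL Y)).map (ev x) = zp Y n x • 1 := by
    intro n
    induction n with
    | zero => simp [zS, zp_ap]
    | succ n ih =>
      rw [zS, pow_succ, ← zS, Units.val_mul, Matrix.map_mul, ih]
      obtain ⟨y, z⟩ := x
      rw [Lq_ev]
      have : zp Y ((n + 1 : ℕ) : ℤ) (y, z) = zp Y n (y, z) * z := by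
        push_cast
        rw [zp_add, ContinuousMap.mul_apply]; congr 1; simp [zp_ap]
      rw [this]; simp [smul_smul, mul_comm]
  rw [Units.val_mul, Matrix.map_mul, h, Matrix.smul_mul, Matrix.one_mul]

theorem poly_approx (F : (Matrix ι ι (RL Y))ˣ) : ∃ (n M : ℕ) (p : ℕ → Matrix ι ι (RA Y)), n < M ∧
    ∀ (t : ℝ), 0 ≤ t → t ≤ 1 → ∀ x, IsUnit (((zS n * F : (Matrix ι ι (RL Y))ˣ) : Matrix ι ι (RL Y)).map (ev x) + (t : ℂ) • ((Pz M p).map (ev x) - ((zS n * F : (Matrix ι ι (RL Y))ˣ) : Matrix ι ι (RL Y)).map (ev x))) := by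
  let Fi : Matrix ι ι (RL Y) := (F⁻¹ : (Matrix ι ι (RL Y))ˣ)
  let C : ℝ := ∑ i, ∑ j, ‖Fi i j‖
  have hC0 : 0 ≤ C := by positivity
  let N : ℝ := (Fintype.card ι : ℝ) + 1
  let ε : ℝ := 1 / ((C + 1) * N * 2)
  have hN : 0 < N := by positivity
  have hε : 0 < ε := by positivity
  obtain ⟨n, M, p, hnM, h⟩ := poly_dense (F : Matrix ι ι (RL Y)) hε
  refine ⟨n, M, p, hnM, fun t t0 t1 x => ?_⟩
  rw [Matrix.isUnit_iff_isUnit_det, isUnit_iff_ne_zero]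
  intro hdet
  obtain ⟨v, hv, h0⟩ := Matrix.exists_mulVec_eq_zero_iff.2 hdet
  apply hv
  -- w = F v
  let A := (F : Matrix ι ι (RL Y)).map (ev x)
  let B := Fi.map (ev x)
  have hBA : B * A = 1 := by
    rw [← Matrix.map_mul]
    have : Fi * (F : Matrix ι ι (RL Y)) = 1 := F.inv_mul
    rw [this, map_one']
  let z : ℂ := zp Y n x
  have hz : ‖z‖ = 1 := by simp only [z, zp_ap, Circle.norm_coe]
  let E : Matrix ι ι ℂ := (Pz M p).map (ev x) - ((zS n * F : (Matrix ι ι (RL Y))ˣ) : Matrix ι ι (RL Y)).map (ev x)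
  have hE : ∀ i j, ‖E i j‖ ≤ ε := by
    intro i j
    have h1 := (zp Y n * (F : Matrix ι ι (RL Y)) i j - Pz M p i j).norm_coe_le_norm x
    have h2 : E i j = - ((zp Y n * (F : Matrix ι ι (RL Y)) i j - Pz M p i j) x) := by
      simp only [E, zS_ev, Matrix.sub_apply, Matrix.smul_apply, Matrix.map_apply, ContinuousMap.sub_apply, ContinuousMap.mul_apply, smul_eq_mul, ev_apply]
      ring
    rw [h2, norm_neg]
    exact h1.trans (h i j).le
  have hsm : ((zS n * F : (Matrix ι ι (RL Y))ˣ) : Matrix ι ι (RL Y)).map (ev x) = z • A := by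
    exact zS_ev n F x
  have h1 : z • (A *ᵥ v) = - ((t : ℂ) • (E *ᵥ v)) := by
    rw [Matrix.add_mulVec, Matrix.smul_mulVec, hsm, Matrix.smul_mulVec, ← hsm] at h0
    exact eq_neg_of_add_eq_zero_left h0
  have h2 : z • v = - ((t : ℂ) • (B *ᵥ (E *ᵥ v))) := by
    have := congrArg (B *ᵥ ·) h1
    simp only [Matrix.mulVec_smul, Matrix.mulVec_neg, Matrix.mulVec_mulVec, hBA, Matrix.one_mulVec] at this
    rw [this, Matrix.mulVec_mulVec]
  have hEv : ∀ i, ‖(E *ᵥ v) i‖ ≤ N * ε * ‖v‖ := by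
    intro i
    calc ‖∑ j, E i j * v j‖ ≤ ∑ j, ‖E i j * v j‖ := norm_sum_le _ _
      _ ≤ ∑ j : ι, ε * ‖v‖ := by
        refine Finset.sum_le_sum fun j _ => ?_
        rw [norm_mul]
        exact mul_le_mul (hE i j) (norm_le_pi_norm v j) (norm_nonneg _) hε.le
      _ = (Fintype.card ι : ℝ) * (ε * ‖v‖) := by simp
      _ ≤ N * (ε * ‖v‖) := by
        refine mul_le_mul_of_nonneg_right (by simp [N]) (by positivity)
      _ = _ := by ring
  have hBE : ∀ i, ‖(B *ᵥ (E *ᵥ v)) i‖ ≤ C * (N * ε * ‖v‖) := by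
    intro i
    calc ‖∑ j, B i j * (E *ᵥ v) j‖ ≤ ∑ j, ‖B i j * (E *ᵥ v) j‖ := norm_sum_le _ _
      _ ≤ ∑ j : ι, ‖Fi i j‖ * (N * ε * ‖v‖) := by
        refine Finset.sum_le_sum fun j _ => ?_
        rw [norm_mul]
        exact mul_le_mul ((Fi i j).norm_coe_le_norm x) (hEv j) (norm_nonneg _) (norm_nonneg _)
      _ = (∑ j : ι, ‖Fi i j‖) * (N * ε * ‖v‖) := by rw [Finset.sum_mul]
      _ ≤ C * (N * ε * ‖v‖) := by
        refine mul_le_mul_of_nonneg_right ?_ (by positivity)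
        exact Finset.single_le_sum (f := fun i => ∑ j : ι, ‖Fi i j‖) (fun _ _ => by positivity) (Finset.mem_univ i)
  have h3 : ‖v‖ ≤ C * (N * ε * ‖v‖) := by
    refine (pi_norm_le_iff_of_nonneg (by positivity)).2 fun i => ?_
    have e1 : ‖v i‖ = ‖(z • v) i‖ := by rw [Pi.smul_apply, smul_eq_mul, norm_mul, hz, one_mul]
    rw [e1, h2, Pi.neg_apply, norm_neg, Pi.smul_apply, smul_eq_mul, norm_mul, Complex.norm_real, Real.norm_of_nonneg t0]
    calc t * _ ≤ 1 * (C * (N * ε * ‖v‖)) := mul_le_mul t1 (hBE i) (norm_nonneg _) (by norm_num)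
      _ = _ := one_mul _
  have h4 : C * (N * ε) ≤ 1 / 2 := by
    have : C * (N * ε) = C / (C + 1) * (1/2) := by simp only [ε]; field_simp
    rw [this]
    have : C / (C + 1) ≤ 1 := by rw [div_le_one (by positivity)]; linarith
    linarith
  have h5 : ‖v‖ ≤ 1/2 * ‖v‖ := by
    calc ‖v‖ ≤ C * (N * ε) * ‖v‖ := by rw [mul_assoc]; exact h3
      _ ≤ _ := mul_le_mul_of_nonneg_right h4 (norm_nonneg _)
  have h6 : ‖v‖ = 0 := by linarith [norm_nonneg v]
  exact norm_eq_zero.1 h6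

end laurent
end BK

namespace BK
open Matrix Kronecker Topology

section rec
variable {J : Type} [Fintype J] [DecidableEq J]

structure Rec (a b : Matrix J J ℂ) (c : ℤ → Matrix J J ℂ) : Prop where
  L : ∀ k, b * c k + a * c (k - 1) = if k = 0 then 1 else 0
  R : ∀ k, c k * b + c (k - 1) * a = if k = 0 then 1 else 0
  t1 : Filter.Tendsto (fun n : ℕ => c n) Filter.atTop (𝓝 0)
  t2 : Filter.Tendsto (fun n : ℕ => c (-1 - n)) Filter.atTop (𝓝 0)

variable {a b : Matrix J J ℂ} {c : ℤ → Matrix J J ℂ}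

theorem Rec.comm (h : Rec a b c) (k : ℤ) : a * c k * b = b * c k * a := by
  have h1 := h.L (k + 1)
  have h2 := h.R (k + 1)
  rw [add_sub_cancel_right] at h1 h2
  have e1 : a * c k = (if k + 1 = 0 then (1 : Matrix J J ℂ) else 0) - b * c (k + 1) := by rw [← h1]; abel
  have e2 : c k * a = (if k + 1 = 0 then (1 : Matrix J J ℂ) else 0) - c (k + 1) * b := by rw [← h2]; abel
  rw [e1, Matrix.mul_assoc b, e2]
  split_ifs <;> noncomm_ring

theorem Rec.step (h : Rec a b c) (n : ℕ) : a * c (-1) * (b * c 0) = a * c (-1 - n) * (b * c n) := by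
  induction n with
  | zero => simp
  | succ n ih =>
    rw [ih, ← Matrix.mul_assoc, h.comm]
    have h1 := h.L (-1 - n)
    rw [if_neg (by omega)] at h1
    have h2 := h.L (n + 1)
    rw [if_neg (by omega), add_sub_cancel_right] at h2
    have e1 : b * c (-1 - n) = - (a * c (-1 - n - 1)) := eq_neg_of_add_eq_zero_left h1
    have e2 : a * c n = - (b * c (n + 1)) := eq_neg_of_add_eq_zero_right h2
    rw [e1, Matrix.mul_assoc _ a, e2]
    push_cast
    rw [neg_mul_neg]
    congr 3
    ring_nf

theorem Rec.ort (h : Rec a b c) : a * c (-1) * (b * c 0) = 0 := by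
  have h1 : Filter.Tendsto (fun n : ℕ => a * c (-1 - n) * (b * c n)) Filter.atTop (𝓝 (a * 0 * (b * 0))) :=
    (tendsto_const_nhds.mul h.t2).mul (tendsto_const_nhds.mul h.t1)
  have h2 : (fun n : ℕ => a * c (-1 - n) * (b * c n)) = fun n => a * c (-1) * (b * c 0) := funext fun n => (h.step n).symm
  rw [h2] at h1
  have := tendsto_nhds_unique tendsto_const_nhds h1
  rw [this]; simp

theorem Rec.bc (h : Rec a b c) : b * c 0 = 1 - a * c (-1) := by
  have := h.L 0
  simp at this
  rw [← this]; abel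
theorem Rec.cb (h : Rec a b c) : c 0 * b = 1 - c (-1) * a := by
  have := h.R 0
  simp at this
  rw [← this]; abel

theorem Rec.idem (h : Rec a b c) : a * c (-1) * (a * c (-1)) = a * c (-1) := by
  have := h.ort
  rw [h.bc, mul_sub, mul_one, sub_eq_zero] at this
  exact this.symm

theorem Rec.idem' (h : Rec a b c) : c (-1) * a * (c (-1) * a) = c (-1) * a := by
  have e : ∀ x : Matrix J J ℂ, x = c 0 * (b * x) + c (-1) * (a * x) := by
    intro x
    rw [← Matrix.mul_assoc, ← Matrix.mul_assoc, h.cb]; noncomm_ring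
  have hi := h.idem
  have h1 : a * (c (-1) * a * (c (-1) * a)) = a * (c (-1) * a) := by
    calc _ = a * c (-1) * (a * c (-1)) * a := by noncomm_ring
      _ = _ := by rw [hi, Matrix.mul_assoc]
  have h2 : b * (c (-1) * a * (c (-1) * a)) = b * (c (-1) * a) := by
    have hc := h.comm (-1)
    calc _ = b * c (-1) * a * (c (-1) * a) := by noncomm_ring
      _ = a * c (-1) * b * (c (-1) * a) := by rw [hc]
      _ = a * c (-1) * (b * c (-1) * a) := by noncomm_ring
      _ = a * c (-1) * (a * c (-1) * b) := by rw [hc]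
      _ = a * c (-1) * (a * c (-1)) * b := by noncomm_ring
      _ = b * (c (-1) * a) := by rw [hi, hc, Matrix.mul_assoc]
  rw [e (c (-1) * a * (c (-1) * a)), h1, h2, ← e]

theorem tendsto_mv {f : ℕ → Matrix J J ℂ} (hf : Filter.Tendsto f Filter.atTop (𝓝 0)) (w : J → ℂ) :
    Filter.Tendsto (fun n => ‖f n *ᵥ w‖) Filter.atTop (𝓝 0) := by
  have h : Continuous fun A : Matrix J J ℂ => ‖A *ᵥ w‖ := by fun_prop
  have := (h.tendsto 0).comp hf
  simp only [Matrix.zero_mulVec, norm_zero] at this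
  exact this

theorem Rec.ker1 (h : Rec a b c) {v : J → ℂ} {μ : ℂ} (hμ : ‖μ‖ ≤ 1) (hv : (c (-1) * a) *ᵥ v = v) (he : a *ᵥ v = μ • (b *ᵥ v)) : v = 0 := by
  set w := b *ᵥ v with hw
  have hs : ∀ n : ℕ, ‖c (-1) *ᵥ w‖ ≤ ‖c (-1 - n) *ᵥ w‖ := by
    intro n
    induction n with
    | zero => simp
    | succ n ih =>
      refine ih.trans ?_
      have h1 := h.R (-1 - n)
      rw [if_neg (by omega)] at h1
      have h2 := congrArg (· *ᵥ v) h1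
      simp only [Matrix.add_mulVec, ← Matrix.mulVec_mulVec, he, Matrix.zero_mulVec, ← hw, Matrix.mulVec_smul] at h2
      rw [eq_neg_of_add_eq_zero_left h2, norm_neg, norm_smul]
      have : (-1 - ((n + 1 : ℕ) : ℤ)) = -1 - n - 1 := by push_cast; ring
      rw [this]
      exact mul_le_of_le_one_left (norm_nonneg _) hμ
  have h0 : ‖c (-1) *ᵥ w‖ ≤ 0 := ge_of_tendsto' (tendsto_mv h.t2 w) hs
  have h1 : c (-1) *ᵥ w = 0 := norm_le_zero_iff.1 h0
  rw [← hv, ← Matrix.mulVec_mulVec, he, Matrix.mulVec_smul, h1, smul_zero]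

theorem Rec.ker2 (h : Rec a b c) {v : J → ℂ} {μ : ℂ} (hμ : ‖μ‖ ≤ 1) (hv : (c 0 * b) *ᵥ v = v) (he : b *ᵥ v = μ • (a *ᵥ v)) : v = 0 := by
  set w := a *ᵥ v with hw
  have hs : ∀ n : ℕ, ‖c 0 *ᵥ w‖ ≤ ‖c n *ᵥ w‖ := by
    intro n
    induction n with
    | zero => simp
    | succ n ih =>
      refine ih.trans ?_
      have h1 := h.R (n + 1)
      rw [if_neg (by omega), add_sub_cancel_right] at h1
      have h2 := congrArg (· *ᵥ v) h1
      simp only [Matrix.add_mulVec, ← Matrix.mulVec_mulVec, he, Matrix.zero_mulVec, ← hw, Matrix.mulVec_smul] at h2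
      rw [eq_neg_of_add_eq_zero_right h2, norm_neg, norm_smul]
      push_cast
      exact mul_le_of_le_one_left (norm_nonneg _) hμ
  have h0 : ‖c 0 *ᵥ w‖ ≤ 0 := ge_of_tendsto' (tendsto_mv h.t1 w) hs
  have h1 : c 0 *ᵥ w = 0 := norm_le_zero_iff.1 h0
  rw [← hv, ← Matrix.mulVec_mulVec, he, Matrix.mulVec_smul, h1, smul_zero]

theorem Rec.ker (h : Rec a b c) {v : J → ℂ} {z s : ℂ} (hz : ‖z‖ = 1) (hs : ‖s‖ ≤ 1)
    (hv : ((a * c (-1)) * (z • a + s • b) + (1 - a * c (-1)) * ((s * z) • a + b)) *ᵥ v = 0) : v = 0 := by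
  obtain ⟨Q, hQ⟩ : ∃ Q, Q = a * c (-1) := ⟨_, rfl⟩
  obtain ⟨P, hP⟩ : ∃ P, P = c (-1) * a := ⟨_, rfl⟩
  rw [← hQ] at hv
  have hQQ : Q * Q = Q := by rw [hQ]; exact h.idem
  have hPP : P * P = P := by rw [hP]; exact h.idem'
  have hQa : Q * a = a * P := by rw [hQ, hP, Matrix.mul_assoc]
  have hQb : Q * b = b * P := by rw [hQ, hP, h.comm, Matrix.mul_assoc]
  have hz0 : z ≠ 0 := by rintro rfl; simp at hz
  have k1 : (z • a + s • b) * P = Q * (Q * (z • a + s • b) + (1 - Q) * ((s * z) • a + b)) := by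
    have : Q * (1 - Q) = 0 := by rw [mul_sub, hQQ, mul_one, sub_self]
    rw [mul_add, ← mul_assoc, ← mul_assoc, this, hQQ, zero_mul, add_zero, mul_add, add_mul]
    simp only [Matrix.smul_mul, Matrix.mul_smul, hQa, hQb]
  have k2 : ((s * z) • a + b) * (1 - P) = (1 - Q) * (Q * (z • a + s • b) + (1 - Q) * ((s * z) • a + b)) := by
    have h1 : (1 - Q) * Q = 0 := by rw [sub_mul, hQQ, one_mul, sub_self]
    have h2 : (1 - Q) * (1 - Q) = 1 - Q := by rw [mul_sub, h1, mul_one, sub_zero]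
    rw [mul_add, ← mul_assoc, ← mul_assoc, h1, h2, zero_mul, zero_add, mul_sub, sub_mul, mul_one, one_mul, mul_add, add_mul]
    simp only [Matrix.smul_mul, Matrix.mul_smul, hQa, hQb]
  have w1 : P *ᵥ v = 0 := by
    refine h.ker1 (μ := - (s * z⁻¹)) ?_ ?_ ?_
    · rw [norm_neg, norm_mul, norm_inv, hz]; simpa using hs
    · rw [← hP, Matrix.mulVec_mulVec, hPP]
    · have := congrArg (· *ᵥ v) k1
      simp only [← Matrix.mulVec_mulVec, hv, Matrix.mulVec_zero] at this
      rw [Matrix.add_mulVec, Matrix.smul_mulVec, Matrix.smul_mulVec] at this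
      have h2 := eq_neg_of_add_eq_zero_left this
      have h3 := congrArg (z⁻¹ • ·) h2
      simp only [smul_smul, inv_mul_cancel₀ hz0, one_smul, smul_neg] at h3
      rw [h3, neg_smul, mul_comm s]
  have w2 : (1 - P) *ᵥ v = 0 := by
    refine h.ker2 (μ := - (s * z)) ?_ ?_ ?_
    · rw [norm_neg, norm_mul, hz]; simpa using hs
    · rw [h.cb, Matrix.mulVec_mulVec]
      congr 1
      rw [← hP]; simp [mul_sub, sub_mul, hPP]
    · have := congrArg (· *ᵥ v) k2
      simp only [← Matrix.mulVec_mulVec, hv, Matrix.mulVec_zero] at this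
      rw [Matrix.add_mulVec, Matrix.smul_mulVec] at this
      rw [eq_neg_of_add_eq_zero_right this, neg_smul]
  have : v = P *ᵥ v + (1 - P) *ᵥ v := by rw [← Matrix.add_mulVec]; simp
  rw [this, w1, w2, add_zero]

end rec

section pencil
variable {Y Y' : Type} [TopologicalSpace Y] [CompactSpace Y] [T2Space Y] [TopologicalSpace Y'] [CompactSpace Y'] [T2Space Y']
variable {ι κ : Type} [Fintype ι] [DecidableEq ι] [Fintype κ] [DecidableEq κ]

/-- linear pencil -/
noncomputable def pen (a b : Matrix ι ι (RA Y)) : Matrix ι ι (RL Y) :=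
  Matrix.of fun i j => pb (mpl Y) (b i j) + pb (mpl Y) (a i j) * zp Y 1

theorem pen_ev (a b : Matrix ι ι (RA Y)) (y : Y) (z : Circle) :
    (pen a b).map (ev (y, z)) = (z : ℂ) • a.map (ev y) + b.map (ev y) := by
  ext i j
  simp [pen, zp_ap, pb_apply]; ring

noncomputable def mavg (k : ℤ) (A : Matrix ι ι (RL Y)) : Matrix ι ι (RA Y) := A.map fun f => avg (zp Y (-k) * f)

theorem avg_sum {s : Finset κ} (f : κ → RL Y) : avg (∑ i ∈ s, f i) = ∑ i ∈ s, avg (f i) := map_sum (avgH Y) f s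

theorem mavg_pen_mul (k : ℤ) (a b : Matrix ι ι (RA Y)) (A : Matrix ι ι (RL Y)) :
    mavg k (pen a b * A) = b * mavg k A + a * mavg (k - 1) A := by
  ext1 i j
  simp only [mavg, Matrix.map_apply, Matrix.mul_apply, Matrix.add_apply, pen, Matrix.of_apply, Finset.mul_sum]
  rw [avg_sum, ← Finset.sum_add_distrib]
  refine Finset.sum_congr rfl fun l _ => ?_
  rw [← avg_mul, ← avg_mul, ← avg_add]
  congr 1
  have : zp Y (-(k - 1)) = zp Y (-k) * zp Y 1 := by rw [← zp_add]; congr 1; ring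
  rw [this]; ring

theorem mavg_mul_pen (k : ℤ) (a b : Matrix ι ι (RA Y)) (A : Matrix ι ι (RL Y)) :
    mavg k (A * pen a b) = mavg k A * b + mavg (k - 1) A * a := by
  ext1 i j
  simp only [mavg, Matrix.map_apply, Matrix.mul_apply, Matrix.add_apply, pen, Matrix.of_apply, Finset.mul_sum]
  rw [avg_sum, ← Finset.sum_add_distrib]
  refine Finset.sum_congr rfl fun l _ => ?_
  rw [mul_comm _ (b l j), mul_comm _ (a l j), ← avg_mul, ← avg_mul, ← avg_add]
  congr 1
  have : zp Y (-(k - 1)) = zp Y (-k) * zp Y 1 := by rw [← zp_add]; congr 1; ring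
  rw [this]; ring

theorem avg_zero : avg (0 : RL Y) = 0 := map_zero (avgH Y)

theorem mavg_one (k : ℤ) : mavg k (1 : Matrix ι ι (RL Y)) = if k = 0 then 1 else 0 := by
  ext1 i j
  simp only [mavg, Matrix.map_apply]
  by_cases h : i = j
  · subst h
    rw [Matrix.one_apply_eq, mul_one, avg_zp]
    by_cases hk : k = 0 <;> simp [hk]
  · rw [Matrix.one_apply_ne h, mul_zero, avg_zero]
    by_cases hk : k = 0 <;> simp [hk, h]

theorem mavg_map (g : C(Y', Y)) (k : ℤ) (A : Matrix ι ι (RL Y)) : mavg k (A.map (pb (gL g))) = (mavg k A).map (pb g) := by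
  ext1 i j
  simp only [mavg, Matrix.map_apply]
  rw [← avg_map, map_mul]
  congr 1

theorem mavg_small (A : Matrix ι ι (RL Y)) (y : Y) (e : ℕ → ℤ) (he : ∀ n, n ≤ (e n).natAbs) :
    Filter.Tendsto (fun n => (mavg (e n) A).map (ev y)) Filter.atTop (𝓝 0) := by
  refine tendsto_pi_nhds.2 fun i => ?_
  refine tendsto_pi_nhds.2 fun j => ?_
  rw [Metric.tendsto_atTop]
  intro ε hε
  obtain ⟨N, hN⟩ := avg_small (A i j) hε
  refine ⟨N + 1, fun n hn => ?_⟩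
  have := hN (-(e n)) (by have := he n; omega) y
  rw [dist_eq_norm]
  simpa [mavg] using this

variable {a b : Matrix ι ι (RA Y)} {u : (Matrix ι ι (RL Y))ˣ}

theorem pen_rec (hu : (u : Matrix ι ι (RL Y)) = pen a b) (y : Y) :
    Rec (a.map (ev y)) (b.map (ev y)) (fun k => (mavg k ((u⁻¹ : (Matrix ι ι (RL Y))ˣ) : Matrix ι ι (RL Y))).map (ev y)) where
  L k := by
    have h := mavg_pen_mul k a b ((u⁻¹ : (Matrix ι ι (RL Y))ˣ) : Matrix ι ι (RL Y))
    rw [← hu, u.mul_inv, mavg_one] at h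
    have := congrArg (ev y).mapMatrix h
    rw [map_add, map_mul, map_mul] at this
    refine this.symm.trans ?_
    split_ifs <;> simp
  R k := by
    have h := mavg_mul_pen k a b ((u⁻¹ : (Matrix ι ι (RL Y))ˣ) : Matrix ι ι (RL Y))
    rw [← hu, u.inv_mul, mavg_one] at h
    have := congrArg (ev y).mapMatrix h
    rw [map_add, map_mul, map_mul] at this
    refine this.symm.trans ?_
    split_ifs <;> simp
  t1 := mavg_small _ y _ (fun n => by omega)
  t2 := mavg_small _ y _ (fun n => by omega)

variable (a u) in
noncomputable def penQ : Matrix ι ι (RA Y) := a * mavg (-1) ((u⁻¹ : (Matrix ι ι (RL Y))ˣ) : Matrix ι ι (RL Y))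

theorem penQ_idem (hu : (u : Matrix ι ι (RL Y)) = pen a b) : penQ a u * penQ a u = penQ a u := by
  refine mat_ext fun y => ?_
  simp only [penQ, Matrix.map_mul]
  exact (pen_rec hu y).idem

theorem penQ_map (g : C(Y', Y)) : penQ (a.map (pb g)) (umap (pb (gL g)) u) = (penQ a u).map (pb g) := by
  rw [penQ, penQ, Matrix.map_mul, ← mavg_map]; rfl

theorem kap_pen (hu : (u : Matrix ι ι (RL Y)) = pen a b) : kap u = kap (Lq (penQ a u) (penQ_idem hu)) := by
  let Q := penQ a u
  have hQ : Q * Q = Q := penQ_idem hu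
  let g : Matrix ι ι (RA Y) := Q * a + (1 - Q) * b
  let D0 : Matrix ι ι (RL Y) := Lq Q hQ * g.map (pb (mpl Y))
  have hD0 : ∀ y z, D0.map (ev (y, z)) = Q.map (ev y) * ((z : ℂ) • a.map (ev y)) + (1 - Q.map (ev y)) * b.map (ev y) := by
    intro y z
    have hq : Q.map (ev y) * Q.map (ev y) = Q.map (ev y) := by rw [← Matrix.map_mul, hQ]
    have e : (g.map (pb (mpl Y))).map (ev (y, z)) = Q.map (ev y) * a.map (ev y) + (1 - Q.map (ev y)) * b.map (ev y) := by
      have : (g.map (pb (mpl Y))).map (ev (y, z)) = g.map (ev y) := rfl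
      rw [this]
      have h := map_add (ev y).mapMatrix (Q * a) ((1 - Q) * b)
      rw [map_mul, map_mul, map_sub, map_one] at h
      exact h
    rw [Matrix.map_mul, Lq_ev, e]
    generalize Q.map (ev y) = q at *
    have h1 : q * (1 - q) = 0 := by rw [mul_sub, hq, mul_one, sub_self]
    have h2 : (1 - q) * q = 0 := by rw [sub_mul, hq, one_mul, sub_self]
    have h3 : (1 - q) * (1 - q) = 1 - q := by rw [mul_sub, h2, mul_one, sub_zero]
    rw [add_mul, mul_add, mul_add, Matrix.smul_mul, Matrix.smul_mul, ← mul_assoc, ← mul_assoc, ← mul_assoc, ← mul_assoc, hq, h1, h2, h3]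
    simp
  have key : ∀ (t : ℝ), 0 ≤ t → t ≤ 1 → ∀ x, IsUnit ((u : Matrix ι ι (RL Y)).map (ev x) + (t : ℂ) • (D0.map (ev x) - (u : Matrix ι ι (RL Y)).map (ev x))) := by
    rintro t t0 t1 ⟨y, z⟩
    rw [Matrix.isUnit_iff_isUnit_det, isUnit_iff_ne_zero]
    intro hdet
    obtain ⟨v, hv, h0⟩ := Matrix.exists_mulVec_eq_zero_iff.2 hdet
    apply hv
    refine (pen_rec hu y).ker (z := z) (s := ((1 - t : ℝ) : ℂ)) (Circle.norm_coe z) ?_ ?_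
    · rw [Complex.norm_real, Real.norm_of_nonneg (by linarith)]; linarith
    · rw [← h0]
      congr 1
      have hq : Q.map (ev y) = a.map (ev y) * (mavg (-1) ((u⁻¹ : (Matrix ι ι (RL Y))ˣ) : Matrix ι ι (RL Y))).map (ev y) := by
        rw [← Matrix.map_mul]; rfl
      rw [← hq, hD0, hu, pen_ev]
      generalize Q.map (ev y) = q
      generalize a.map (ev y) = a'
      generalize b.map (ev y) = b'
      simp only [mul_add, sub_mul, one_mul, Matrix.mul_smul, smul_add, smul_sub, smul_smul]
      push_cast
      module
  have hu0 : IsUnit D0 := by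
    rw [isUnit_mat_iff']
    intro x
    have := key 1 (by norm_num) (by norm_num) x
    simpa using this
  obtain ⟨d, hd⟩ := hu0
  have hg : IsUnit g := by
    have h1 : g.map (pb (mpl Y)) = ((((Lq Q hQ)⁻¹ * d : (Matrix ι ι (RL Y))ˣ)) : Matrix ι ι (RL Y)) := by
      rw [Units.val_mul, hd, ← Matrix.mul_assoc, Units.inv_mul, Matrix.one_mul]
    have h2 : g = (umap (pb (mk1 Y)) ((Lq Q hQ)⁻¹ * d)).val := by
      rw [umap_val, ← h1]; rfl
    rw [h2]; exact Units.isUnit _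
  obtain ⟨g', hg'⟩ := hg
  have hdd : d = Lq Q hQ * umap (pb (mpl Y)) g' := by
    apply Units.ext
    rw [hd, Units.val_mul, umap_val, hg']
  have k1 : kap u = kap d := by
    refine kap_seg ?_
    rw [hd]
    exact fun t x => key t t.2.1 t.2.2 x
  have k2 := kap_mul (Lq Q hQ) (umap (pb (mpl Y)) g')
  rw [← hdd, kap_const] at k2
  rw [k1]
  exact add_right_cancel k2

end pencil
end BK

namespace BK
open Matrix Kronecker Topology

section gen
variable {R S : Type} [CommRing R] [CommRing S] {ι : Type} [Fintype ι] [DecidableEq ι]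

/-- block companion matrix -/
def compM (M : ℕ) (τ : R) (q0 : Matrix ι ι R) (p : ℕ → Matrix ι ι R) : Matrix (Fin (M + 1) × ι) (Fin (M + 1) × ι) R :=
  Matrix.of fun a b => if a.1 = 0 then (if b.1 = 0 then q0 a.2 b.2 else p b.1 a.2 b.2)
    else (if a = b then 1 else 0) - (if a.1.val = b.1.val + 1 ∧ a.2 = b.2 then τ else 0)

def compA (R : Type) [CommRing R] (ι : Type) [DecidableEq ι] (M : ℕ) : Matrix (Fin (M + 1) × ι) (Fin (M + 1) × ι) R :=
  Matrix.of fun a b => if a.1.val = b.1.val + 1 ∧ a.2 = b.2 then -1 else 0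

theorem compM_map (f : R →+* S) (M : ℕ) (τ : R) (q0 : Matrix ι ι R) (p : ℕ → Matrix ι ι R) :
    (compM M τ q0 p).map f = compM M (f τ) (q0.map f) (fun l => (p l).map f) := by
  ext a b
  simp only [compM, Matrix.map_apply, Matrix.of_apply]
  split_ifs <;> simp

theorem compA_map (f : R →+* S) (M : ℕ) : (compA R ι M).map f = compA S ι M := by
  ext a b
  simp only [compA, Matrix.map_apply, Matrix.of_apply]
  split_ifs <;> simp

theorem compM_eq (M : ℕ) (τ : R) (q0 : Matrix ι ι R) (p : ℕ → Matrix ι ι R) :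
    compM M τ q0 p = τ • compA R ι M + compM M 0 q0 p := by
  ext a b
  simp only [compM, compA, Matrix.add_apply, Matrix.smul_apply, Matrix.of_apply, smul_eq_mul]
  by_cases h : a.1 = 0
  · have : ¬ (a.1.val = b.1.val + 1 ∧ a.2 = b.2) := by rw [h]; rintro ⟨h, -⟩; simp at h
    simp [h]
  · rw [if_neg h, if_neg h]; split_ifs <;> ring

theorem compM_ker (M : ℕ) (τ : R) (q0 : Matrix ι ι R) (p : ℕ → Matrix ι ι R) (v : Fin (M + 1) × ι → R)
    (h : compM M τ q0 p *ᵥ v = 0) : (∀ (i : Fin M) k, v (i.succ, k) = τ * v (i.castSucc, k)) ∧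
    ∀ k, ∑ j, q0 k j * v (0, j) + ∑ i : Fin M, ∑ j, p (i.val + 1) k j * v (i.succ, j) = 0 := by
  constructor
  · intro i k
    have := congrFun h (i.succ, k)
    simp only [Matrix.mulVec, dotProduct, compM, Matrix.of_apply, Fin.succ_ne_zero, if_false, sub_mul, Finset.sum_sub_distrib, Pi.zero_apply] at this
    rw [sub_eq_zero] at this
    rw [Finset.sum_eq_single (i.succ, k), Finset.sum_eq_single (i.castSucc, k)] at this
    · simpa using this
    · rintro ⟨b1, b2⟩ - hb
      rw [if_neg, zero_mul]
      rintro ⟨h1, h2⟩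
      apply hb
      ext
      · simp at h1 ⊢; exact h1.symm
      · exact h2.symm
    · simp
    · rintro b - hb
      rw [if_neg (Ne.symm hb), zero_mul]
    · simp
  · intro k
    have := congrFun h (0, k)
    simp only [Matrix.mulVec, dotProduct, compM, Matrix.of_apply, Fintype.sum_prod_type, Fin.sum_univ_succ, if_true, Fin.succ_ne_zero, if_false, Pi.zero_apply, Fin.val_succ] at this
    exact this

theorem compM_ker' (M : ℕ) (τ : R) (q0 : Matrix ι ι R) (p : ℕ → Matrix ι ι R) (v : Fin (M + 1) × ι → R)
    (h : compM M τ q0 p *ᵥ v = 0) (hi : ∀ w : ι → R, (∀ k, ∑ j, (q0 k j + ∑ i ∈ Finset.range M, τ ^ (i + 1) * p (i + 1) k j) * w j = 0) → w = 0) : v = 0 := by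
  obtain ⟨h1, h2⟩ := compM_ker M τ q0 p v h
  have h3 : ∀ (i : Fin (M + 1)) k, v (i, k) = τ ^ i.val * v (0, k) := by
    intro i
    induction i using Fin.induction with
    | zero => simp
    | succ i ih => intro k; rw [h1, ih]; simp [pow_succ]; ring
  have h4 : (fun k => v (0, k)) = 0 := by
    apply hi
    intro k
    rw [← h2 k]
    simp only [add_mul, Finset.sum_add_distrib, Finset.sum_mul]
    congr 1
    rw [Finset.sum_comm, Finset.sum_range]
    refine Finset.sum_congr rfl fun i _ => Finset.sum_congr rfl fun j _ => ?_
    rw [h3 i.succ]; simp; ring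
  ext ⟨i, k⟩
  rw [h3, congrFun h4 k]; simp

def splitEq (M : ℕ) (ι : Type) : Fin (M + 1) × ι ≃ ι ⊕ (Fin M × ι) where
  toFun x := Fin.cases (motive := fun _ => ι ⊕ (Fin M × ι)) (Sum.inl x.2) (fun i => Sum.inr (i, x.2)) x.1
  invFun := Sum.elim (fun k => (0, k)) (fun x => (x.1.succ, x.2))
  left_inv := by
    rintro ⟨i, k⟩
    induction i using Fin.cases <;> simp
  right_inv := by rintro (k | ⟨i, k⟩) <;> simp

theorem compM_split (M : ℕ) (q0 : Matrix ι ι R) (a b) : (fromBlocks q0 0 0 1 : Matrix (ι ⊕ (Fin M × ι)) (ι ⊕ (Fin M × ι)) R) (splitEq M ι a) (splitEq M ι b)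
    = compM M 0 q0 0 a b := by
  obtain ⟨i, k⟩ := a
  obtain ⟨j, l⟩ := b
  induction i using Fin.cases <;> induction j using Fin.cases <;>
    simp [splitEq, compM, Matrix.one_apply, Fin.succ_ne_zero, Prod.ext_iff]
end gen

variable {Y Y' : Type} [TopologicalSpace Y] [CompactSpace Y] [T2Space Y] [TopologicalSpace Y'] [CompactSpace Y'] [T2Space Y']
variable {ι κ : Type} [Fintype ι] [DecidableEq ι] [Fintype κ] [DecidableEq κ]

theorem kap_reindex (σ : ι ≃ κ) (α : (Matrix ι ι (RL Y))ˣ) (β : (Matrix κ κ (RL Y))ˣ)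
    (h : ∀ i j, (β : Matrix κ κ (RL Y)) (σ i) (σ j) = (α : Matrix ι ι (RL Y)) i j) : kap α = kap β := by
  have h1 : (α : Matrix ι ι (RL Y)) = (β : Matrix κ κ (RL Y)).submatrix σ σ := by ext1 i j; exact (h i j).symm
  have h2 : ((α⁻¹ : (Matrix ι ι (RL Y))ˣ) : Matrix ι ι (RL Y)) = ((β⁻¹ : (Matrix κ κ (RL Y))ˣ) : Matrix κ κ (RL Y)).submatrix σ σ := by
    have h3 : (α : Matrix ι ι (RL Y)) * ((β⁻¹ : (Matrix κ κ (RL Y))ˣ) : Matrix κ κ (RL Y)).submatrix σ σ = 1 := by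
      rw [h1, Matrix.submatrix_mul_equiv, β.mul_inv, Matrix.submatrix_one_equiv]
    calc _ = ((α⁻¹ : (Matrix ι ι (RL Y))ˣ) : Matrix ι ι (RL Y)) * ((α : Matrix ι ι (RL Y)) * ((β⁻¹ : (Matrix κ κ (RL Y))ˣ) : Matrix κ κ (RL Y)).submatrix σ σ) := by rw [h3, Matrix.mul_one]
      _ = _ := by rw [← Matrix.mul_assoc, α.inv_mul, Matrix.one_mul]
  refine cls_eq_of (Eqv.of_equiv (σ.sumCongr σ) ?_)
  have : (clE β).submatrix (σ.sumCongr σ) (σ.sumCongr σ) = clE α := by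
    refine mat_ext_pol (Y := Y) (ι := ι ⊕ ι) (κ := ι ⊕ ι) ?_
    intro y s z
    have e := cl_ev β y s z
    have : ((clE β).submatrix (σ.sumCongr σ) (σ.sumCongr σ)).map (ev (y, pol (s, z))) = ((clE β).map (ev (y, pol (s, z)))).submatrix (σ.sumCongr σ) (σ.sumCongr σ) := rfl
    rw [this, e, cl_ev, h1, h2]
    ext (i | i) (j | j) <;> simp [Matrix.one_apply]
  intro i j
  exact congrFun (congrFun this i) j

theorem Pz_ev (M : ℕ) (p : ℕ → Matrix ι ι (RA Y)) (y : Y) (z : Circle) (i j : ι) :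
    Pz M p i j (y, z) = p 0 i j y + ∑ l ∈ Finset.range M, (z : ℂ) ^ (l + 1) * p (l + 1) i j y := by
  rw [Pz, Matrix.of_apply, ContinuousMap.sum_apply, Finset.sum_range_succ', add_comm]
  simp only [ContinuousMap.mul_apply, zp_ap, pb_apply]
  congr 1
  simp

theorem pen_comp_ev (M : ℕ) (p : ℕ → Matrix ι ι (RA Y)) (y : Y) (z : Circle) :
    (pen (compA (RA Y) ι M) (compM M 0 (p 0) p)).map (ev (y, z)) = compM M (z : ℂ) ((p 0).map (ev y)) (fun l => (p l).map (ev y)) := by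
  rw [pen_ev, compA_map, compM_map, compM_eq M (z : ℂ), map_zero]

theorem inj_of_unit {A : Matrix ι ι ℂ} (h : IsUnit A) (w : ι → ℂ) (hw : A *ᵥ w = 0) : w = 0 := by
  obtain ⟨u, rfl⟩ := h
  have := congrArg (fun x => ((u⁻¹ : (Matrix ι ι ℂ)ˣ) : Matrix ι ι ℂ) *ᵥ x) hw
  simpa [Matrix.mulVec_mulVec] using this

theorem comp_unit {M : ℕ} {p : ℕ → Matrix ι ι (RA Y)} (h : IsUnit (Pz M p)) :
    IsUnit (pen (compA (RA Y) ι M) (compM M 0 (p 0) p)) := by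
  refine isUnit_of_ker ?_
  rintro ⟨y, z⟩ v hv
  rw [pen_comp_ev] at hv
  refine compM_ker' _ _ _ _ v hv ?_
  intro w hw
  refine inj_of_unit (isUnit_mat_iff'.1 h (y, z)) w ?_
  ext k
  rw [Pi.zero_apply, ← hw k]
  simp only [Matrix.mulVec, dotProduct, Matrix.map_apply, ev_apply, Pz_ev]

/-- path from the companion matrix to the block sum -/
noncomputable def pathQ (M : ℕ) (p : ℕ → Matrix ι ι (RA Y)) : Matrix ι ι (RL (I01 × Y)) := Matrix.of fun i j =>
  ⟨fun x => Pz M p i j (x.1.2, x.2) - ((x.1.1 : ℝ) : ℂ) * ∑ l ∈ Finset.range M, (((x.1.1 : ℝ) : ℂ) * (x.2 : ℂ)) ^ (l + 1) * p (l + 1) i j x.1.2, by fun_prop⟩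
noncomputable def pathP (p : ℕ → Matrix ι ι (RA Y)) (l : ℕ) : Matrix ι ι (RL (I01 × Y)) := Matrix.of fun i j =>
  ⟨fun x => ((x.1.1 : ℝ) : ℂ) * p l i j x.1.2, by fun_prop⟩
noncomputable def pathT (Y : Type) [TopologicalSpace Y] : RL (I01 × Y) := ⟨fun x => ((x.1.1 : ℝ) : ℂ) * x.2, by fun_prop⟩

theorem kap_comp {M : ℕ} {p : ℕ → Matrix ι ι (RA Y)} (h : IsUnit (Pz M p)) :
    kap (comp_unit h).unit = kap h.unit + ((M * Fintype.card ι : ℕ) : K (RS Y)) := by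
  have hF : IsUnit (compM M (pathT Y) (pathQ M p) (pathP p)) := by
    refine isUnit_of_ker ?_
    rintro ⟨⟨t, y⟩, z⟩ v hv
    rw [compM_map] at hv
    refine compM_ker' _ _ _ _ v hv ?_
    intro w hw
    refine inj_of_unit (isUnit_mat_iff'.1 h (y, z)) w ?_
    ext k
    rw [Pi.zero_apply, ← hw k]
    simp only [Matrix.mulVec, dotProduct, Matrix.map_apply, ev_apply]
    refine Finset.sum_congr rfl fun j _ => ?_
    congr 1
    simp only [pathQ, pathP, pathT, Matrix.of_apply, ContinuousMap.coe_mk, Finset.mul_sum]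
    rw [eq_comm, sub_add_eq_add_sub, sub_eq_iff_eq_add]
    congr 1
    refine Finset.sum_congr rfl fun l _ => by ring
  have e1 : kap (udiag h.unit (1 : (Matrix (Fin M × ι) (Fin M × ι) (RL Y))ˣ)) = kap h.unit + ((M * Fintype.card ι : ℕ) : K (RS Y)) := by
    rw [kap_add, kap_one]; simp
  rw [← e1]
  have h0u : IsUnit ((compM M (pathT Y) (pathQ M p) (pathP p)).map (pb (gL (atT Y 0)))) := 
    hF.map ((pb (gL (atT Y 0))).mapMatrix (m := Fin (M + 1) × ι))
  have e2 : (compM M (pathT Y) (pathQ M p) (pathP p)).map (pb (gL (atT Y 0))) = compM M 0 (Pz M p) 0 := by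
    rw [compM_map]
    congr 1
    · ext x; simp [pathT, pb_apply]
    · ext i j x; simp [pathQ, pb_apply]
    · ext l i j x; simp [pathP, pb_apply]
  have e3 : (compM M (pathT Y) (pathQ M p) (pathP p)).map (pb (gL (atT Y 1))) = pen (compA (RA Y) ι M) (compM M 0 (p 0) p) := by
    refine mat_ext ?_
    rintro ⟨y, z⟩
    rw [pen_comp_ev, compM_map, compM_map]
    congr 1
    · simp [pathT, pb_apply, ev_apply]
    · ext i j; simp [pathQ, pb_apply, ev_apply, Pz_ev]
    · ext l i j; simp [pathP, pb_apply]
  rw [← kap_path (α := h0u.unit) (β := (comp_unit h).unit) _ hF rfl e3]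
  refine kap_reindex (splitEq M ι) _ _ ?_
  intro a b
  rw [IsUnit.unit_spec, e2]
  exact compM_split M (Pz M p) a b

end BK

namespace BK
open Matrix Kronecker Topology

variable {Y Y' : Type} [TopologicalSpace Y] [CompactSpace Y] [T2Space Y] [TopologicalSpace Y'] [CompactSpace Y'] [T2Space Y']
variable {ι κ : Type} [Fintype ι] [DecidableEq ι] [Fintype κ] [DecidableEq κ]

/-- the map (a,b) ↦ a + b H -/
noncomputable def TT (Y : Type) [TopologicalSpace Y] [CompactSpace Y] [T2Space Y] : K (RA Y) × K (RA Y) →+ K (RS Y) where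
  toFun x := K.map (pb (mpr Y)) x.1 + K.map (pb (mpr Y)) x.2 * Hh Y
  map_zero' := by simp
  map_add' x y := by simp; ring

theorem TT_apply (x : K (RA Y) × K (RA Y)) : TT Y x = K.map (pb (mpr Y)) x.1 + K.map (pb (mpr Y)) x.2 * Hh Y := rfl

theorem kap_L_mem (q : Matrix ι ι (RA Y)) (h : q * q = q) : kap (Lq q h) ∈ (TT Y).range :=
  ⟨(cls ⟨ι, 1 - q, compl_idem h⟩, cls ⟨ι, q, h⟩), by rw [kap_L, TT_apply, add_comm]⟩

theorem pr_mem (a : K (RA Y)) : K.map (pb (mpr Y)) a ∈ (TT Y).range := ⟨(a, 0), by simp [TT_apply]⟩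
theorem nat_mem (n : ℕ) : (n : K (RS Y)) ∈ (TT Y).range := ⟨(n, 0), by simp [TT_apply]⟩

theorem kap_zS_mem (n : ℕ) : kap (zS n : (Matrix ι ι (RL Y))ˣ) ∈ (TT Y).range := by
  induction n with
  | zero => rw [zS, pow_zero, kap_one]; exact nat_mem _
  | succ n ih =>
    have h := kap_mul (zS n : (Matrix ι ι (RL Y))ˣ) (Lq 1 (by simp))
    have e : zS (n + 1) = (zS n : (Matrix ι ι (RL Y))ˣ) * (Lq 1 (by simp)) := pow_succ _ _
    rw [e, eq_sub_of_add_eq h]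
    exact sub_mem (add_mem ih (kap_L_mem _ _)) (nat_mem _)

theorem kap_mem (α : (Matrix ι ι (RL Y))ˣ) : kap α ∈ (TT Y).range := by
  obtain ⟨n, M, p, hn, h⟩ := poly_approx α
  have hu : IsUnit (Pz M p) := by
    rw [isUnit_mat_iff']
    intro x
    have := h 1 zero_le_one le_rfl x
    simpa using this
  have e1 : kap (zS n * α) = kap hu.unit := kap_seg fun t x => h t t.2.1 t.2.2 x
  have e2 := kap_comp hu
  have e3 := kap_pen (u := (comp_unit hu).unit) (a := compA (RA Y) ι M) rfl
  have e4 := kap_mul (zS n) α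
  have : kap α = kap (Lq _ (penQ_idem (u := (comp_unit hu).unit) (a := compA (RA Y) ι M) rfl)) - ((M * Fintype.card ι : ℕ) : K (RS Y)) + (Fintype.card ι : K (RS Y)) - kap (zS n : (Matrix ι ι (RL Y))ˣ) := by
    rw [← e3, e2, ← e1]
    linear_combination -e4
  rw [this]
  exact sub_mem (add_mem (sub_mem (kap_L_mem _ _) (nat_mem _)) (nat_mem _)) (kap_zS_mem _)

/-- scaling the radial coordinate -/
noncomputable abbrev mh (Y : Type) [TopologicalSpace Y] : C(I01 × (Y × (I01 × Circle)), Y × S2) :=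
  ⟨fun x => (x.2.1, pol (x.1 * x.2.2.1, x.2.2.2)), by fun_prop⟩

theorem mh_1 : (mh Y).comp (atT (Y × (I01 × Circle)) 1) = mpol Y := by
  ext1 x; simp [mh]
theorem mh_0 : (mh Y).comp (atT (Y × (I01 × Circle)) 0) = (mN Y).comp ((mpl Y).comp (mj Y)) := by
  ext1 x; simp [mh]; exact pol_zero _ _

theorem eqv_polar (ε : Pj (RS Y)) : Eqv (ε.map (pb (mpol Y))) ((ε.map (pb (mN Y))).map (pb ((mpl Y).comp (mj Y)))) := by
  have := eqv_homotopy (ε.map (pb (mh Y))) 1 0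
  have h1 : (ε.map (pb (mh Y))).map (pb (atT (Y × (I01 × Circle)) 1)) = ε.map (pb (mpol Y)) := by
    rw [← mh_1]; rfl
  have h0 : (ε.map (pb (mh Y))).map (pb (atT (Y × (I01 × Circle)) 0)) = (ε.map (pb (mN Y))).map (pb ((mpl Y).comp (mj Y))) := by
    have : (ε.map (pb (mh Y))).map (pb (atT (Y × (I01 × Circle)) 0)) = ε.map (pb ((mh Y).comp (atT (Y × (I01 × Circle)) 0))) := rfl
    rw [this, mh_0]; rfl
  rwa [h1, h0] at this

theorem mpol_0 {ι κ : Type} (A : Matrix ι κ (RS Y)) : (A.map (pb (mpol Y))).map (pb (mat0 Y 0)) = (A.map (pb (mN Y))).map (pb (mpl Y)) := by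
  ext i j x
  show A i j (x.1, pol (0, x.2)) = A i j (x.1, pol (0, 1))
  rw [pol_zero]
theorem mpol_1 {ι κ : Type} (A : Matrix ι κ (RS Y)) : (A.map (pb (mpol Y))).map (pb (mat0 Y 1)) = (A.map (pb (mS Y))).map (pb (mpl Y)) := by
  ext i j x
  show A i j (x.1, pol (1, x.2)) = A i j (x.1, pol (1, 1))
  rw [pol_one]
theorem mk_pl {ι κ : Type} (A : Matrix ι κ (RA Y)) : (A.map (pb (mpl Y))).map (pb (mk1 Y)) = A := by
  ext i j x; rfl

theorem eqv_cl (ε : Pj (RS Y)) (h : Eqv (ε.map (pb (mN Y))) (Pj.triv (RA Y) κ)) :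
    ∃ α : (Matrix κ κ (RL Y))ˣ, Eqv ε (cl α) := by
  obtain ⟨a, b, hab, hba⟩ := h
  change a * b = ε.e.map (pb (mN Y)) at hab
  change b * a = 1 at hba
  obtain ⟨X, Z, hXZ, hZX⟩ := (eqv_polar ε).trans (Eqv.map (pb ((mpl Y).comp (mj Y))) ⟨a, b, hab, hba⟩)
  change X * Z = ε.e.map (pb (mpol Y)) at hXZ
  change Z * X = (1 : Matrix κ κ (RA Y)).map _ at hZX
  rw [map_one'] at hZX
  change Matrix ε.ι κ (RA Y) at a
  change Matrix κ ε.ι (RA Y) at b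
  change Matrix ε.ι κ (RW Y) at X
  change Matrix κ ε.ι (RW Y) at Z
  -- values at the north pole
  obtain ⟨X0, hX0⟩ : ∃ X0, X0 = X.map (pb (mat0 Y 0)) := ⟨_, rfl⟩
  obtain ⟨Z0, hZ0⟩ : ∃ Z0, Z0 = Z.map (pb (mat0 Y 0)) := ⟨_, rfl⟩
  obtain ⟨A, hA⟩ : ∃ A, A = a.map (pb (mpl Y)) := ⟨_, rfl⟩
  obtain ⟨B, hB⟩ : ∃ B, B = b.map (pb (mpl Y)) := ⟨_, rfl⟩
  have hBA : B * A = 1 := by rw [hB, hA, ← Matrix.map_mul, hba, map_one']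
  have h00 : Z0 * X0 = 1 := by rw [hZ0, hX0, ← Matrix.map_mul, hZX, map_one']
  have h01 : X0 * Z0 = A * B := by rw [hZ0, hX0, ← Matrix.map_mul, hXZ, mpol_0, ← hab, hA, hB, Matrix.map_mul]
  have hG1 : (Z0 * A) * (B * X0) = 1 := by
    rw [Matrix.mul_assoc, ← Matrix.mul_assoc A, ← h01, ← Matrix.mul_assoc, ← Matrix.mul_assoc, h00, Matrix.one_mul, h00]
  have hG2 : (B * X0) * (Z0 * A) = 1 := by
    rw [Matrix.mul_assoc, ← Matrix.mul_assoc X0, h01, ← Matrix.mul_assoc, ← Matrix.mul_assoc, hBA, Matrix.one_mul, hBA]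
  obtain ⟨X', hX'⟩ : ∃ X', X' = X * (Z0 * A).map (pb (mj Y)) := ⟨_, rfl⟩
  obtain ⟨Z', hZ'⟩ : ∃ Z', Z' = (B * X0).map (pb (mj Y)) * Z := ⟨_, rfl⟩
  have hf : Fr ε X' Z' := by
    constructor
    · rw [hX', hZ', Matrix.mul_assoc, ← Matrix.mul_assoc Z, hZX, Matrix.one_mul, ← Matrix.map_mul, hG2, map_one']
    · rw [hX', hZ', Matrix.mul_assoc, ← Matrix.mul_assoc _ _ Z, ← Matrix.map_mul, hG1, map_one', Matrix.one_mul, hXZ]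
  have hX'0 : X'.map (pb (mat0 Y 0)) = A := by
    rw [hX', Matrix.map_mul, map_j, ← hX0, ← Matrix.mul_assoc, h01, Matrix.mul_assoc, hBA, Matrix.mul_one]
  have hZ'0 : Z'.map (pb (mat0 Y 0)) = B := by
    rw [hZ', Matrix.map_mul, map_j, ← hZ0, Matrix.mul_assoc, h01, ← Matrix.mul_assoc, hBA, Matrix.one_mul]
  obtain ⟨X1, hX1⟩ : ∃ X1, X1 = X'.map (pb (mat0 Y 1)) := ⟨_, rfl⟩
  obtain ⟨Z1, hZ1⟩ : ∃ Z1, Z1 = Z'.map (pb (mat0 Y 1)) := ⟨_, rfl⟩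
  have h11 : X1 * Z1 = (ε.e.map (pb (mS Y))).map (pb (mpl Y)) := by rw [hX1, hZ1, ← Matrix.map_mul, hf.eq, mpol_1]
  have h10 : Z1 * X1 = 1 := by rw [hX1, hZ1, ← Matrix.map_mul, hf.one, map_one']
  obtain ⟨kX, hkX⟩ : ∃ kX, kX = X1.map (pb (mk1 Y)) := ⟨_, rfl⟩
  obtain ⟨kZ, hkZ⟩ : ∃ kZ, kZ = Z1.map (pb (mk1 Y)) := ⟨_, rfl⟩
  have hk0 : kZ * kX = 1 := by rw [hkX, hkZ, ← Matrix.map_mul, h10, map_one']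
  have hk1 : kX * kZ = ε.e.map (pb (mS Y)) := by rw [hkX, hkZ, ← Matrix.map_mul, h11, mk_pl]
  have hu1 : (kZ.map (pb (mpl Y)) * X1) * (Z1 * kX.map (pb (mpl Y))) = 1 := by
    rw [Matrix.mul_assoc, ← Matrix.mul_assoc X1, h11, ← Matrix.map_mul, ← Matrix.map_mul, ← hk1, Matrix.mul_assoc, hk0, Matrix.mul_one, hk0, map_one']
  have hu2 : (Z1 * kX.map (pb (mpl Y))) * (kZ.map (pb (mpl Y)) * X1) = 1 := by
    rw [Matrix.mul_assoc, ← Matrix.mul_assoc _ _ X1, ← Matrix.map_mul, hk1, ← h11, Matrix.mul_assoc, h10, Matrix.mul_one, h10]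
  refine ⟨⟨kZ.map (pb (mpl Y)) * X1, Z1 * kX.map (pb (mpl Y)), hu1, hu2⟩, Fr.cmp hf (cl_fr _) ?_ ?_⟩
  · refine good_of (fromCols a 0) (fromCols 0 (ε.e.map (pb (mS Y)) * kX)) ?_ ?_
    · rw [Matrix.map_mul, clZ_0, hX'0, hA, fromCols_map, mul_fromCols]; simp
    · rw [Matrix.map_mul, clZ_1, ← hX1, fromCols_map, Matrix.map_mul, ← h11, mul_fromCols]
      simp [Matrix.mul_assoc]
  · refine good_of (fromRows b 0) (fromRows 0 (kZ * ε.e.map (pb (mS Y)))) ?_ ?_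
    · rw [Matrix.map_mul, clX_0, hZ'0, hB, fromRows_map, fromRows_mul]; simp
    · rw [Matrix.map_mul, clX_1, ← hZ1, fromRows_map, Matrix.map_mul, ← h11, fromRows_mul]
      simp [Matrix.mul_assoc]

theorem TT_surj (ξ : K (RS Y)) : ∃ a b, ξ = K.map (pb (mpr Y)) a + K.map (pb (mpr Y)) b * Hh Y := by
  suffices h : ∀ ε : Pj (RS Y), cls ε ∈ (TT Y).range by
    obtain ⟨p, q, rfl⟩ := K.exists_sub ξ
    obtain ⟨⟨a, b⟩, h⟩ := sub_mem (h p) (h q)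
    exact ⟨a, b, h.symm⟩
  intro ε
  obtain ⟨ε', hε'⟩ : ∃ ε', ε' = ε.add ((ε.map (pb (mN Y))).compl.map (pb (mpr Y))) := ⟨_, rfl⟩
  have h1 : cls (ε'.map (pb (mN Y))) = cls (Pj.triv (RA Y) ε.ι) := by
    rw [← K.map_cls, hε', cls_add, map_add, ← K.map_cls, pr_N, K.map_cls]
    exact cls_compl (ε.map (pb (mN Y)))
  obtain ⟨n, hn⟩ := cls_eq_iff.1 h1
  have h2 : Eqv ((ε'.add (Pj.triv (RS Y) (Fin n))).map (pb (mN Y))) (Pj.triv (RA Y) (ε.ι ⊕ Fin n)) := by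
    refine Eqv.trans ?_ (hn.trans ?_)
    · refine Eqv.of_equiv (Equiv.refl _) ?_
      intro i j
      show fromBlocks (ε'.e.map (pb (mN Y))) 0 0 1 i j = (fromBlocks ε'.e 0 0 1).map (pb (mN Y)) i j
      rw [fromBlocks_map]; simp
    · refine Eqv.of_equiv (Equiv.refl _) ?_
      intro i j
      show (1 : Matrix (ε.ι ⊕ Fin n) (ε.ι ⊕ Fin n) (RA Y)) i j = fromBlocks 1 0 0 1 i j
      rw [fromBlocks_one]
  obtain ⟨α, hα⟩ := eqv_cl _ h2
  have h3 := cls_eq_of hα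
  rw [cls_add, hε', cls_add, ← K.map_cls] at h3
  have : cls ε = kap α - cls (Pj.triv (RS Y) (Fin n)) - K.map (pb (mpr Y)) (cls (ε.map (pb (mN Y))).compl) := by
    rw [kap, ← h3]; ring
  rw [this]
  refine sub_mem (sub_mem (kap_mem α) ?_) (pr_mem _)
  rw [cls_triv]; exact nat_mem _

end BK

namespace BK
open Matrix Kronecker Topology

section gen
variable {R S : Type} [CommRing R] [CommRing S] {ι : Type} [Fintype ι] [DecidableEq ι]

def bd (m : ℕ) (d : ℕ → Matrix ι ι R) : Matrix (Fin m × ι) (Fin m × ι) R :=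
  Matrix.of fun a b => if a.1 = b.1 then d a.1 a.2 b.2 else 0

theorem bd_idem (m : ℕ) {d : ℕ → Matrix ι ι R} (hd : ∀ i, d i * d i = d i) : bd m d * bd m d = bd m d := by
  ext ⟨i, k⟩ ⟨j, l⟩
  rw [Matrix.mul_apply, Fintype.sum_prod_type, Finset.sum_eq_single i]
  · by_cases h : i = j
    · subst h
      simp only [bd, Matrix.of_apply, if_true]
      rw [← Matrix.mul_apply, hd]
    · simp [bd, h]
  · intro b _ hb
    simp [bd, Ne.symm hb]
  · simp

theorem cls_bd (m : ℕ) (d : ℕ → Matrix ι ι R) (hd : ∀ i, d i * d i = d i) :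
    cls (⟨Fin m × ι, bd m d, bd_idem m hd⟩ : Pj R) = ∑ i ∈ Finset.range m, cls (⟨ι, d i, hd i⟩ : Pj R) := by
  induction m generalizing d with
  | zero => 
    simp only [Finset.range_zero, Finset.sum_empty]
    refine Eq.trans (cls_eq_of (Eqv.of_equiv (q := ⟨Fin 0 × ι, 0, by simp⟩) (Equiv.refl (Fin 0 × ι)) ?_)) (cls_zero (Fin 0 × ι) (by simp))
    rintro ⟨i, k⟩; exact i.elim0
  | succ m ih =>
    rw [Finset.sum_range_succ', ← ih (fun i => d (i + 1)) (fun i => hd (i + 1)), add_comm (cls _) (cls _), ← cls_add]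
    refine cls_eq_of (Eqv.of_equiv (splitEq m ι) ?_)
    rintro ⟨i, k⟩ ⟨j, l⟩
    show fromBlocks (d 0) 0 0 (bd m fun i => d (i + 1)) _ _ = bd (m + 1) d _ _
    induction i using Fin.cases <;> induction j using Fin.cases <;>
      simp [splitEq, bd, Fin.succ_ne_zero, (Fin.succ_ne_zero _).symm]

/-- generalized pencils -/
def gA (M : ℕ) (Am : ℕ → Matrix ι ι R) : Matrix (Fin (M + 1) × ι) (Fin (M + 1) × ι) R :=
  Matrix.of fun a b => if a.1.val = b.1.val + 1 then - Am a.1 a.2 b.2 else 0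
def gB (M : ℕ) (Bm p : ℕ → Matrix ι ι R) : Matrix (Fin (M + 1) × ι) (Fin (M + 1) × ι) R :=
  Matrix.of fun a b => if a.1 = 0 then p b.1 a.2 b.2 else if a.1 = b.1 then Bm a.1 a.2 b.2 else 0

theorem gA_map (f : R →+* S) (M : ℕ) (Am : ℕ → Matrix ι ι R) : (gA M Am).map f = gA M (fun i => (Am i).map f) := by
  ext a b
  simp only [gA, Matrix.map_apply, Matrix.of_apply]
  split_ifs <;> simp
theorem gB_map (f : R →+* S) (M : ℕ) (Bm p : ℕ → Matrix ι ι R) :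
    (gB M Bm p).map f = gB M (fun i => (Bm i).map f) (fun i => (p i).map f) := by
  ext a b
  simp only [gB, Matrix.map_apply, Matrix.of_apply]
  split_ifs <;> simp

theorem gA_one (M : ℕ) : gA M (fun _ => (1 : Matrix ι ι R)) = compA R ι M := by
  ext a b
  simp only [gA, compA, Matrix.of_apply, Matrix.one_apply]
  split_ifs <;> simp_all
theorem gB_one (M : ℕ) (p : ℕ → Matrix ι ι R) : gB M (fun _ => (1 : Matrix ι ι R)) p = compM M 0 (p 0) p := by
  ext a b
  simp only [gB, compM, Matrix.of_apply, Matrix.one_apply, Prod.ext_iff]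
  split_ifs <;> simp_all

def Vf {M : ℕ} (v : Fin (M + 1) × ι → R) (i : ℕ) : ι → R := fun k => if h : i < M + 1 then v (⟨i, h⟩, k) else 0

theorem gpen_ker (M : ℕ) (z : R) (Am Bm p : ℕ → Matrix ι ι R) (v : Fin (M + 1) × ι → R)
    (h : (z • gA M Am + gB M Bm p) *ᵥ v = 0) :
    (∀ i < M, Bm (i + 1) *ᵥ Vf v (i + 1) = z • (Am (i + 1) *ᵥ Vf v i)) ∧
    ∑ i ∈ Finset.range (M + 1), p i *ᵥ Vf v i = 0 := by
  constructor
  · intro i hi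
    ext k
    have := congrFun h (⟨i + 1, by omega⟩, k)
    rw [Matrix.add_mulVec, Matrix.smul_mulVec] at this
    have e1 : (gA M Am *ᵥ v) (⟨i + 1, by omega⟩, k) = - (Am (i + 1) *ᵥ Vf v i) k := by
      simp only [Matrix.mulVec, dotProduct, gA, Matrix.of_apply, Fintype.sum_prod_type]
      rw [Finset.sum_eq_single (⟨i, by omega⟩ : Fin (M + 1))]
      · simp [Vf, show i < M + 1 by omega]
      · intro b _ hb
        have : ¬ (i + 1 = b.val + 1) := by intro h; apply hb; ext; simp; omega
        simp [this]; intro h; omega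
      · simp
    have e2 : (gB M Bm p *ᵥ v) (⟨i + 1, by omega⟩, k) = (Bm (i + 1) *ᵥ Vf v (i + 1)) k := by
      simp only [Matrix.mulVec, dotProduct, gB, Matrix.of_apply, Fintype.sum_prod_type]
      rw [Finset.sum_eq_single (⟨i + 1, by omega⟩ : Fin (M + 1))]
      · simp [Vf, hi]
      · intro b _ hb
        simp [Ne.symm hb]
      · simp
    rw [Pi.add_apply, Pi.smul_apply, e1, e2] at this
    simp only [Pi.smul_apply, smul_eq_mul, Pi.zero_apply] at this ⊢
    linear_combination this
  · ext k
    have := congrFun h (0, k)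
    rw [Matrix.add_mulVec, Matrix.smul_mulVec] at this
    have e1 : (gA M Am *ᵥ v) (0, k) = 0 := by
      simp [Matrix.mulVec, dotProduct, gA]
    rw [Pi.add_apply, Pi.smul_apply, e1, smul_zero, zero_add] at this
    rw [Pi.zero_apply] at this ⊢
    rw [← this, Finset.sum_range, Finset.sum_apply]
    simp only [Matrix.mulVec, dotProduct, gB, Matrix.of_apply, Fintype.sum_prod_type, if_true]
    refine Finset.sum_congr rfl fun i _ => Finset.sum_congr rfl fun j _ => ?_
    simp only [Vf, dif_pos i.isLt]

/-- coefficients -/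
def Lc (n : ℕ) (q : Matrix ι ι R) (i : ℕ) : Matrix ι ι R := if i = n then 1 - q else if i = n + 1 then q else 0
def LA (n : ℕ) (t : R) (q : Matrix ι ι R) (i : ℕ) : Matrix ι ι R :=
  if i ≤ n then 1 else if i = n + 1 then q + t • (1 - q) else t • 1
def LB (n : ℕ) (t : R) (q : Matrix ι ι R) (i : ℕ) : Matrix ι ι R :=
  if i ≤ n then t • 1 else if i = n + 1 then (1 - q) + t • q else 1
def Ld (n : ℕ) (q : Matrix ι ι R) (i : ℕ) : Matrix ι ι R :=
  if i = n + 1 then q else if i = 0 then 0 else if i ≤ n then 1 else 0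

theorem Lc_map (f : R →+* S) (n : ℕ) (q : Matrix ι ι R) (i : ℕ) : (Lc n q i).map f = Lc n (q.map f) i := by
  unfold Lc; split_ifs <;> ext a b <;> by_cases hab : a = b <;> simp [Matrix.one_apply, hab]
theorem LA_map (f : R →+* S) (n : ℕ) (t : R) (q : Matrix ι ι R) (i : ℕ) : (LA n t q i).map f = LA n (f t) (q.map f) i := by
  unfold LA; split_ifs <;> ext a b <;> by_cases hab : a = b <;> simp [Matrix.one_apply, hab]
theorem LB_map (f : R →+* S) (n : ℕ) (t : R) (q : Matrix ι ι R) (i : ℕ) : (LB n t q i).map f = LB n (f t) (q.map f) i := by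
  unfold LB; split_ifs <;> ext a b <;> by_cases hab : a = b <;> simp [Matrix.one_apply, hab]
theorem LA_one (n : ℕ) (q : Matrix ι ι R) : LA n 1 q = fun _ => 1 := by
  funext i; unfold LA; split_ifs <;> simp
theorem LB_one (n : ℕ) (q : Matrix ι ι R) : LB n 1 q = fun _ => 1 := by
  funext i; unfold LB; split_ifs <;> simp
theorem Ld_idem (n : ℕ) (q : Matrix ι ι R) (h : q * q = q) (i : ℕ) : Ld n q i * Ld n q i = Ld n q i := by
  unfold Ld; split_ifs <;> simp [h]

theorem bd_gA (M n : ℕ) (q : Matrix ι ι R) (h : q * q = q) : bd (M + 1) (Ld n q) * gA M (LA n 0 q) = gA M (LA n 0 q) := by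
  ext ⟨i, k⟩ ⟨j, l⟩
  rw [Matrix.mul_apply, Fintype.sum_prod_type, Finset.sum_eq_single i]
  · by_cases hij : i.val = j.val + 1
    · simp only [bd, gA, Matrix.of_apply, if_true, if_pos hij, mul_neg, Finset.sum_neg_distrib]
      rw [← Matrix.mul_apply]
      congr 2
      have : i.val ≠ 0 := by omega
      unfold Ld LA
      rw [if_neg this]
      split_ifs <;> simp_all
    · simp [gA, hij]
  · intro b _ hb
    simp [bd, Ne.symm hb]
  · simp

theorem bd_gB (M n : ℕ) (q : Matrix ι ι R) (h : q * q = q) : bd (M + 1) (Ld n q) * gB M (LB n 0 q) (Lc n q) = 0 := by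
  ext ⟨i, k⟩ ⟨j, l⟩
  rw [Matrix.mul_apply, Fintype.sum_prod_type, Finset.sum_eq_single i]
  · by_cases hi : i = 0
    · simp [bd, hi, Ld]
    · have hi' : i.val ≠ 0 := fun h => hi (Fin.ext h)
      by_cases hij : i = j
      · subst hij
        simp only [bd, gB, Matrix.of_apply, if_true, if_neg hi]
        rw [← Matrix.mul_apply]
        congr 2
        unfold Ld LB
        rw [if_neg hi']
        clear hi
        generalize i.val = m at hi' ⊢
        by_cases h1 : m = n + 1
        · simp [h1, Matrix.mul_sub, h]
        · by_cases h2 : m ≤ n <;> simp [h1, h2]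
      · simp [gB, hi, hij]
  · intro b _ hb
    simp [bd, Ne.symm hb]
  · simp
end gen

theorem L_ker {ι : Type} [Fintype ι] [DecidableEq ι] {M n : ℕ} (hn : n < M) (z t : ℂ) (hz : z ≠ 0) (q : Matrix ι ι ℂ) (hq : q * q = q) (v : Fin (M + 1) × ι → ℂ)
    (h : (z • gA M (LA n t q) + gB M (LB n t q) (Lc n q)) *ᵥ v = 0) : v = 0 := by
  obtain ⟨h1, h2⟩ := gpen_ker _ _ _ _ _ _ h
  have h3 : (1 - q) *ᵥ Vf v n + q *ᵥ Vf v (n + 1) = 0 := by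
    rw [← h2, Finset.sum_eq_add n (n + 1) (by omega)]
    · simp [Lc]
    · intro c _ hc
      simp [Lc, hc.1, hc.2]
    · intro h; simp at h; omega
    · intro h; simp at h; omega
  have h4 : q *ᵥ Vf v (n + 1) = 0 := by
    have := congrArg (fun x => q *ᵥ x) h3
    simpa [Matrix.mulVec_add, Matrix.mul_sub, hq] using this
  have h5 : (1 - q) *ᵥ Vf v n = 0 := by rw [h4, add_zero] at h3; exact h3
  have h5' : q *ᵥ Vf v n = Vf v n := by
    rw [Matrix.sub_mulVec, Matrix.one_mulVec, sub_eq_zero] at h5; exact h5.symm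
  have h6 : Vf v (n + 1) = z • Vf v n := by
    have := h1 n hn
    simp only [LB, LA, show ¬ (n + 1 ≤ n) by omega, if_false, if_true] at this
    rw [Matrix.add_mulVec, Matrix.add_mulVec, Matrix.smul_mulVec, Matrix.smul_mulVec, h4, h5, h5', Matrix.sub_mulVec, h4, Matrix.one_mulVec] at this
    simpa using this
  have h7 : Vf v n = 0 := by
    rw [h6, Matrix.mulVec_smul, h5'] at h4
    exact (smul_eq_zero.1 h4).resolve_left hz
  have h8 : Vf v (n + 1) = 0 := by rw [h6, h7, smul_zero]
  have h9 : ∀ j ≤ n, Vf v (n - j) = 0 := by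
    intro j
    induction j with
    | zero => intro _; exact h7
    | succ j ih =>
      intro hj
      have := h1 (n - (j + 1)) (by omega)
      rw [show n - (j + 1) + 1 = n - j by omega, ih (by omega)] at this
      simp only [LA, show n - j ≤ n by omega, if_true, Matrix.mulVec_zero, Matrix.one_mulVec] at this
      exact (smul_eq_zero.1 this.symm).resolve_left hz
  have h10 : ∀ j, n + 1 + j ≤ M → Vf v (n + 1 + j) = 0 := by
    intro j
    induction j with
    | zero => intro _; exact h8
    | succ j ih =>
      intro hj
      have := h1 (n + 1 + j) (by omega)
      rw [← add_assoc]
      rw [ih (by omega)] at this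
      simpa [LB, show ¬ (n + 1 + j + 1 ≤ n) by omega, show ¬ (n + 1 + j = n) by omega] using this
  ext ⟨⟨i, hi⟩, k⟩
  have : Vf v i = 0 := by
    by_cases hin : i ≤ n
    · have := h9 (n - i) (by omega)
      rwa [show n - (n - i) = i by omega] at this
    · have := h10 (i - (n + 1)) (by omega)
      rwa [show n + 1 + (i - (n + 1)) = i by omega] at this
  have := congrFun this k
  simpa [Vf, hi] using this

end BK

namespace BK
open Matrix Kronecker Topology

variable {Y Y' : Type} [TopologicalSpace Y] [CompactSpace Y] [T2Space Y] [TopologicalSpace Y'] [CompactSpace Y'] [T2Space Y']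
variable {ι κ : Type} [Fintype ι] [DecidableEq ι] [Fintype κ] [DecidableEq κ]

theorem pen_map (g : C(Y', Y)) (a b : Matrix ι ι (RA Y)) : pen (a.map (pb g)) (b.map (pb g)) = (pen a b).map (pb (gL g)) := by
  refine mat_ext ?_
  rintro ⟨y, z⟩
  have : ((pen a b).map (pb (gL g))).map (ev (y, z)) = (pen a b).map (ev (g y, z)) := rfl
  rw [this, pen_ev, pen_ev]; rfl

/-- index class of an invertible pencil -/
noncomputable def penB {a b : Matrix ι ι (RA Y)} (h : IsUnit (pen a b)) : K (RA Y) :=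
  cls ⟨ι, penQ a h.unit, penQ_idem rfl⟩

theorem cls_congr {R : Type} [CommRing R] {e e' : Matrix ι ι R} (h : e = e') (he he') :
    cls (⟨ι, e, he⟩ : Pj R) = cls (⟨ι, e', he'⟩ : Pj R) := by subst h; rfl

theorem penB_map (g : C(Y', Y)) {a b : Matrix ι ι (RA Y)} (h : IsUnit (pen a b)) {a' b' : Matrix ι ι (RA Y')} (h' : IsUnit (pen a' b'))
    (ha : a.map (pb g) = a') (hb : b.map (pb g) = b') : K.map (pb g) (penB h) = penB h' := by
  subst ha hb
  rw [penB, K.map_cls, penB]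
  refine cls_congr ?_ _ _
  rw [← penQ_map]
  congr 1
  apply Units.ext
  exact (pen_map g a b).symm

theorem penB_path {a b : Matrix ι ι (RA (I01 × Y))} (h : IsUnit (pen a b)) {a0 b0 a1 b1 : Matrix ι ι (RA Y)}
    (h0 : IsUnit (pen a0 b0)) (h1 : IsUnit (pen a1 b1)) (ha0 : a.map (pb (atT Y 0)) = a0) (hb0 : b.map (pb (atT Y 0)) = b0)
    (ha1 : a.map (pb (atT Y 1)) = a1) (hb1 : b.map (pb (atT Y 1)) = b1) : penB h0 = penB h1 := by
  rw [← penB_map _ h h0 ha0 hb0, ← penB_map _ h h1 ha1 hb1, kmap_homotopy _ 0 1]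

theorem penQ_eq {a b D : Matrix ι ι (RA Y)} {u : (Matrix ι ι (RL Y))ˣ} (hu : (u : Matrix ι ι (RL Y)) = pen a b)
    (hD : D * a = a) (hb : D * b = 0) : penQ a u = D := by
  have e1 : pen a 0 = pen 0 D * (u : Matrix ι ι (RL Y)) := by
    refine mat_ext ?_
    rintro ⟨y, z⟩
    rw [Matrix.map_mul, hu, pen_ev, pen_ev, pen_ev]
    have hb' : D.map (ev y) * b.map (ev y) = 0 := by rw [← Matrix.map_mul, hb]; ext; rfl
    have hD' : D.map (ev y) * a.map (ev y) = a.map (ev y) := by rw [← Matrix.map_mul, hD]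
    have h0 : (0 : Matrix ι ι (RA Y)).map (ev y) = 0 := by ext; rfl
    rw [h0, smul_zero, zero_add, add_zero, Matrix.mul_add, hb', add_zero, Matrix.mul_smul, hD']
  have e2 := mavg_pen_mul 0 a 0 ((u⁻¹ : (Matrix ι ι (RL Y))ˣ) : Matrix ι ι (RL Y))
  rw [e1, Matrix.mul_assoc, u.mul_inv, mavg_pen_mul, mavg_one, mavg_one] at e2
  simpa [penQ] using e2.symm

theorem comp_map (g : C(Y', Y)) (M : ℕ) (p : ℕ → Matrix ι ι (RA Y)) :
    (compM M 0 (p 0) p).map (pb g) = compM M 0 ((p 0).map (pb g)) (fun l => (p l).map (pb g)) := by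
  rw [compM_map, map_zero]

noncomputable def BB {M : ℕ} {p : ℕ → Matrix ι ι (RA Y)} (h : IsUnit (Pz M p)) : K (RA Y) := penB (comp_unit h)

theorem BB_path {M : ℕ} {p : ℕ → Matrix ι ι (RA (I01 × Y))} {p0 p1 : ℕ → Matrix ι ι (RA Y)} (h : IsUnit (Pz M p))
    (h0 : IsUnit (Pz M p0)) (h1 : IsUnit (Pz M p1)) (e0 : ∀ l, (p l).map (pb (atT Y 0)) = p0 l)
    (e1 : ∀ l, (p l).map (pb (atT Y 1)) = p1 l) : BB h0 = BB h1 := by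
  obtain rfl : (fun l => (p l).map (pb (atT Y 0))) = p0 := funext e0
  obtain rfl : (fun l => (p l).map (pb (atT Y 1))) = p1 := funext e1
  exact penB_path (comp_unit h) _ _ (compA_map _ _) (comp_map _ _ _) (compA_map _ _) (comp_map _ _ _)

noncomputable def tq (Y : Type) [TopologicalSpace Y] : RA (I01 × Y) := ⟨fun x => ((x.1 : ℝ) : ℂ), by fun_prop⟩

theorem Lc_Pz {M n : ℕ} (hn : n < M) (q : Matrix ι ι (RA Y)) (h : q * q = q) :
    Pz M (Lc n q) = ((zS n * Lq q h : (Matrix ι ι (RL Y))ˣ) : Matrix ι ι (RL Y)) := by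
  refine mat_ext ?_
  rintro ⟨y, z⟩
  rw [zS_ev, Lq_ev]
  ext i j
  simp only [Matrix.map_apply, ev_apply, Pz, Matrix.of_apply, ContinuousMap.sum_apply, ContinuousMap.mul_apply, pb_apply]
  rw [Finset.sum_eq_add n (n + 1) (by omega)]
  · simp only [Lc, if_true, show n + 1 ≠ n by omega, if_false, zp_ap, Matrix.smul_apply, Matrix.add_apply, Matrix.sub_apply, smul_eq_mul, Matrix.map_apply, ev_apply,
      ContinuousMap.sub_apply]
    have : ((1 : Matrix ι ι (RA Y)) i j) y = (1 : Matrix ι ι ℂ) i j := by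
      by_cases hij : i = j <;> simp [Matrix.one_apply, hij]
    change _ * (((1 : Matrix ι ι (RA Y)) i j) y - q i j y) + _ * q i j y = _
    rw [this]
    simp only [zpow_natCast, pow_succ, Circle.coe_mul]
    ring
  · intro c _ hc
    simp [Lc, hc.1, hc.2]
  · intro h; simp at h; omega
  · intro h; simp at h; omega

theorem L_unit {M n : ℕ} (hn : n < M) (f : RA Y) (q : Matrix ι ι (RA Y)) (h : q * q = q) :
    IsUnit (pen (gA M (LA n f q)) (gB M (LB n f q) (Lc n q))) := by
  refine isUnit_of_ker ?_
  rintro ⟨y, z⟩ v hv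
  rw [pen_ev, gA_map, gB_map] at hv
  simp only [LA_map, LB_map, Lc_map] at hv
  exact L_ker hn z (f y) (by simp) (q.map (ev y)) (by rw [← Matrix.map_mul, h]) v hv

theorem BB_L {M n : ℕ} (hn : n < M) (q : Matrix ι ι (RA Y)) (h : q * q = q) (hu : IsUnit (Pz M (Lc n q))) :
    BB hu = ∑ i ∈ Finset.range (M + 1), cls (⟨ι, Ld n q i, Ld_idem n q h i⟩ : Pj (RA Y)) := by
  rw [← cls_bd]
  have h0 := L_unit hn (0 : RA Y) q h
  let pq : C(I01 × Y, Y) := ⟨fun x => x.2, by fun_prop⟩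
  have hq' : ∀ t, (q.map (pb pq)).map (pb (atT Y t)) = q := fun t => by ext i j x; rfl
  have t0 : pb (atT Y 0) (tq Y) = 0 := by ext x; simp [tq, pb_apply]
  have t1 : pb (atT Y 1) (tq Y) = 1 := by ext x; simp [tq, pb_apply]
  have := penB_path (L_unit hn (tq Y) (q.map (pb pq)) (by rw [← Matrix.map_mul, h])) h0 (comp_unit hu) 
    (by rw [gA_map]; simp only [LA_map, hq', t0])
    (by rw [gB_map]; simp only [LB_map, Lc_map, hq', t0])
    (by rw [gA_map]; simp only [LA_map, hq', t1]; rw [← gA_one]; congr 1; rw [← LA_one n q])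
    (by rw [gB_map]; simp only [LB_map, Lc_map, hq', t1]; rw [← gB_one]; congr 1; rw [← LB_one n q])
  rw [BB, ← this, penB]
  exact cls_congr (penQ_eq rfl (bd_gA M n q h) (bd_gB M n q h)) _ _

theorem BB_near {M n : ℕ} (hn : n < M) (q : Matrix ι ι (RA Y)) (h : q * q = q) {p : ℕ → Matrix ι ι (RA Y)} (hp : IsUnit (Pz M p))
    (hs : ∀ (t : ℝ), 0 ≤ t → t ≤ 1 → ∀ x, IsUnit (((zS n * Lq q h : (Matrix ι ι (RL Y))ˣ) : Matrix ι ι (RL Y)).map (ev x) + (t : ℂ) • ((Pz M p).map (ev x) - ((zS n * Lq q h : (Matrix ι ι (RL Y))ˣ) : Matrix ι ι (RL Y)).map (ev x)))) :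
    BB hp = ∑ i ∈ Finset.range (M + 1), cls (⟨ι, Ld n q i, Ld_idem n q h i⟩ : Pj (RA Y)) := by
  have hu : IsUnit (Pz M (Lc n q)) := by rw [Lc_Pz hn q h]; exact Units.isUnit _
  rw [← BB_L hn q h hu]
  let pp : ℕ → Matrix ι ι (RA (I01 × Y)) := fun l => Matrix.of fun i j =>
    ⟨fun x => Lc n q l i j x.2 + ((x.1 : ℝ) : ℂ) * (p l i j x.2 - Lc n q l i j x.2), by fun_prop⟩
  have hpp : IsUnit (Pz M pp) := by
    rw [isUnit_mat_iff']
    rintro ⟨⟨t, y⟩, z⟩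
    convert hs t t.2.1 t.2.2 (y, z) using 1
    rw [← Lc_Pz hn q h]
    ext i j
    simp only [Matrix.map_apply, ev_apply, Pz, pp, Matrix.of_apply, ContinuousMap.sum_apply, ContinuousMap.mul_apply, pb_apply,
      Matrix.add_apply, Matrix.smul_apply, Matrix.sub_apply, smul_eq_mul, zp_ap, ContinuousMap.coe_mk]
    rw [← Finset.sum_sub_distrib, Finset.mul_sum, ← Finset.sum_add_distrib]
    refine Finset.sum_congr rfl fun l _ => by ring
  refine (BB_path hpp hu hp ?_ ?_).symm
  · intro l; ext i j x; simp [pp, pb_apply]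
  · intro l; ext i j x; simp [pp, pb_apply]

theorem L_homotopy (u : (Matrix ι ι (RL (I01 × Y)))ˣ) (q q' : Matrix ι ι (RA Y)) (h : q * q = q) (h' : q' * q' = q')
    (h0 : umap (pb (gL (atT Y 0))) u = Lq q h) (h1 : umap (pb (gL (atT Y 1))) u = Lq q' h') :
    cls (⟨ι, q, h⟩ : Pj (RA Y)) = cls (⟨ι, q', h'⟩ : Pj (RA Y)) := by
  obtain ⟨n, M, p, hn, hp⟩ := poly_approx u
  have key : ∀ (t : I01) (q : Matrix ι ι (RA Y)) (h : q * q = q) (h0 : umap (pb (gL (atT Y t))) u = Lq q h),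
      ∀ (s : ℝ), 0 ≤ s → s ≤ 1 → ∀ x, IsUnit (((zS n * Lq q h : (Matrix ι ι (RL Y))ˣ) : Matrix ι ι (RL Y)).map (ev x) + (s : ℂ) • ((Pz M (fun l => (p l).map (pb (atT Y t)))).map (ev x) - ((zS n * Lq q h : (Matrix ι ι (RL Y))ˣ) : Matrix ι ι (RL Y)).map (ev x))) := by
    rintro t q h h0 s hs0 hs1 ⟨y, z⟩
    have := hp s hs0 hs1 ((t, y), z)
    rw [zS_ev] at this ⊢
    rw [← h0]
    have e : (Pz M (fun l => (p l).map (pb (atT Y t)))).map (ev (y, z)) = (Pz M p).map (ev ((t, y), z)) := by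
      ext i j
      simp only [Matrix.map_apply, ev_apply, Pz, Matrix.of_apply, ContinuousMap.sum_apply, ContinuousMap.mul_apply, pb_apply, zp_ap]
      rfl
    rw [e]; exact this
  have hu : IsUnit (Pz M p) := by
    rw [isUnit_mat_iff']
    intro x
    have := hp 1 zero_le_one le_rfl x
    simpa using this
  have hut : ∀ (t : I01) (q : Matrix ι ι (RA Y)) (h : q * q = q) (h0 : umap (pb (gL (atT Y t))) u = Lq q h), IsUnit (Pz M (fun l => (p l).map (pb (atT Y t)))) := by
    intro t q h h0
    rw [isUnit_mat_iff']
    intro x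
    have := key t q h h0 1 zero_le_one le_rfl x
    simpa using this
  have e0 := BB_near hn q h (hut 0 q h h0) (key 0 q h h0)
  have e1 := BB_near hn q' h' (hut 1 q' h' h1) (key 1 q' h' h1)
  rw [BB_path hu (hut 0 q h h0) (hut 1 q' h' h1) (fun _ => rfl) (fun _ => rfl), e1] at e0
  have hm : n + 1 ∈ Finset.range (M + 1) := by simp; omega
  rw [← Finset.add_sum_erase _ _ hm, ← Finset.add_sum_erase _ _ hm] at e0
  have e2 : ∑ x ∈ (Finset.range (M + 1)).erase (n + 1), cls (⟨ι, Ld n q x, Ld_idem n q h x⟩ : Pj (RA Y)) = ∑ x ∈ (Finset.range (M + 1)).erase (n + 1), cls (⟨ι, Ld n q' x, Ld_idem n q' h' x⟩ : Pj (RA Y)) := by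
    refine Finset.sum_congr rfl fun i hi => cls_congr ?_ _ _
    have : i ≠ n + 1 := by simp at hi; exact hi.1
    simp [Ld, this]
  rw [e2, add_left_inj] at e0
  have e3 : ∀ (q : Matrix ι ι (RA Y)) (h : q * q = q), cls (⟨ι, Ld n q (n + 1), Ld_idem n q h (n + 1)⟩ : Pj (RA Y)) = cls (⟨ι, q, h⟩ : Pj (RA Y)) := by
    intro q h; exact cls_congr (by simp [Ld]) _ _
  rw [e3, e3] at e0
  exact e0.symm

end BK

namespace BK
open Matrix Kronecker Topology

variable {Y Y' : Type} [TopologicalSpace Y] [CompactSpace Y] [T2Space Y] [TopologicalSpace Y'] [CompactSpace Y'] [T2Space Y']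
variable {ι κ : Type} [Fintype ι] [DecidableEq ι] [Fintype κ] [DecidableEq κ]

theorem frame_mul {R : Type} [CommRing R] {a b : Type} [Fintype a] [Fintype b] [DecidableEq a] [DecidableEq b]
    {x : Matrix a b R} {y : Matrix b a R} {X : Matrix a ι R} {Z : Matrix ι a R} {X' : Matrix b ι R} {Z' : Matrix ι b R}
    (h1 : Z * X = 1) (h1' : Z' * X' = 1) (hxy : x * y = X * Z) (hyx : y * x = X' * Z') : (Z' * y * X) * (Z * x * X') = 1 := by
  have : (Z' * y * X) * (Z * x * X') = Z' * ((y * (X * Z)) * (x * X')) := by simp only [Matrix.mul_assoc]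
  rw [this, ← hxy]
  have : Z' * (y * (x * y) * (x * X')) = Z' * ((y * x) * ((y * x) * X')) := by simp only [Matrix.mul_assoc]
  rw [this, hyx]
  have : Z' * (X' * Z' * (X' * Z' * X')) = (Z' * X') * ((Z' * X') * (Z' * X')) := by simp only [Matrix.mul_assoc]
  rw [this, h1']; simp

theorem key11 {R : Type} [CommRing R] (A : Matrix (ι ⊕ ι) (ι ⊕ ι) R) :
    fromCols (1 : Matrix ι ι R) (0 : Matrix ι ι R) * A * fromRows (1 : Matrix ι ι R) (0 : Matrix ι ι R) = A.toBlocks₁₁ := by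
  conv_lhs => rw [← fromBlocks_toBlocks A]
  rw [fromCols_mul_fromBlocks, fromCols_mul_fromRows]; simp

theorem key22 {R : Type} [CommRing R] (A : Matrix (ι ⊕ ι) (ι ⊕ ι) R) (B C : Matrix ι ι R) :
    fromCols (0 : Matrix ι ι R) B * A * fromRows (0 : Matrix ι ι R) C = B * A.toBlocks₂₂ * C := by
  conv_lhs => rw [← fromBlocks_toBlocks A]
  rw [fromCols_mul_fromBlocks, fromCols_mul_fromRows]; simp

theorem cl_clutch (α α' : (Matrix ι ι (RL Y))ˣ) (h : Eqv (cl α) (cl α')) (h1 : umap (pb (mk1 Y)) α = 1) (h1' : umap (pb (mk1 Y)) α' = 1) :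
    ∃ (g : (Matrix ι ι (RA Y))ˣ) (u : (Matrix ι ι (RL (I01 × Y)))ˣ),
      umap (pb (gL (atT Y 1))) u = α ∧ umap (pb (gL (atT Y 0))) u = umap (pb (mpl Y)) g⁻¹ * α' * umap (pb (mpl Y)) g := by
  obtain ⟨x, y, hxy, hyx⟩ := h
  change x * y = clE α at hxy
  change y * x = clE α' at hyx
  change Matrix (ι ⊕ ι) (ι ⊕ ι) (RS Y) at x
  change Matrix (ι ⊕ ι) (ι ⊕ ι) (RS Y) at y
  have hxy' : x.map (pb (mpol Y)) * y.map (pb (mpol Y)) = clX α * clZ α := by rw [← Matrix.map_mul, hxy, cl_e]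
  have hyx' : y.map (pb (mpol Y)) * x.map (pb (mpol Y)) = clX α' * clZ α' := by rw [← Matrix.map_mul, hyx, cl_e]
  obtain ⟨φ, hφ⟩ : ∃ φ : (Matrix ι ι (RW Y))ˣ, (φ : Matrix ι ι (RW Y)) = clZ α' * y.map (pb (mpol Y)) * clX α :=
    ⟨⟨_, _, frame_mul (clZX α) (clZX α') hxy' hyx', frame_mul (clZX α') (clZX α) hyx' hxy'⟩, rfl⟩
  have e0 : (φ : Matrix ι ι (RW Y)).map (pb (mat0 Y 0)) = (y.map (pb (mN Y))).toBlocks₁₁.map (pb (mpl Y)) := by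
    rw [hφ, Matrix.map_mul, Matrix.map_mul, clZ_0, clX_0, mpol_0, key11]; rfl
  have e1 : (φ : Matrix ι ι (RW Y)).map (pb (mat0 Y 1)) = ((α'⁻¹ : (Matrix ι ι (RL Y))ˣ) : Matrix ι ι (RL Y)) * (y.map (pb (mS Y))).toBlocks₂₂.map (pb (mpl Y)) * α := by
    rw [hφ, Matrix.map_mul, Matrix.map_mul, clZ_1, clX_1, mpol_1, key22]; rfl
  obtain ⟨g, hg⟩ : ∃ g, g = umap (pb (mk1 Y)) (umap (pb (mat0 Y 1)) φ) := ⟨_, rfl⟩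
  have hg' : (g : Matrix ι ι (RA Y)) = (y.map (pb (mS Y))).toBlocks₂₂ := by
    rw [hg, umap_val, umap_val, e1, Matrix.map_mul, Matrix.map_mul, mk_pl, ← umap_val, ← umap_val, map_inv, h1, h1']
    simp
  have e1u : umap (pb (mat0 Y 1)) φ = α'⁻¹ * umap (pb (mpl Y)) g * α := by
    apply Units.ext
    rw [umap_val, e1, Units.val_mul, Units.val_mul, umap_val, hg']
  let m1 : C((I01 × Y) × Circle, Y × (I01 × Circle)) := ⟨fun p => (p.1.2, (p.1.1, p.2)), by fun_prop⟩
  let m2 : C((I01 × Y) × Circle, Y × (I01 × Circle)) := ⟨fun p => (p.1.2, (p.1.1, 1)), by fun_prop⟩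
  let m3 : C((I01 × Y) × Circle, Y × Circle) := ⟨fun p => (p.1.2, p.2), by fun_prop⟩
  let m4 : C((I01 × Y) × Circle, Y) := ⟨fun p => p.1.2, by fun_prop⟩
  refine ⟨g, umap (pb m4) g⁻¹ * umap (pb m3) α' * (umap (pb m1) φ * (umap (pb m2) φ)⁻¹) * umap (pb m4) g, ?_, ?_⟩
  · have a1 : umap (pb (gL (atT Y 1))) (umap (pb m1) φ) = umap (pb (mat0 Y 1)) φ := rfl
    have a2 : umap (pb (gL (atT Y 1))) (umap (pb m2) φ) = umap (pb (mpl Y)) g := by rw [hg]; rfl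
    have a3 : umap (pb (gL (atT Y 1))) (umap (pb m3) α') = α' := rfl
    have a4 : ∀ g : (Matrix ι ι (RA Y))ˣ, umap (pb (gL (atT Y 1))) (umap (pb m4) g) = umap (pb (mpl Y)) g := fun g => rfl
    simp only [_root_.map_mul, map_inv, a1, a2, a3, a4, e1u]
    group
  · have a1 : umap (pb (gL (atT Y 0))) (umap (pb m1) φ) = umap (pb (mat0 Y 0)) φ := rfl
    have a2 : umap (pb (gL (atT Y 0))) (umap (pb m2) φ) = umap (pb (mat0 Y 0)) φ := by
      have : umap (pb (gL (atT Y 0))) (umap (pb m2) φ) = umap (pb (mpl Y)) (umap (pb (mk1 Y)) (umap (pb (mat0 Y 0)) φ)) := rfl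
      rw [this]
      apply Units.ext
      rw [umap_val, umap_val, umap_val, e0, mk_pl]
    have a3 : umap (pb (gL (atT Y 0))) (umap (pb m3) α') = α' := rfl
    have a4 : ∀ g : (Matrix ι ι (RA Y))ˣ, umap (pb (gL (atT Y 0))) (umap (pb m4) g) = umap (pb (mpl Y)) g := fun g => rfl
    simp only [_root_.map_mul, map_inv, a1, a2, a3, a4]
    group

theorem Lq_k1 (q : Matrix ι ι (RA Y)) (h : q * q = q) : umap (pb (mk1 Y)) (Lq q h) = 1 := by
  apply Units.ext
  refine mat_ext ?_
  intro y
  have : (umap (pb (mk1 Y)) (Lq q h) : Matrix ι ι (RA Y)).map (ev y) = (Lq q h : Matrix ι ι (RL Y)).map (ev (y, 1)) := rfl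
  rw [this, Lq_ev, Units.val_one, map_one']
  simp

theorem L_inj (q q' : Matrix ι ι (RA Y)) (h : q * q = q) (h' : q' * q' = q') (H : Eqv (cl (Lq q h)) (cl (Lq q' h'))) :
    cls (⟨ι, q, h⟩ : Pj (RA Y)) = cls (⟨ι, q', h'⟩ : Pj (RA Y)) := by
  obtain ⟨g, u, h1, h0⟩ := cl_clutch _ _ H (Lq_k1 q h) (Lq_k1 q' h')
  have hgq : ((g⁻¹ : (Matrix ι ι (RA Y))ˣ) : Matrix ι ι (RA Y)) * q' * g * (((g⁻¹ : (Matrix ι ι (RA Y))ˣ) : Matrix ι ι (RA Y)) * q' * g) = ((g⁻¹ : (Matrix ι ι (RA Y))ˣ) : Matrix ι ι (RA Y)) * q' * g := by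
    simp only [mul_assoc, Units.mul_inv_cancel_left]
    rw [← mul_assoc q', h']
  have e : umap (pb (mpl Y)) g⁻¹ * Lq q' h' * umap (pb (mpl Y)) g = Lq _ hgq := by
    apply Units.ext
    refine mat_ext ?_
    rintro ⟨y, z⟩
    rw [Lq_ev, Units.val_mul, Units.val_mul, Matrix.map_mul, Matrix.map_mul, Lq_ev, umap_val, umap_val, Matrix.map_mul, Matrix.map_mul]
    have k : ∀ A : Matrix ι ι (RA Y), (A.map (pb (mpl Y))).map (ev (y, z)) = A.map (ev y) := fun A => rfl
    rw [k, k]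
    have kk : ((g⁻¹ : (Matrix ι ι (RA Y))ˣ) : Matrix ι ι (RA Y)).map (ev y) * (g : Matrix ι ι (RA Y)).map (ev y) = 1 := by
      rw [← Matrix.map_mul, Units.inv_mul, map_one']
    simp only [Matrix.mul_add, Matrix.add_mul, Matrix.mul_sub, Matrix.sub_mul, Matrix.mul_one, kk, Matrix.mul_smul, Matrix.smul_mul]
  rw [e] at h0
  rw [← L_homotopy u _ q hgq h h0 h1]
  refine cls_eq_of ⟨((g⁻¹ : (Matrix ι ι (RA Y))ˣ) : Matrix ι ι (RA Y)) * q', q' * g, ?_, ?_⟩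
  · show _ = ((g⁻¹ : (Matrix ι ι (RA Y))ˣ) : Matrix ι ι (RA Y)) * q' * g
    rw [Matrix.mul_assoc, ← Matrix.mul_assoc q', h', Matrix.mul_assoc]
  · show _ = q'
    rw [Matrix.mul_assoc, ← Matrix.mul_assoc _ _ q', Units.mul_inv, Matrix.one_mul, h']

end BK

namespace BK
open Matrix Kronecker Topology

variable {Y Y' : Type} [TopologicalSpace Y] [CompactSpace Y] [T2Space Y] [TopologicalSpace Y'] [CompactSpace Y'] [T2Space Y']
variable {ι κ : Type} [Fintype ι] [DecidableEq ι] [Fintype κ] [DecidableEq κ]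

theorem eqv_udiag (α : (Matrix ι ι (RL Y))ˣ) (β : (Matrix κ κ (RL Y))ˣ) : Eqv (cl (udiag α β)) ((cl α).add (cl β)) := by
  refine (Eqv.of_equiv (Equiv.sumSumSumComm ι κ ι κ) ?_)
  have : (fromBlocks (clE α) 0 0 (clE β)).submatrix (Equiv.sumSumSumComm ι κ ι κ) (Equiv.sumSumSumComm ι κ ι κ) = (clE (udiag α β)) := by
    refine mat_ext_pol (Y := Y) (ι := (ι ⊕ κ) ⊕ (ι ⊕ κ)) (κ := (ι ⊕ κ) ⊕ (ι ⊕ κ)) ?_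
    intro y s z
    rw [cl_ev, ← submatrix_map, fromBlocks_map, cl_ev, cl_ev]
    ext i j
    rcases i with (i | i) | (i | i) <;> rcases j with (j | j) | (j | j) <;> simp [udiag, Matrix.one_apply] <;> try rfl
  intro i j
  exact congrFun (congrFun this i) j

theorem eqv_one : Eqv (cl (1 : (Matrix ι ι (RL Y))ˣ)) (Pj.triv (RS Y) ι) := by
  have hf : Fr (Pj.triv (RS Y) ι) (1 : Matrix ι ι (RW Y)) 1 := ⟨by simp, by simp⟩
  refine (Fr.cmp (cl_fr _) hf ?_ ?_)
  · refine good_of (fromRows 1 0) (fromRows 0 (1 : Matrix ι ι (RA Y))) ?_ ?_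
    · rw [Matrix.mul_one, clX_0]; ext (i | i) j : 2 <;> simp [Matrix.one_apply]
    · rw [Matrix.mul_one, clX_1]; ext (i | i) j : 2 <;> simp [Matrix.one_apply]
  · refine good_of (fromCols 1 0) (fromCols 0 (1 : Matrix ι ι (RA Y))) ?_ ?_
    · rw [Matrix.one_mul, clZ_0]; ext i (j | j) : 2 <;> simp [Matrix.one_apply]
    · rw [Matrix.one_mul, clZ_1]; ext i (j | j) : 2 <;> simp [Matrix.one_apply]

theorem blk_idem {R : Type} [CommRing R] {q : Matrix ι ι R} (h : q * q = q) :
    (fromBlocks q 0 0 0 : Matrix (ι ⊕ κ) (ι ⊕ κ) R) * fromBlocks q 0 0 0 = fromBlocks q 0 0 0 := by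
  simp [fromBlocks_multiply, h]

theorem Lq_blk (q : Matrix ι ι (RA Y)) (h : q * q = q) : Lq (fromBlocks q 0 0 0 : Matrix (ι ⊕ κ) (ι ⊕ κ) (RA Y)) (blk_idem h) = udiag (Lq q h) 1 := by
  apply Units.ext
  refine mat_ext ?_
  rintro ⟨y, z⟩
  have : (udiag (Lq q h) (1 : (Matrix κ κ (RL Y))ˣ) : Matrix (ι ⊕ κ) (ι ⊕ κ) (RL Y)).map (ev (y, z)) =
    fromBlocks ((Lq q h : Matrix ι ι (RL Y)).map (ev (y, z))) 0 0 1 := by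
    show (fromBlocks _ 0 0 _).map _ = _
    rw [fromBlocks_map, Units.val_one, map_one']
    simp
  rw [this, Lq_ev, Lq_ev]
  ext (i | i) (j | j) <;> simp [Matrix.one_apply]

theorem kap_L' (q : Matrix ι ι (RA Y)) (h : q * q = q) : kap (Lq q h) =
    K.map (pb (mpr Y)) (cls ⟨ι, q, h⟩) * (Hh Y - 1) + (Fintype.card ι : K (RS Y)) := by
  have e : cls (⟨ι, q, h⟩ : Pj (RA Y)) + cls (⟨ι, 1 - q, compl_idem h⟩ : Pj (RA Y)) = (Fintype.card ι : K (RA Y)) := by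
    rw [← cls_triv]; exact cls_compl ⟨ι, q, h⟩
  have e2 := congrArg (K.map (pb (mpr Y))) e
  rw [map_add, map_natCast] at e2
  rw [kap_L]
  linear_combination e2

theorem L_inj' (q q' : Matrix ι ι (RA Y)) (h : q * q = q) (h' : q' * q' = q') (H : kap (Lq q h) = kap (Lq q' h')) :
    cls (⟨ι, q, h⟩ : Pj (RA Y)) = cls (⟨ι, q', h'⟩ : Pj (RA Y)) := by
  obtain ⟨n, hn⟩ := cls_eq_iff.1 H
  have k : ∀ (q : Matrix ι ι (RA Y)) (h : q * q = q), Eqv (cl (Lq (fromBlocks q 0 0 0 : Matrix (ι ⊕ Fin n) (ι ⊕ Fin n) (RA Y)) (blk_idem h))) ((cl (Lq q h)).add (Pj.triv (RS Y) (Fin n))) := by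
    intro q h
    rw [Lq_blk q h]
    exact (eqv_udiag _ _).trans (Eqv.add (Eqv.refl _) eqv_one)
  have := L_inj _ _ _ _ ((k q h).trans (hn.trans (k q' h').symm))
  rw [cls_eq_of (eqv_left ⟨ι, q, h⟩ (Fin n) (blk_idem h)), cls_eq_of (eqv_left ⟨ι, q', h'⟩ (Fin n) (blk_idem h'))]
  exact this

theorem pr_H_inj (b : K (RA Y)) (h : K.map (pb (mpr Y)) b * (Hh Y - 1) = 0) : b = 0 := by
  obtain ⟨p, q, rfl⟩ := K.exists_sub b
  let P : Pj (RA Y) := p.add q.compl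
  let Q : Pj (RA Y) := (⟨p.ι, 0, by simp⟩ : Pj (RA Y)).add (Pj.triv (RA Y) q.ι)
  have hP : cls P = cls p + (cls (Pj.triv (RA Y) q.ι) - cls q) := by
    rw [cls_add, ← cls_compl q]; ring
  have hQ : cls Q = cls (Pj.triv (RA Y) q.ι) := by
    rw [cls_add, cls_zero]; ring
  have e : cls p - cls q = cls P - cls Q := by rw [hP, hQ]; ring
  rw [e, sub_eq_zero]
  rw [e, map_sub] at h
  refine L_inj' (ι := p.ι ⊕ q.ι) P.e Q.e P.idem Q.idem ?_
  rw [kap_L', kap_L']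
  linear_combination h

theorem TT_inj {a b : K (RA Y)} (h : K.map (pb (mpr Y)) a + K.map (pb (mpr Y)) b * Hh Y = 0) : b = 0 := by
  have h2 := congrArg (K.map (pb (mN Y))) h
  rw [map_add, _root_.map_mul, pr_N, pr_N, Hh_N, map_zero] at h2
  have ha : a = -b := by linear_combination h2
  rw [ha, map_neg] at h
  exact pr_H_inj b (by linear_combination h)

noncomputable def be (ξ : K (RS Y)) : K (RA Y) := (TT_surj ξ).choose_spec.choose

theorem be_eq (a b : K (RA Y)) : be (K.map (pb (mpr Y)) a + K.map (pb (mpr Y)) b * Hh Y) = b := by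
  have h := (TT_surj (K.map (pb (mpr Y)) a + K.map (pb (mpr Y)) b * Hh Y)).choose_spec.choose_spec
  have := TT_inj (a := a - (TT_surj (K.map (pb (mpr Y)) a + K.map (pb (mpr Y)) b * Hh Y)).choose)
    (b := b - be (K.map (pb (mpr Y)) a + K.map (pb (mpr Y)) b * Hh Y)) (by
      rw [map_sub, map_sub]
      unfold be
      linear_combination h)
  exact (sub_eq_zero.1 this).symm

theorem be_add (ξ η : K (RS Y)) : be (ξ + η) = be ξ + be η := by
  obtain ⟨a, b, rfl⟩ := TT_surj ξ
  obtain ⟨c, d, rfl⟩ := TT_surj η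
  rw [be_eq, be_eq, ← be_eq (a + c) (b + d), map_add, map_add]
  congr 1; ring

theorem be_pr (a : K (RA Y)) : be (K.map (pb (mpr Y)) a) = 0 := by
  rw [← be_eq a 0, map_zero]; simp

theorem be_Hh : be (Hh Y) = 1 := by
  rw [← be_eq 0 1, map_zero, map_one]; simp

theorem be_zero : be (0 : K (RS Y)) = 0 := by
  rw [← map_zero (K.map (pb (mpr Y))), be_pr]

theorem be_mul (ξ η : K (RS Y)) : be (ξ * η) = K.map (pb (mN Y)) ξ * be η + be ξ * K.map (pb (mN Y)) η := by
  obtain ⟨a, b, rfl⟩ := TT_surj ξ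
  obtain ⟨c, d, rfl⟩ := TT_surj η
  rw [be_eq, be_eq]
  simp only [map_add, _root_.map_mul, pr_N, Hh_N]
  trans a * d + b * c + 2 * b * d
  · rw [← be_eq (a * c - b * d) (a * d + b * c + 2 * b * d)]
    congr 1
    simp only [map_add, map_sub, _root_.map_mul, map_ofNat]
    linear_combination (K.map (pb (mpr Y)) b * K.map (pb (mpr Y)) d) * (Hh_sq (Y := Y))
  · ring

theorem be_psi (ξ : K (RS Y)) : be (psi ξ) = 2 * psi (be ξ) := by
  obtain ⟨a, b, rfl⟩ := TT_surj ξ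
  rw [be_eq, ← be_eq (psi a - psi b) (2 * psi b)]
  congr 1
  rw [map_add, psi_mul_Hh, psi_map, psi_map]
  simp only [map_add, map_sub, _root_.map_mul, map_ofNat]
  linear_combination (K.map (pb (mpr Y)) (psi b)) * (Hh_sq (Y := Y))

theorem be_map (g : C(Y', Y)) (ξ : K (RS Y)) : be (K.map (pb (gS g)) ξ) = K.map (pb g) (be ξ) := by
  obtain ⟨a, b, rfl⟩ := TT_surj ξ
  rw [be_eq, map_add, _root_.map_mul, pr_map, pr_map, Hh_map, be_eq]

end BK

namespace BK
open Matrix Kronecker Topology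

variable {Y Y' : Type} [TopologicalSpace Y] [CompactSpace Y] [T2Space Y] [TopologicalSpace Y'] [CompactSpace Y'] [T2Space Y']
variable {ι κ : Type} [Fintype ι] [DecidableEq ι] [Fintype κ] [DecidableEq κ]

/-- matrix of continuous functions from a continuous matrix valued function -/
def mkC {W m n : Type} [TopologicalSpace W] (F : W → Matrix m n ℂ) (h : Continuous F) : Matrix m n C(W, ℂ) :=
  Matrix.of fun i j => ⟨fun w => F w i j, (continuous_apply j).comp ((continuous_apply i).comp h)⟩

theorem mkC_ev {W m n : Type} [TopologicalSpace W] (F : W → Matrix m n ℂ) (h : Continuous F) (w : W) :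
    (mkC F h).map (ev w) = F w := rfl

/-- the Hopf projector -/
noncomputable def Qm (a : S2) : Matrix (Fin 2) (Fin 2) ℂ :=
  !![1 - ((a.1.2 : ℝ) : ℂ), (starRingEnd ℂ) a.1.1; a.1.1, ((a.1.2 : ℝ) : ℂ)]

theorem Qm_cont : Continuous Qm := by
  refine continuous_matrix ?_
  intro i j
  fin_cases i <;> fin_cases j <;> simp [Qm] <;> fun_prop

theorem pol_fst (s : I01) (z : Circle) : (pol (s, z)).1.1 = (Real.sqrt (s * (1 - s)) : ℂ) * z := rfl
theorem pol_snd (s : I01) (z : Circle) : (pol (s, z)).1.2 = s := rfl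

theorem S2_norm (a : S2) : a.1.1 * (starRingEnd ℂ) a.1.1 = ((a.1.2 : ℝ) : ℂ) * (1 - ((a.1.2 : ℝ) : ℂ)) := by
  obtain ⟨⟨s, z⟩, rfl⟩ := pol_surj a
  rw [pol_fst, pol_snd, map_mul, Complex.conj_ofReal]
  have h1 : (z : ℂ) * (starRingEnd ℂ) z = 1 := by
    rw [Complex.mul_conj, Circle.normSq_coe]; simp
  have h2 : (Real.sqrt (s * (1 - s)) : ℂ) * (Real.sqrt (s * (1 - s)) : ℂ) = (s : ℝ) * (1 - (s : ℝ)) := by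
    rw [← Complex.ofReal_mul, Real.mul_self_sqrt (mul_nonneg s.2.1 (by linarith [s.2.2]))]; push_cast; ring
  linear_combination h2 + (Real.sqrt (s * (1 - s)) : ℂ) * (Real.sqrt (s * (1 - s)) : ℂ) * h1

theorem Qm_idem (a : S2) : Qm a * Qm a = Qm a := by
  have h := S2_norm a
  ext i j
  fin_cases i <;> fin_cases j <;> simp [Qm, Matrix.mul_apply, Fin.sum_univ_two]
  · linear_combination h
  · ring
  · ring
  · linear_combination h

variable (Y) in
noncomputable def qq : Matrix (Fin 2) (Fin 2) (RA (Y × S2)) := mkC (fun x : Y × S2 => Qm x.2) (Qm_cont.comp continuous_snd)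

theorem qq_idem : qq Y * qq Y = qq Y := by
  refine mat_ext ?_
  intro x
  rw [Matrix.map_mul, qq, mkC_ev, Qm_idem]

theorem cls_qq : cls (⟨Fin 2, qq Y, qq_idem⟩ : Pj (RS Y)) = Hh Y := by
  rw [Hh, kap]
  symm
  let σ : Unit ⊕ Unit ≃ Fin 2 := ⟨Sum.elim (fun _ => 0) (fun _ => 1), ![Sum.inl (), Sum.inr ()], by rintro (x | x) <;> rfl, by intro x; fin_cases x <;> rfl⟩
  refine cls_eq_of (Eqv.of_equiv σ ?_)
  have : (qq Y).submatrix σ σ = clE (zU Y) := by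
    refine mat_ext_pol (Y := Y) (ι := Unit ⊕ Unit) (κ := Unit ⊕ Unit) ?_
    intro y s z
    rw [cl_ev, zU_ev, zU_inv_ev]
    have hc : cc Y (y, s, z) = (Real.sqrt (1 - s) : ℂ) := rfl
    have hs : sn Y (y, s, z) = (Real.sqrt s : ℂ) := rfl
    have hs0 : 0 ≤ (s : ℝ) := s.2.1
    have hs1 : 0 ≤ 1 - (s : ℝ) := by linarith [s.2.2]
    have h1 : (Real.sqrt (1 - s) : ℂ) * (Real.sqrt (1 - s) : ℂ) = 1 - (s : ℝ) := by
      rw [← Complex.ofReal_mul, Real.mul_self_sqrt hs1]; push_cast; ring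
    have h2 : (Real.sqrt s : ℂ) * (Real.sqrt s : ℂ) = (s : ℝ) := by
      rw [← Complex.ofReal_mul, Real.mul_self_sqrt hs0]
    have h3 : (Real.sqrt (s * (1 - s)) : ℂ) = (Real.sqrt s : ℂ) * (Real.sqrt (1 - s) : ℂ) := by
      rw [← Complex.ofReal_mul, Real.sqrt_mul hs0]
    have e : ((qq Y).submatrix σ σ).map (ev (y, pol (s, z))) = (Qm (pol (s, z))).submatrix σ σ := rfl
    rw [e, hc, hs, h1, h2]
    ext (i | i) (j | j)
    · simp [Qm, σ, pol_snd, Matrix.one_apply]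
    · simp [Qm, σ, pol_fst, Matrix.one_apply, h3]; rw [← Circle.coe_inv, Circle.coe_inv_eq_conj]; ring
    · simp [Qm, σ, pol_fst, Matrix.one_apply, h3]
    · simp [Qm, σ, pol_snd, Matrix.one_apply]
  intro i j
  exact congrFun (congrFun this i) j

variable (Y) in
noncomputable def uu : (Matrix (Fin 2) (Fin 2) (RL (Y × S2)))ˣ := Lq (qq Y) qq_idem * (Lq (1 - qq Y) (compl_idem qq_idem))⁻¹

theorem uu_ev (y : Y) (a : S2) (z : Circle) : (uu Y : Matrix (Fin 2) (Fin 2) (RL (Y × S2))).map (ev ((y, a), z)) =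
    (z : ℂ) • Qm a + ((z⁻¹ : Circle) : ℂ) • (1 - Qm a) := by
  rw [uu, Units.val_mul, Matrix.map_mul, Lq_ev, Lq_inv_ev]
  have h : (1 - qq Y).map (ev (y, a)) = 1 - Qm a := by
    rw [← mkC_ev (fun x : Y × S2 => Qm x.2) (Qm_cont.comp continuous_snd) (y, a)]
    rw [Matrix.map_sub _ (by intro a b; exact map_sub _ _ _), map_one']; rfl
  have h' : (qq Y).map (ev (y, a)) = Qm a := rfl
  rw [h, h']
  simp only [Matrix.mul_add, Matrix.add_mul, Matrix.mul_sub, Matrix.sub_mul, Matrix.mul_smul, Matrix.smul_mul, Qm_idem, Matrix.mul_one, Matrix.one_mul]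
  simp
  module

theorem kap_uu : kap (uu Y) = 2 + 2 * (K.map (pb (mpr (Y × S2))) (Hh Y) - 1) * (Hh (Y × S2) - 1) := by
  have h1 := kap_mul (Lq (qq Y) qq_idem) (Lq (1 - qq Y) (compl_idem qq_idem))⁻¹
  rw [kap_inv, kap_L', kap_L'] at h1
  have h2 : cls (⟨Fin 2, 1 - qq Y, compl_idem qq_idem⟩ : Pj (RA (Y × S2))) = 2 - Hh Y := by
    have := cls_compl (⟨Fin 2, qq Y, qq_idem⟩ : Pj (RS Y))
    rw [cls_qq, cls_triv] at this
    simp only [Fintype.card_fin, Nat.cast_ofNat] at this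
    have h3 : cls (⟨Fin 2, 1 - qq Y, compl_idem qq_idem⟩ : Pj (RA (Y × S2))) = cls (Pj.compl (⟨Fin 2, qq Y, qq_idem⟩ : Pj (RS Y))) := rfl
    rw [h3]
    linear_combination this
  have h3 : cls (⟨Fin 2, qq Y, qq_idem⟩ : Pj (RA (Y × S2))) = Hh Y := cls_qq
  rw [h2, h3, map_sub, map_ofNat] at h1
  simp only [Fintype.card_fin, Nat.cast_ofNat] at h1
  rw [uu]
  linear_combination h1

theorem kap_uu' (a : K (RS Y)) (ha : a = 2 * (Hh Y - 1)) : kap (uu Y) = K.map (pb (mpr (Y × S2))) (2 - a) + K.map (pb (mpr (Y × S2))) a * Hh (Y × S2) := by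
  rw [kap_uu, ha]
  simp only [map_sub, _root_.map_mul, map_ofNat, map_one]
  ring

theorem be_kap_uu : be (kap (uu Y)) = 2 * (Hh Y - 1) := by
  obtain ⟨a, ha⟩ : ∃ a, a = 2 * (Hh Y - 1) := ⟨_, rfl⟩
  rw [kap_uu' a ha, ← ha]
  exact be_eq (Y := Y × S2) (2 - a) a

end BK

namespace BK
open Matrix Kronecker Topology

section om
variable {R S : Type} [CommRing R] [CommRing S] [Invertible (2 : R)] [Invertible (2 : S)]
variable {ι : Type} [Fintype ι] [DecidableEq ι]

def om (R : Type) [CommRing R] : Matrix (Fin 2 × Fin 2) Unit R :=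
  Matrix.of fun p _ => if p = (0, 1) then 1 else if p = (1, 0) then -1 else 0

theorem kron_om (g : Matrix (Fin 2) (Fin 2) R) : (g ⊗ₖ g) * om R = g.det • om R := by
  ext ⟨i, j⟩ k
  rw [det_fin_two]
  fin_cases i <;> fin_cases j <;> simp [om, Matrix.mul_apply, Fintype.sum_prod_type, Fin.sum_univ_two] <;> ring

theorem om_kron (g : Matrix (Fin 2) (Fin 2) R) : (om R)ᵀ * (g ⊗ₖ g) = g.det • (om R)ᵀ := by
  ext k ⟨i, j⟩
  rw [det_fin_two]
  fin_cases i <;> fin_cases j <;> simp [om, Matrix.mul_apply, Fintype.sum_prod_type, Fin.sum_univ_two] <;> ring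

theorem om_om : (⅟(2 : R) • (om R)ᵀ) * om R = 1 := by
  ext i j
  simp [om, Matrix.mul_apply, Fintype.sum_prod_type, Fin.sum_univ_two, Matrix.one_apply]

theorem om_om' : om R * (⅟(2 : R) • (om R)ᵀ) = sgP (-1) R (Fin 2) := by
  ext ⟨i, j⟩ ⟨k, l⟩
  fin_cases i <;> fin_cases j <;> fin_cases k <;> fin_cases l <;> simp [om, sgP, flip, Matrix.mul_apply, Matrix.one_apply]

def ox (X : Matrix ι (Fin 2) R) : Matrix (ι × ι) Unit R := (X ⊗ₖ X) * om R
def oy (Z : Matrix (Fin 2) ι R) : Matrix Unit (ι × ι) R := (⅟(2 : R) • (om R)ᵀ) * (Z ⊗ₖ Z)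

theorem oy_ox {X : Matrix ι (Fin 2) R} {Z : Matrix (Fin 2) ι R} (h : Z * X = 1) : oy Z * ox X = 1 := by
  rw [oy, ox, Matrix.mul_assoc, ← Matrix.mul_assoc (Z ⊗ₖ Z), ← mul_kronecker_mul, h, one_kronecker_one, Matrix.one_mul, om_om]

theorem ox_oy (X : Matrix ι (Fin 2) R) (Z : Matrix (Fin 2) ι R) : ox X * oy Z = sgP (-1) R ι * ((X * Z) ⊗ₖ (X * Z)) := by
  rw [oy, ox, Matrix.mul_assoc, ← Matrix.mul_assoc (om R), om_om', ← Matrix.mul_assoc, ← sgP_kron, Matrix.mul_assoc, ← mul_kronecker_mul]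

theorem ox_mul (X : Matrix ι (Fin 2) R) (g : Matrix (Fin 2) (Fin 2) R) (hg : g.det = 1) : ox (X * g) = ox X := by
  rw [ox, ox, mul_kronecker_mul, Matrix.mul_assoc, kron_om, hg, one_smul]
theorem oy_mul (Z : Matrix (Fin 2) ι R) (g : Matrix (Fin 2) (Fin 2) R) (hg : g.det = 1) : oy (g * Z) = oy Z := by
  rw [oy, oy, mul_kronecker_mul, ← Matrix.mul_assoc, Matrix.smul_mul, om_kron, hg, one_smul]

theorem om_map (f : R →+* S) : (om R).map f = om S := by
  ext i j; simp [om, apply_ite f]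
theorem ox_map (f : R →+* S) (X : Matrix ι (Fin 2) R) : (ox X).map f = ox (X.map f) := by
  rw [ox, ox, Matrix.map_mul, om_map]; congr 1
  ext i j; simp
theorem map_half (f : R →+* S) : f (⅟(2 : R)) = ⅟(2 : S) := by
  have h : f (⅟(2 : R)) * 2 = 1 := by rw [← map_ofNat f 2, ← _root_.map_mul, invOf_mul_self, map_one]
  calc f (⅟(2 : R)) = f (⅟(2 : R)) * (2 * ⅟(2 : S)) := by rw [mul_invOf_self, mul_one]
    _ = ⅟(2 : S) := by rw [← mul_assoc, h, one_mul]
theorem oy_map (f : R →+* S) (Z : Matrix (Fin 2) ι R) : (oy Z).map f = oy (Z.map f) := by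
  rw [oy, oy, Matrix.map_mul, map_smul', map_half, transpose_map, om_map]; congr 1
  ext i j; simp
end om

theorem sgP_map' {R S : Type} [CommRing R] [CommRing S] [Invertible (2 : R)] [Invertible (2 : S)] {ι : Type} [Fintype ι] [DecidableEq ι] (f : R →+* S) (σ : ℤˣ) :
    (sgP σ R ι).map f = sgP σ S ι := by
  rw [sgP, sgP, map_smul', map_half, Matrix.map_add _ (fun a b => map_add f a b), map_one', map_smul', map_flip, map_intCast]

theorem sq_triv {W X : Type} [TopologicalSpace W] [TopologicalSpace X] [CompactSpace W] [T2Space X] {ι : Type} [Fintype ι] [DecidableEq ι]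
    (π : C(W, X)) (hs : Function.Surjective π) (E : Matrix ι ι C(X, ℂ)) (hE : E * E = E) (A : Matrix ι (Fin 2) C(W, ℂ)) (Z : Matrix (Fin 2) ι C(W, ℂ))
    (hZX : Z * A = 1) (hXZ : E.map (pb π) = A * Z)
    (h : ∀ w w', π w = π w' → ∃ g gi : Matrix (Fin 2) (Fin 2) ℂ, g.det = 1 ∧ gi.det = 1 ∧ A.map (ev w) = A.map (ev w') * g ∧ Z.map (ev w) = gi * Z.map (ev w')) :
    Eqv (Sq (-1) (⟨ι, E, hE⟩ : Pj C(X, ℂ))) (Pj.triv C(X, ℂ) Unit) := by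
  obtain ⟨x, hx⟩ := mat_desc π hs (ox A) (by
    intro w w' hw
    obtain ⟨g, gi, h1, h2, h3, h4⟩ := h w w' hw
    rw [ox_map, ox_map, h3, ox_mul _ _ h1])
  obtain ⟨y, hy⟩ := mat_desc π hs (oy Z) (by
    intro w w' hw
    obtain ⟨g, gi, h1, h2, h3, h4⟩ := h w w' hw
    rw [oy_map, oy_map, h4, oy_mul _ _ h2])
  refine ⟨x, y, ?_, ?_⟩
  · apply mat_pb_inj π hs
    show (x * y).map _ = (sgP (-1) _ ι * (E ⊗ₖ E)).map _
    rw [Matrix.map_mul, hx, hy, ox_oy, Matrix.map_mul, sgP_map', ← hXZ]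
    congr 1
  · apply mat_pb_inj π hs
    show (y * x).map _ = (1 : Matrix Unit Unit C(X, ℂ)).map _
    rw [Matrix.map_mul, hx, hy, oy_ox hZX, map_one']

theorem be_two (Y : Type) [TopologicalSpace Y] [CompactSpace Y] [T2Space Y] (x : K (RS Y)) : be (2 * x) = 2 * be x := by
  rw [two_mul, be_add, two_mul]

theorem be_sub_two (Y : Type) [TopologicalSpace Y] [CompactSpace Y] [T2Space Y] (x : K (RS Y)) : be (x - 2) = be x := by
  have : be (x - 2) + be (2 : K (RS Y)) = be x := by rw [← be_add]; congr 1; ring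
  have h2 : be (2 : K (RS Y)) = 0 := by rw [← map_ofNat (K.map (pb (mpr Y))) 2, be_pr]
  rw [h2, add_zero] at this; exact this

theorem tr_int (x : K (RA Unit)) : ∃ n : ℤ, (K.tr x) () = (n : ℂ) := by
  have key : ∀ p : Pj (RA Unit), ∃ n : ℤ, (K.tr (cls p)) () = (n : ℂ) := by
    intro p
    have h : IsIdempotentElem (Matrix.toLin' (p.e.map (ev ()))) := by
      unfold IsIdempotentElem
      rw [Module.End.mul_eq_comp, ← Matrix.toLin'_mul, ← Matrix.map_mul, p.idem]
    refine ⟨Module.finrank ℂ (LinearMap.range (Matrix.toLin' (p.e.map (ev ())))), ?_⟩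
    rw [K.tr_cls]
    have := (LinearMap.IsIdempotentElem.isProj_range _ h).trace
    rw [Matrix.trace_toLin'_eq] at this
    push_cast
    rw [← this]
    simp [Matrix.trace]
  obtain ⟨p, q, rfl⟩ := K.exists_sub x
  obtain ⟨m, hm⟩ := key p
  obtain ⟨n, hn⟩ := key q
  exact ⟨m - n, by rw [map_sub K.tr, ContinuousMap.sub_apply, hm, hn]; push_cast; ring⟩

abbrev X1 : Type := Unit × S2
abbrev X2 : Type := X1 × S2
abbrev X3 : Type := X2 × S2
abbrev X4 : Type := X3 × S2

theorem no_class (ε : K (RS X3)) (h1 : psi ε = ε * ε - 2) (h2 : K.map (pb (mN X3)) ε = K.map (pb (mpr X2)) (kap (uu Unit)))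
    (h3 : K.map (pb (gS (gS (mN X1)))) ε = kap (uu X1)) : False := by
  have e1 := congrArg be h1
  rw [be_psi, be_sub_two, be_mul, h2] at e1
  obtain ⟨η, hη⟩ : ∃ η : K (RS X2), η = be ε := ⟨_, rfl⟩
  have e1' : 2 * psi η = 2 * (K.map (pb (mpr X2)) (kap (uu Unit)) * η) := by rw [hη, e1]; ring
  have e2 := congrArg be e1'
  rw [be_two, be_two, be_psi, be_mul, pr_N, be_pr, zero_mul, add_zero] at e2
  obtain ⟨k, hk⟩ : ∃ k : K (RS X1), k = be η := ⟨_, rfl⟩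
  rw [← hk] at e2
  have hk2 : K.map (pb (mN X1)) k = 2 := by
    rw [hk, ← be_map, hη, ← be_map, h3]
    rw [be_kap_uu, be_two, sub_eq_add_neg, be_add, be_Hh]
    rw [show (-1 : K (RS X1)) = K.map (pb (mpr X1)) (-1) by rw [map_neg, map_one], be_pr]
    ring
  have e3 := congrArg be e2
  rw [be_two, be_two, be_two, be_psi, be_mul, kap_N, hk2, be_kap_uu] at e3
  obtain ⟨m, hm⟩ : ∃ m : K (RS Unit), m = be k := ⟨_, rfl⟩
  rw [← hm] at e3
  simp only [Fintype.card_fin, Nat.cast_ofNat] at e3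
  have e4 := congrArg be e3
  have hH : be (Hh Unit - 1) = 1 := by
    rw [sub_eq_add_neg, be_add, be_Hh, show (-1 : K (RS Unit)) = K.map (pb (mpr Unit)) (-1) by rw [map_neg, map_one], be_pr, add_zero]
  rw [be_two, be_two, be_two, be_psi, be_two, be_add, be_two, mul_comm (2 * (Hh Unit - 1)) 2, be_two, be_two, hH] at e4
  have e5 := congrArg K.tr e4
  simp only [_root_.map_mul, map_add, map_ofNat, map_one, tr_psi] at e5
  obtain ⟨n, hn⟩ := tr_int (be m)
  have e6 := DFunLike.congr_fun e5 ()
  simp only [ContinuousMap.mul_apply, ContinuousMap.add_apply, hn, ContinuousMap.one_apply] at e6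
  have t2 : (2 : RA Unit) () = 2 := rfl
  rw [t2] at e6
  have e7 : (12 : ℤ) * n = 8 := by
    have : (12 : ℂ) * n = 8 := by linear_combination e6
    exact_mod_cast this
  omega

end BK

namespace BK
open Matrix Kronecker Topology

section frame
variable {m : Type}

def cX (c s : ℂ) (X : Matrix m (Fin 2) ℂ) (g : Matrix (Fin 2) (Fin 2) ℂ) : Matrix (m ⊕ m) (Fin 2) ℂ := fromRows (c • X) (s • (X * g))
def rZ (c s : ℂ) (Z : Matrix (Fin 2) m ℂ) (g : Matrix (Fin 2) (Fin 2) ℂ) : Matrix (Fin 2) (m ⊕ m) ℂ := fromCols (c • Z) (s • (g * Z))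

theorem rZ_cX [Fintype m] {c s : ℂ} {X : Matrix m (Fin 2) ℂ} {Z : Matrix (Fin 2) m ℂ} {g gi : Matrix (Fin 2) (Fin 2) ℂ}
    (h : c * c + s * s = 1) (hZ : Z * X = 1) (hg : gi * g = 1) : rZ c s Z gi * cX c s X g = 1 := by
  have : gi * Z * (X * g) = 1 := by rw [Matrix.mul_assoc, ← Matrix.mul_assoc Z, hZ, Matrix.one_mul, hg]
  rw [rZ, cX, fromCols_mul_fromRows, Matrix.smul_mul, Matrix.mul_smul, Matrix.smul_mul, Matrix.mul_smul, hZ, this, smul_smul, smul_smul, ← add_smul, h, one_smul]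

theorem cX_rZ (c s : ℂ) (X : Matrix m (Fin 2) ℂ) (Z : Matrix (Fin 2) m ℂ) (g gi : Matrix (Fin 2) (Fin 2) ℂ) (hg : g * gi = 1) :
    cX c s X g * rZ c s Z gi = fromBlocks ((c * c) • (X * Z)) ((c * s) • (X * gi * Z)) ((s * c) • (X * g * Z)) ((s * s) • (X * Z)) := by
  have : X * g * (gi * Z) = X * Z := by rw [Matrix.mul_assoc, ← Matrix.mul_assoc g, hg, Matrix.one_mul]
  rw [rZ, cX, fromRows_mul_fromCols]
  simp only [Matrix.smul_mul, Matrix.mul_smul, smul_smul, this, Matrix.mul_assoc]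
  simp only [mul_comm c s]

theorem cX_mul (c s : ℂ) (X : Matrix m (Fin 2) ℂ) (g g' h : Matrix (Fin 2) (Fin 2) ℂ) (e : h * g = g' * h) :
    cX c s (X * h) g = cX c s X g' * h := by
  rw [cX, cX, fromRows_mul, Matrix.smul_mul, Matrix.smul_mul, Matrix.mul_assoc X h, e, Matrix.mul_assoc]
theorem rZ_mul (c s : ℂ) (Z : Matrix (Fin 2) m ℂ) (g g' h : Matrix (Fin 2) (Fin 2) ℂ) (e : g * h = h * g') :
    rZ c s (h * Z) g = h * rZ c s Z g' := by
  rw [rZ, rZ, mul_fromCols, Matrix.mul_smul, Matrix.mul_smul, ← Matrix.mul_assoc g, e, Matrix.mul_assoc]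
end frame

section grp
variable {G : Type} [Group G] (M : G →* Matrix (Fin 2) (Fin 2) ℂ)

/-- pointwise frame -/
def fX (c s c' s' : ℂ) (u A : G) : Matrix ((Fin 2 ⊕ Fin 2) ⊕ (Fin 2 ⊕ Fin 2)) (Fin 2) ℂ := cX c' s' (cX c s 1 (M u)) (M A)
def fZ (c s c' s' : ℂ) (u A : G) : Matrix (Fin 2) ((Fin 2 ⊕ Fin 2) ⊕ (Fin 2 ⊕ Fin 2)) ℂ := rZ c' s' (rZ c s 1 (M u⁻¹)) (M A⁻¹)

theorem M_inv (g : G) : M g * M g⁻¹ = 1 := by rw [← _root_.map_mul, mul_inv_cancel, map_one]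
theorem M_inv' (g : G) : M g⁻¹ * M g = 1 := by rw [← _root_.map_mul, inv_mul_cancel, map_one]

theorem fZ_fX (c s c' s' : ℂ) (u A : G) (h : c * c + s * s = 1) (h' : c' * c' + s' * s' = 1) :
    fZ M c s c' s' u A * fX M c s c' s' u A = 1 := 
  rZ_cX h' (rZ_cX h (Matrix.one_mul 1) (M_inv' M u)) (M_inv' M A)

/-- change of `u` at `c = 0` -/
theorem fX_two (s c' s' : ℂ) (u u' v : G) : fX M 0 s c' s' u (u⁻¹ * v * u) = fX M 0 s c' s' u' (u'⁻¹ * v * u') * M (u'⁻¹ * u) := by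
  have h : cX 0 s 1 (M u) = cX 0 s (1 : Matrix (Fin 2) (Fin 2) ℂ) (M u') * M (u'⁻¹ * u) := by
    simp only [cX, fromRows_mul, Matrix.smul_mul, zero_smul, Matrix.one_mul, Matrix.zero_mul, ← _root_.map_mul]; congr 3; group
  rw [fX, fX, h]
  apply cX_mul
  simp only [← _root_.map_mul]; congr 1; group
theorem fZ_two (s c' s' : ℂ) (u u' v : G) : fZ M 0 s c' s' u (u⁻¹ * v * u) = M (u'⁻¹ * u)⁻¹ * fZ M 0 s c' s' u' (u'⁻¹ * v * u') := by
  have h : rZ 0 s 1 (M u⁻¹) = M (u'⁻¹ * u)⁻¹ * rZ 0 s (1 : Matrix (Fin 2) (Fin 2) ℂ) (M u'⁻¹) := by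
    simp only [rZ, mul_fromCols, Matrix.mul_smul, zero_smul, Matrix.mul_one, Matrix.mul_zero, ← _root_.map_mul]; congr 3; group
  rw [fZ, fZ, h]
  apply rZ_mul
  simp only [← _root_.map_mul]; congr 1; group
/-- change of `A` at `c' = 0` -/
theorem fX_four (c s s' : ℂ) (u A A' : G) : fX M c s 0 s' u A = fX M c s 0 s' u A' * M (A'⁻¹ * A) := by
  simp only [fX, cX, fromRows_mul, Matrix.smul_mul, zero_smul, Matrix.zero_mul, Matrix.mul_assoc, ← _root_.map_mul]
  simp [mul_assoc]
theorem fZ_four (c s s' : ℂ) (u A A' : G) : fZ M c s 0 s' u A = M (A'⁻¹ * A)⁻¹ * fZ M c s 0 s' u A' := by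
  simp only [fZ, rZ, mul_fromCols, Matrix.mul_smul, zero_smul, Matrix.mul_zero, ← Matrix.mul_assoc, ← _root_.map_mul]
  simp
theorem fX_zero2 (c c' s' : ℂ) (u u' A : G) : fX M c 0 c' s' u A = fX M c 0 c' s' u' A := by simp only [fX, cX, zero_smul]
theorem fZ_zero2 (c c' s' : ℂ) (u u' A : G) : fZ M c 0 c' s' u A = fZ M c 0 c' s' u' A := by simp only [fZ, rZ, zero_smul]
theorem fX_zero4 (c s c' : ℂ) (u A A' : G) : fX M c s c' 0 u A = fX M c s c' 0 u A' := by simp only [fX, cX, zero_smul]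
theorem fZ_zero4 (c s c' : ℂ) (u A A' : G) : fZ M c s c' 0 u A = fZ M c s c' 0 u A' := by simp only [fZ, rZ, zero_smul]

variable [TopologicalSpace G] [IsTopologicalGroup G]

theorem cX_cont {W m : Type} [TopologicalSpace W] {c s : W → ℂ} {X : W → Matrix m (Fin 2) ℂ} {g : W → Matrix (Fin 2) (Fin 2) ℂ}
    (hc : Continuous c) (hs : Continuous s) (hX : Continuous X) (hg : Continuous g) : Continuous fun w => cX (c w) (s w) (X w) (g w) := by
  have h2 : Continuous fun w => s w • (X w * g w) := hs.smul (hX.matrix_mul hg)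
  refine continuous_matrix ?_
  rintro (i | i) j
  · exact (hc.smul hX).matrix_elem i j
  · exact h2.matrix_elem i j
theorem rZ_cont {W m : Type} [TopologicalSpace W] {c s : W → ℂ} {X : W → Matrix (Fin 2) m ℂ} {g : W → Matrix (Fin 2) (Fin 2) ℂ}
    (hc : Continuous c) (hs : Continuous s) (hX : Continuous X) (hg : Continuous g) : Continuous fun w => rZ (c w) (s w) (X w) (g w) := by
  have h2 : Continuous fun w => s w • (g w * X w) := hs.smul (hg.matrix_mul hX)
  refine continuous_matrix ?_
  rintro j (i | i)
  · exact (hc.smul hX).matrix_elem j i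
  · exact h2.matrix_elem j i

abbrev WW : Type := ((X1 × (I01 × Circle)) × S2) × (I01 × Circle)

noncomputable abbrev ppi : C(WW, X4) := ⟨fun w => (((w.1.1.1, pol w.1.1.2), w.1.2), pol w.2), by fun_prop⟩

theorem ppi_surj : Function.Surjective ppi := by
  rintro ⟨⟨⟨x, a⟩, b⟩, d⟩
  obtain ⟨p, rfl⟩ := pol_surj a
  obtain ⟨q, rfl⟩ := pol_surj d
  exact ⟨(((x, p), b), q), rfl⟩

noncomputable abbrev co (s : I01) : ℂ := (Real.sqrt (1 - s) : ℂ)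
noncomputable abbrev si (s : I01) : ℂ := (Real.sqrt s : ℂ)
theorem co_si (s : I01) : co s * co s + si s * si s = 1 := by
  have hs0 : 0 ≤ (s : ℝ) := s.2.1
  have hs1 : 0 ≤ 1 - (s : ℝ) := by linarith [s.2.2]
  rw [co, si, ← Complex.ofReal_mul, Real.mul_self_sqrt hs1, ← Complex.ofReal_mul, Real.mul_self_sqrt hs0]; push_cast; ring
theorem co_zero : co 0 = 1 := by simp [co]
theorem co_one : co 1 = 0 := by simp [co]
theorem si_zero : si 0 = 0 := by simp [si]
theorem si_one : si 1 = 1 := by simp [si]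

noncomputable def AA (U : C(S2 × Circle, G)) (Hm : C(I01 × (G × G), G)) (a : S2) (s : I01) (z : Circle) (b : S2) (t : Circle) : G :=
  U (b, t) * Hm (s, ((U (b, t))⁻¹, (U (a, z))⁻¹))

noncomputable def pX (U : C(S2 × Circle, G)) (Hm : C(I01 × (G × G), G)) (w : WW) : Matrix ((Fin 2 ⊕ Fin 2) ⊕ (Fin 2 ⊕ Fin 2)) (Fin 2) ℂ :=
  fX M (co w.1.1.2.1) (si w.1.1.2.1) (co w.2.1) (si w.2.1) (U (w.1.1.1.2, w.1.1.2.2)) (AA U Hm w.1.1.1.2 w.1.1.2.1 w.1.1.2.2 w.1.2 w.2.2)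
noncomputable def pZ (U : C(S2 × Circle, G)) (Hm : C(I01 × (G × G), G)) (w : WW) : Matrix (Fin 2) ((Fin 2 ⊕ Fin 2) ⊕ (Fin 2 ⊕ Fin 2)) ℂ :=
  fZ M (co w.1.1.2.1) (si w.1.1.2.1) (co w.2.1) (si w.2.1) (U (w.1.1.1.2, w.1.1.2.2)) (AA U Hm w.1.1.1.2 w.1.1.2.1 w.1.1.2.2 w.1.2 w.2.2)

variable (U : C(S2 × Circle, G)) (Hm : C(I01 × (G × G), G))

theorem AA_cont {W : Type} [TopologicalSpace W] {a b : W → S2} {s : W → I01} {z t : W → Circle}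
    (ha : Continuous a) (hb : Continuous b) (hs : Continuous s) (hz : Continuous z) (ht : Continuous t) : Continuous fun w => AA U Hm (a w) (s w) (z w) (b w) (t w) := by
  unfold AA; fun_prop

theorem pX_cont (hM : Continuous M) : Continuous (pX M U Hm) := by
  unfold pX fX
  have h := AA_cont U Hm (W := WW) (a := fun w => w.1.1.1.2) (b := fun w => w.1.2) (s := fun w => w.1.1.2.1) (z := fun w => w.1.1.2.2) (t := fun w => w.2.2) (by fun_prop) (by fun_prop) (by fun_prop) (by fun_prop) (by fun_prop)
  refine cX_cont (by fun_prop) (by fun_prop) (cX_cont (by fun_prop) (by fun_prop) continuous_const (by fun_prop)) (hM.comp h)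
theorem pZ_cont (hM : Continuous M) : Continuous (pZ M U Hm) := by
  unfold pZ fZ
  have h := AA_cont U Hm (W := WW) (a := fun w => w.1.1.1.2) (b := fun w => w.1.2) (s := fun w => w.1.1.2.1) (z := fun w => w.1.1.2.2) (t := fun w => w.2.2) (by fun_prop) (by fun_prop) (by fun_prop) (by fun_prop) (by fun_prop)
  refine rZ_cont (by fun_prop) (by fun_prop) (rZ_cont (by fun_prop) (by fun_prop) continuous_const (by fun_prop)) (hM.comp h.inv)

variable (h0 : ∀ x, Hm (0, x) = 1) (h1 : ∀ a b, Hm (1, (a, b)) = a * b * a⁻¹ * b⁻¹)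

theorem AA_zero (h0 : ∀ x, Hm (0, x) = 1) (a : S2) (z : Circle) (b : S2) (t : Circle) : AA U Hm a 0 z b t = U (b, t) := by
  rw [AA, h0, mul_one]
theorem AA_one (h1 : ∀ a b, Hm (1, (a, b)) = a * b * a⁻¹ * b⁻¹) (a : S2) (z : Circle) (b : S2) (t : Circle) :
    AA U Hm a 1 z b t = (U (a, z))⁻¹ * U (b, t) * U (a, z) := by
  rw [AA, h1]; group

theorem fib2 (h0 : ∀ x, Hm (0, x) = 1) (h1 : ∀ a b, Hm (1, (a, b)) = a * b * a⁻¹ * b⁻¹) (x : X1) (s : I01) (z z' : Circle) (b : S2) (q : I01 × Circle) (h : z = z' ∨ s = 0 ∨ s = 1) :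
    ∃ g : G, pX M U Hm (((x, (s, z)), b), q) = pX M U Hm (((x, (s, z')), b), q) * M g ∧ pZ M U Hm (((x, (s, z)), b), q) = M g⁻¹ * pZ M U Hm (((x, (s, z')), b), q) := by
  rcases h with rfl | rfl | rfl
  · exact ⟨1, by rw [map_one, Matrix.mul_one], by rw [inv_one, map_one, Matrix.one_mul]⟩
  · refine ⟨1, ?_, ?_⟩
    · rw [map_one, Matrix.mul_one]
      simp only [pX, AA_zero U Hm h0, si_zero]
      exact fX_zero2 ..
    · rw [inv_one, map_one, Matrix.one_mul]
      simp only [pZ, AA_zero U Hm h0, si_zero]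
      exact fZ_zero2 ..
  · refine ⟨(U (x.2, z'))⁻¹ * U (x.2, z), ?_, ?_⟩
    · simp only [pX, AA_one U Hm h1, co_one]
      exact fX_two ..
    · simp only [pZ, AA_one U Hm h1, co_one]
      exact fZ_two ..

theorem fib4 (x : X1) (p : I01 × Circle) (s : I01) (z z' : Circle) (b : S2) (h : z = z' ∨ s = 0 ∨ s = 1) :
    ∃ g : G, pX M U Hm (((x, p), b), (s, z)) = pX M U Hm (((x, p), b), (s, z')) * M g ∧ pZ M U Hm (((x, p), b), (s, z)) = M g⁻¹ * pZ M U Hm (((x, p), b), (s, z')) := by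
  rcases h with rfl | rfl | rfl
  · exact ⟨1, by rw [map_one, Matrix.mul_one], by rw [inv_one, map_one, Matrix.one_mul]⟩
  · refine ⟨1, ?_, ?_⟩
    · rw [map_one, Matrix.mul_one]
      simp only [pX, si_zero]
      exact fX_zero4 ..
    · rw [inv_one, map_one, Matrix.one_mul]
      simp only [pZ, si_zero]
      exact fZ_zero4 ..
  · refine ⟨(AA U Hm x.2 p.1 p.2 b z')⁻¹ * AA U Hm x.2 p.1 p.2 b z, ?_, ?_⟩
    · simp only [pX, co_one]
      exact fX_four ..
    · simp only [pZ, co_one]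
      exact fZ_four ..

theorem fib (h0 : ∀ x, Hm (0, x) = 1) (h1 : ∀ a b, Hm (1, (a, b)) = a * b * a⁻¹ * b⁻¹) (w w' : WW) (h : ppi w = ppi w') :
    ∃ g : G, pX M U Hm w = pX M U Hm w' * M g ∧ pZ M U Hm w = M g⁻¹ * pZ M U Hm w' := by
  obtain ⟨⟨⟨x, s, z⟩, b⟩, t, y⟩ := w
  obtain ⟨⟨⟨x', s', z'⟩, b'⟩, t', y'⟩ := w'
  have e1 : x = x' := congrArg (fun r : X4 => r.1.1.1) h
  have e2 : pol (s, z) = pol (s', z') := congrArg (fun r : X4 => r.1.1.2) h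
  have e3 : b = b' := congrArg (fun r : X4 => r.1.2) h
  have e4 : pol (t, y) = pol (t', y') := congrArg (fun r : X4 => r.2) h
  subst e1 e3
  obtain ⟨rfl, k2⟩ := pol_eq e2
  obtain ⟨rfl, k4⟩ := pol_eq e4
  obtain ⟨g, g1, g2⟩ := fib2 M U Hm h0 h1 x s z z' b (t, y) k2
  obtain ⟨g', g1', g2'⟩ := fib4 M U Hm x (s, z') t y y' b k4
  refine ⟨g' * g, ?_, ?_⟩
  · rw [g1, g1', Matrix.mul_assoc, ← _root_.map_mul]
  · rw [g2, g2', ← Matrix.mul_assoc, ← _root_.map_mul, _root_.mul_inv_rev]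

theorem pZ_pX (w : WW) : pZ M U Hm w * pX M U Hm w = 1 := fZ_fX M _ _ _ _ _ _ (co_si _) (co_si _)

theorem ex_E (hM : Continuous M) (h0 : ∀ x, Hm (0, x) = 1) (h1 : ∀ a b, Hm (1, (a, b)) = a * b * a⁻¹ * b⁻¹) (hdet : ∀ g, (M g).det = 1) :
    ∃ (E : Matrix ((Fin 2 ⊕ Fin 2) ⊕ (Fin 2 ⊕ Fin 2)) ((Fin 2 ⊕ Fin 2) ⊕ (Fin 2 ⊕ Fin 2)) C(X4, ℂ)) (hE : E * E = E),
      (∀ w : WW, E.map (ev (ppi w)) = pX M U Hm w * pZ M U Hm w) ∧ Eqv (Sq (-1) (⟨_, E, hE⟩ : Pj C(X4, ℂ))) (Pj.triv C(X4, ℂ) Unit) := by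
  obtain ⟨A, hA⟩ : ∃ A, A = mkC (pX M U Hm) (pX_cont M U Hm hM) := ⟨_, rfl⟩
  obtain ⟨Z, hZ⟩ : ∃ A, A = mkC (pZ M U Hm) (pZ_cont M U Hm hM) := ⟨_, rfl⟩
  have eA : ∀ w, A.map (ev w) = pX M U Hm w := fun w => by rw [hA, mkC_ev]
  have eZ : ∀ w, Z.map (ev w) = pZ M U Hm w := fun w => by rw [hZ, mkC_ev]
  have hZA : Z * A = 1 := by
    refine mat_ext ?_
    intro w
    rw [Matrix.map_mul, eA, eZ, pZ_pX, map_one']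
  obtain ⟨E, hE⟩ := mat_desc ppi ppi_surj (A * Z) (by
    intro w w' hw
    obtain ⟨g, g1, g2⟩ := fib M U Hm h0 h1 w w' hw
    rw [Matrix.map_mul, Matrix.map_mul, eA, eZ, eA, eZ, g1, g2, Matrix.mul_assoc, ← Matrix.mul_assoc (M g), M_inv, Matrix.one_mul])
  have hEE : E * E = E := by
    apply mat_pb_inj ppi ppi_surj
    rw [Matrix.map_mul, hE, Matrix.mul_assoc, ← Matrix.mul_assoc Z, hZA, Matrix.one_mul]
  refine ⟨E, hEE, ?_, ?_⟩
  · intro w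
    have : E.map (ev (ppi w)) = (E.map (pb ppi)).map (ev w) := rfl
    rw [this, hE, Matrix.map_mul, eA, eZ]
  · refine sq_triv ppi ppi_surj E hEE A Z hZA hE ?_
    intro w w' hw
    obtain ⟨g, g1, g2⟩ := fib M U Hm h0 h1 w w' hw
    exact ⟨M g, M g⁻¹, hdet _, hdet _, by rw [eA, eA, g1], by rw [eZ, eZ, g2]⟩
end grp
end BK

namespace BK
open Matrix Kronecker Topology

section fin
variable {G : Type} [Group G] [TopologicalSpace G] [IsTopologicalGroup G] (M : G →* Matrix (Fin 2) (Fin 2) ℂ)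
  (U : C(S2 × Circle, G)) (Hm : C(I01 × (G × G), G))
variable {Y : Type} [TopologicalSpace Y] [CompactSpace Y] [T2Space Y]

theorem uu_M (hU : ∀ a z, M (U (a, z)) = (z : ℂ) • Qm a + ((z⁻¹ : Circle) : ℂ) • (1 - Qm a)) (y : Y) (a : S2) (z : Circle) :
    (uu Y : Matrix (Fin 2) (Fin 2) (RL (Y × S2))).map (ev ((y, a), z)) = M (U (a, z)) := by rw [uu_ev, hU]

theorem uu_M' (hU : ∀ a z, M (U (a, z)) = (z : ℂ) • Qm a + ((z⁻¹ : Circle) : ℂ) • (1 - Qm a)) (y : Y) (a : S2) (z : Circle) :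
    (((uu Y)⁻¹ : (Matrix (Fin 2) (Fin 2) (RL (Y × S2)))ˣ) : Matrix (Fin 2) (Fin 2) (RL (Y × S2))).map (ev ((y, a), z)) = M (U (a, z))⁻¹ := by
  obtain ⟨B, hB⟩ : ∃ B, B = (((uu Y)⁻¹ : (Matrix (Fin 2) (Fin 2) (RL (Y × S2)))ˣ) : Matrix (Fin 2) (Fin 2) (RL (Y × S2))) := ⟨_, rfl⟩
  have h : B * (uu Y : Matrix (Fin 2) (Fin 2) (RL (Y × S2))) = 1 := by rw [hB]; exact (uu Y).inv_mul
  have h2 : B.map (ev ((y, a), z)) * M (U (a, z)) = 1 := by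
    rw [← uu_M M U hU y a z, ← Matrix.map_mul, h, map_one']
  rw [← hB]
  calc B.map (ev ((y, a), z)) = B.map (ev ((y, a), z)) * (M (U (a, z)) * M (U (a, z))⁻¹) := by rw [M_inv, Matrix.mul_one]
    _ = _ := by rw [← Matrix.mul_assoc, h2, Matrix.one_mul]

theorem clE_pt (hU : ∀ a z, M (U (a, z)) = (z : ℂ) • Qm a + ((z⁻¹ : Circle) : ℂ) • (1 - Qm a)) (y : Y) (a : S2) (s : I01) (z : Circle) :
    (clE (uu Y)).map (ev ((y, a), pol (s, z))) = fromBlocks ((co s * co s) • (1 : Matrix (Fin 2) (Fin 2) ℂ)) ((co s * si s) • M (U (a, z))⁻¹)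
      ((si s * co s) • M (U (a, z))) ((si s * si s) • (1 : Matrix (Fin 2) (Fin 2) ℂ)) := by
  rw [cl_ev, uu_M M U hU, uu_M' M U hU]; rfl

theorem clE_pt' (hU : ∀ a z, M (U (a, z)) = (z : ℂ) • Qm a + ((z⁻¹ : Circle) : ℂ) • (1 - Qm a)) (y : Y) (a : S2) (s : I01) (z : Circle) :
    (clE (uu Y)).map (ev ((y, a), pol (s, z))) = cX (co s) (si s) 1 (M (U (a, z))) * rZ (co s) (si s) 1 (M (U (a, z))⁻¹) := by
  rw [clE_pt M U hU, cX_rZ _ _ _ _ _ _ (M_inv _ _)]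
  simp only [Matrix.mul_one, Matrix.one_mul]

section J
variable (R : Type) [CommRing R]
def J2 : Matrix (Fin 2 ⊕ Fin 2) (Fin 2) R := fromRows 1 0
def JJ : Matrix ((Fin 2 ⊕ Fin 2) ⊕ (Fin 2 ⊕ Fin 2)) (Fin 2 ⊕ Fin 2) R := fromBlocks (J2 R) 0 0 (J2 R)
variable {R}
theorem J2_T : (J2 R)ᵀ * J2 R = 1 := by
  rw [J2, transpose_fromRows, fromCols_mul_fromRows]; simp
theorem JJ_T : (JJ R)ᵀ * JJ R = 1 := by
  rw [JJ, fromBlocks_transpose, fromBlocks_multiply]; simp [J2_T]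
theorem JJ_eqv (p : Matrix (Fin 2 ⊕ Fin 2) (Fin 2 ⊕ Fin 2) R) (hp : p * p = p) (E : Matrix ((Fin 2 ⊕ Fin 2) ⊕ (Fin 2 ⊕ Fin 2)) ((Fin 2 ⊕ Fin 2) ⊕ (Fin 2 ⊕ Fin 2)) R) (hE : E * E = E)
    (h : E = JJ R * p * (JJ R)ᵀ) : Eqv (⟨_, E, hE⟩ : Pj R) ⟨_, p, hp⟩ := by
  refine ⟨JJ R * p, p * (JJ R)ᵀ, ?_, ?_⟩
  · have h' : JJ R * p * (p * (JJ R)ᵀ) = JJ R * p * (JJ R)ᵀ := by rw [Matrix.mul_assoc, ← Matrix.mul_assoc p, hp, Matrix.mul_assoc]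
    exact h'.trans h.symm
  · show _ = p
    rw [Matrix.mul_assoc, ← Matrix.mul_assoc _ (JJ R), JJ_T, Matrix.one_mul, hp]
theorem JJ_map {S : Type} [CommRing S] (f : R →+* S) : (JJ R).map f = JJ S := by
  ext (( i| i)|(i|i)) (j|j) <;> simp [JJ, J2, Matrix.one_apply, apply_ite f]
end J

theorem main_abs (hM : Continuous M) (hdet : ∀ g, (M g).det = 1)
    (hU : ∀ a z, M (U (a, z)) = (z : ℂ) • Qm a + ((z⁻¹ : Circle) : ℂ) • (1 - Qm a))
    (h0 : ∀ x, Hm (0, x) = 1) (h1 : ∀ a b, Hm (1, (a, b)) = a * b * a⁻¹ * b⁻¹) : False := by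
  obtain ⟨E, hE, hpt, hsq⟩ := ex_E M U Hm hM h0 h1 hdet
  refine no_class (cls ⟨_, E, hE⟩) ?_ ?_ ?_
  · rw [psi_cls', cls_eq_of hsq, cls_triv]; simp
  · rw [K.map_cls, kap, K.map_cls]
    have e : E.map (pb (mN X3)) = fromBlocks ((clE (uu Unit)).map (pb (mpr X2))) 0 0 0 := by
      refine mat_ext ?_
      rintro ⟨⟨⟨y, a⟩, p⟩, b⟩
      obtain ⟨⟨s, z⟩, rfl⟩ := pol_surj p
      have e1 : (E.map (pb (mN X3))).map (ev (((y, a), pol (s, z)), b)) = E.map (ev (ppi ((((y, a), (s, z)), b), (0, 1)))) := rfl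
      have e2 : ((clE (uu Unit)).map (pb (mpr X2))).map (ev (((y, a), pol (s, z)), b)) = (clE (uu Unit)).map (ev ((y, a), pol (s, z))) := rfl
      rw [e1, hpt, fromBlocks_map, e2, clE_pt' M U hU, pX, pZ, fX, fZ]
      simp only [si_zero, co_zero]
      rw [cX_rZ _ _ _ _ _ _ (M_inv _ _)]
      simp only [mul_one, one_smul, mul_zero, zero_mul, zero_smul]
      congr 1 <;> ext i j <;> simp
    symm
    refine (cls_eq_of (eqv_left _ (Fin 2 ⊕ Fin 2) ?_)).trans (cls_eq_of (Eqv.of_equiv (Equiv.refl _) ?_))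
    · have := (Pj.map (pb (mN X3)) ⟨_, E, hE⟩).idem
      rw [← e]; exact this
    · intro i j
      exact congrFun (congrFun e i) j
  · rw [K.map_cls, kap]
    refine cls_eq_of (JJ_eqv (clE (uu X1)) (cl (uu X1)).idem _ (Pj.map (pb (gS (gS (mN X1)))) ⟨_, E, hE⟩).idem ?_)
    show E.map (pb (gS (gS (mN X1)))) = _
    refine mat_ext ?_
    rintro ⟨⟨y, b⟩, q⟩
    obtain ⟨⟨t, x⟩, rfl⟩ := pol_surj q
    have e1 : (E.map (pb (gS (gS (mN X1))))).map (ev ((y, b), pol (t, x))) = E.map (ev (ppi (((y, (0, 1)), b), (t, x)))) := rfl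
    rw [e1, hpt, Matrix.map_mul, Matrix.map_mul, transpose_map, JJ_map, clE_pt M U hU, pX, pZ, fX, fZ]
    simp only [AA_zero U Hm h0, co_zero, si_zero]
    rw [cX_rZ _ _ _ _ _ _ (M_inv _ _), JJ, fromBlocks_transpose, fromBlocks_multiply, fromBlocks_multiply]
    have hx : cX 1 0 1 (M (U (y.2, 1))) = J2 ℂ := by simp [cX, J2]
    have hz : rZ 1 0 1 (M (U (y.2, 1))⁻¹) = (J2 ℂ)ᵀ := by simp [rZ, J2, transpose_fromRows]
    rw [hx, hz]
    simp
end fin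
end BK

namespace BK
open Matrix Kronecker Topology

noncomputable def MM : SU 2 →* Matrix (Fin 2) (Fin 2) ℂ where
  toFun g := (g : Matrix.unitaryGroup (Fin 2) ℂ).1
  map_one' := rfl
  map_mul' _ _ := rfl

theorem MM_cont : Continuous MM := continuous_subtype_val.comp continuous_subtype_val
theorem MM_inj {g h : SU 2} (e : MM g = MM h) : g = h := Subtype.ext (Subtype.ext e)
theorem MM_det (g : SU 2) : (MM g).det = 1 := g.2

instance : IsTopologicalGroup (Matrix.unitaryGroup (Fin 2) ℂ) := inferInstanceAs (IsTopologicalGroup (unitary (Matrix (Fin 2) (Fin 2) ℂ)))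

/-- quaternionic form -/
def QF (A : Matrix (Fin 2) (Fin 2) ℂ) : Prop := A 1 1 = star (A 0 0) ∧ A 1 0 = -star (A 0 1)
noncomputable def dd (A : Matrix (Fin 2) (Fin 2) ℂ) : ℝ := Complex.normSq (A 0 0) + Complex.normSq (A 0 1)

theorem nsq (z : ℂ) : z * star z = (Complex.normSq z : ℂ) := Complex.mul_conj z

theorem QF_SU (g : SU 2) : QF (MM g) := by
  have h1 : MM g * star (MM g) = 1 := (Matrix.mem_unitaryGroup_iff).1 g.1.2
  have h2 : star (MM g) = (MM g).adjugate := by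
    calc star (MM g) = ((MM g).adjugate * MM g) * star (MM g) := by rw [adjugate_mul, MM_det, one_smul, Matrix.one_mul]
      _ = _ := by rw [Matrix.mul_assoc, h1, Matrix.mul_one]
  rw [adjugate_fin_two] at h2
  constructor
  · have := congrFun (congrFun h2 0) 0
    simp [star_apply] at this
    exact this.symm
  · have := congrFun (congrFun h2 1) 0
    simp [star_apply] at this
    rw [eq_neg_iff_add_eq_zero]; simp [this]

theorem dd_QF {A : Matrix (Fin 2) (Fin 2) ℂ} (h : QF A) : A.det = (dd A : ℂ) := by
  rw [det_fin_two, h.1, h.2, dd, nsq]; push_cast; rw [← nsq (A 0 1)]; ring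

theorem dd_SU (g : SU 2) : dd (MM g) = 1 := by
  have := dd_QF (QF_SU g)
  rw [MM_det] at this; exact_mod_cast this.symm

theorem QF_smul {A : Matrix (Fin 2) (Fin 2) ℂ} (h : QF A) (r : ℝ) : QF ((r : ℂ) • A) := by
  constructor <;> simp [h.1, h.2]
theorem QF_sub {A B : Matrix (Fin 2) (Fin 2) ℂ} (h : QF A) (h' : QF B) : QF (A - B) := by
  constructor <;> simp [h.1, h.2, h'.1, h'.2]; ring
theorem dd_smul (A : Matrix (Fin 2) (Fin 2) ℂ) (r : ℝ) : dd ((r : ℂ) • A) = r * r * dd A := by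
  simp [dd]; ring
theorem dd_nonneg (A : Matrix (Fin 2) (Fin 2) ℂ) : 0 ≤ dd A := add_nonneg (Complex.normSq_nonneg _) (Complex.normSq_nonneg _)
theorem dd_zero {A : Matrix (Fin 2) (Fin 2) ℂ} (h : QF A) (h' : dd A = 0) : A = 0 := by
  have a := Complex.normSq_nonneg (A 0 0)
  have b := Complex.normSq_nonneg (A 0 1)
  unfold dd at h'
  have a' : A 0 0 = 0 := Complex.normSq_eq_zero.1 (by linarith)
  have b' : A 0 1 = 0 := Complex.normSq_eq_zero.1 (by linarith)
  ext i j
  fin_cases i <;> fin_cases j <;> simp [a', b', h.1, h.2]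

theorem QF_mem {A : Matrix (Fin 2) (Fin 2) ℂ} (h : QF A) (h' : dd A = 1) : A ∈ Matrix.unitaryGroup (Fin 2) ℂ := by
  have hd := dd_QF h
  rw [h', det_fin_two, h.1, h.2] at hd
  push_cast at hd
  rw [Matrix.mem_unitaryGroup_iff]
  ext i j
  fin_cases i <;> fin_cases j <;> simp [Matrix.mul_apply, Fin.sum_univ_two, star_apply, h.1, h.2]
  · simp at hd; linear_combination hd
  · ring
  · ring
  · simp at hd; linear_combination hd

def mkSU (A : Matrix (Fin 2) (Fin 2) ℂ) (h : QF A) (h' : dd A = 1) : SU 2 :=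
  ⟨⟨A, QF_mem h h'⟩, by show A.det = 1; rw [dd_QF h, h']; simp⟩

theorem MM_mkSU (A : Matrix (Fin 2) (Fin 2) ℂ) (h : QF A) (h' : dd A = 1) : MM (mkSU A h h') = A := rfl

theorem mkSU_cont {W : Type} [TopologicalSpace W] {F : W → Matrix (Fin 2) (Fin 2) ℂ} (hF : Continuous F) (h : ∀ w, QF (F w)) (h' : ∀ w, dd (F w) = 1) :
    Continuous fun w => mkSU (F w) (h w) (h' w) := (hF.subtype_mk _).subtype_mk _

theorem dd_cont : Continuous dd := by
  unfold dd
  exact (Complex.continuous_normSq.comp (continuous_id.matrix_elem 0 0)).add (Complex.continuous_normSq.comp (continuous_id.matrix_elem 0 1))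

/-- normalisation -/
noncomputable def nrm (A : Matrix (Fin 2) (Fin 2) ℂ) : Matrix (Fin 2) (Fin 2) ℂ := (((Real.sqrt (dd A))⁻¹ : ℝ) : ℂ) • A
theorem dd_nrm {A : Matrix (Fin 2) (Fin 2) ℂ} (h : dd A ≠ 0) : dd (nrm A) = 1 := by
  rw [nrm, dd_smul, ← _root_.mul_inv, Real.mul_self_sqrt (dd_nonneg A), inv_mul_cancel₀ h]
theorem nrm_one {A : Matrix (Fin 2) (Fin 2) ℂ} (h : dd A = 1) : nrm A = A := by
  rw [nrm, h]; simp

/-- the generating map -/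
noncomputable def Um (a : S2) (z : Circle) : Matrix (Fin 2) (Fin 2) ℂ := (z : ℂ) • Qm a + ((z⁻¹ : Circle) : ℂ) • (1 - Qm a)
theorem Um_QF (a : S2) (z : Circle) : QF (Um a z) := by
  have hz : (z : ℂ)⁻¹ = (starRingEnd ℂ) (z : ℂ) := by rw [← Circle.coe_inv, Circle.coe_inv_eq_conj]
  constructor
  · simp [Um, Qm, hz]; ring
  · simp [Um, Qm, hz]
theorem Um_dd (a : S2) (z : Circle) : dd (Um a z) = 1 := by
  have h := dd_QF (Um_QF a z)
  have h2 : (Um a z).det = 1 := by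
    have hz : (z : ℂ) * ((z⁻¹ : Circle) : ℂ) = 1 := by rw [← Circle.coe_mul, mul_inv_cancel, Circle.coe_one]
    have hn := S2_norm a
    rw [det_fin_two]
    obtain ⟨y, hy⟩ : ∃ y : ℂ, y = ((z⁻¹ : Circle) : ℂ) := ⟨_, rfl⟩
    simp only [Um, ← hy] at hz ⊢
    simp [Qm]
    linear_combination hz - ((z : ℂ) - y) ^ 2 * hn
  rw [h2] at h; exact_mod_cast h.symm

noncomputable def UU : C(S2 × Circle, SU 2) := ⟨fun x => mkSU (Um x.1 x.2) (Um_QF _ _) (Um_dd _ _), by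
  refine mkSU_cont (F := fun x : S2 × Circle => Um x.1 x.2) ?_ (fun x => Um_QF _ _) (fun x => Um_dd _ _)
  unfold Um
  have h := Qm_cont
  have h1 : Continuous fun x : S2 × Circle => Qm x.1 := h.comp continuous_fst
  have h2 : Continuous fun x : S2 × Circle => ((x.2 : Circle) : ℂ) := by fun_prop
  have h3 : Continuous fun x : S2 × Circle => ((x.2⁻¹ : Circle) : ℂ) := by fun_prop
  exact (h2.smul h1).add (h3.smul (continuous_const.sub h1))⟩

theorem null_of_miss {X : Type} [TopologicalSpace X] (f : C(X, SU 2)) (p : SU 2) (hp : ∀ x, f x ≠ p) :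
    ∃ q : SU 2, (ContinuousMap.const X q).Homotopic f := by
  obtain ⟨F, hF⟩ : ∃ F : I01 × X → Matrix (Fin 2) (Fin 2) ℂ, F = fun y => ((y.1 : ℝ) : ℂ) • MM (f y.2) - (((1 - y.1 : ℝ)) : ℂ) • MM p := ⟨_, rfl⟩
  have hFc : Continuous F := by
    rw [hF]
    have h1 : Continuous fun y : I01 × X => MM (f y.2) := MM_cont.comp (f.continuous.comp continuous_snd)
    have h2 : Continuous fun y : I01 × X => ((y.1 : ℝ) : ℂ) := by fun_prop
    have h3 : Continuous fun y : I01 × X => ((1 - y.1 : ℝ) : ℂ) := by fun_prop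
    exact (h2.smul h1).sub (h3.smul continuous_const)
  have hQ : ∀ y, QF (F y) := by
    intro y; rw [hF]; exact QF_sub (QF_smul (QF_SU _) _) (QF_smul (QF_SU _) _)
  have hd : ∀ y, dd (F y) ≠ 0 := by
    intro y hy
    have h := dd_zero (hQ y) hy
    simp only [hF] at h
    have h2 := sub_eq_zero.1 h
    have h3 := congrArg dd h2
    rw [dd_smul, dd_smul, dd_SU, dd_SU] at h3
    have h4 : (y.1 : ℝ) = 1 / 2 := by linarith
    rw [h4] at h2
    have h5 : MM (f y.2) = MM p := by
      have e : ((1 - 1 / 2 : ℝ) : ℂ) = ((1 / 2 : ℝ) : ℂ) := by norm_num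
      rw [e] at h2
      exact smul_right_injective _ (by norm_num : ((1 / 2 : ℝ) : ℂ) ≠ 0) h2
    exact hp _ (MM_inj h5)
  have hN : Continuous fun y => nrm (F y) := by
    have h1 : Continuous fun y => (((Real.sqrt (dd (F y)))⁻¹ : ℝ) : ℂ) := by
      refine Complex.continuous_ofReal.comp ?_
      refine Continuous.inv₀ (Real.continuous_sqrt.comp (dd_cont.comp hFc)) ?_
      intro y
      exact (Real.sqrt_ne_zero (dd_nonneg _)).2 (hd y)
    exact h1.smul hFc
  have hQ0 : QF ((((-1 : ℝ)) : ℂ) • MM p) := QF_smul (QF_SU _) _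
  have hd0 : dd ((((-1 : ℝ)) : ℂ) • MM p) = 1 := by rw [dd_smul, dd_SU]; norm_num
  refine ⟨mkSU _ hQ0 hd0, ⟨⟨⟨fun y => mkSU (nrm (F y)) (QF_smul (hQ y) _) (dd_nrm (hd y)), mkSU_cont hN _ _⟩, ?_, ?_⟩⟩⟩
  · intro x
    apply MM_inj
    have e : F (0, x) = (((-1 : ℝ)) : ℂ) • MM p := by rw [hF]; simp
    show nrm (F (0, x)) = (((-1 : ℝ)) : ℂ) • MM p
    rw [e, nrm_one hd0]
  · intro x
    apply MM_inj
    have e : F (1, x) = MM (f x) := by rw [hF]; simp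
    show nrm (F (1, x)) = _
    rw [e, nrm_one (dd_SU _)]

end BK

/-- Every continuous map `SU(2) × SU(2) → SU(2)` homotopic to the commutator map
`(u,v) ↦ u v u⁻¹ v⁻¹` is surjective. -/
theorem surjective_of_homotopic_to_commutatorMap_SU2
    (c f : C(SU 2 × SU 2, SU 2))
    (hc : ∀ u v : SU 2, c (u, v) = u * v * u⁻¹ * v⁻¹)
    (hf : f.Homotopic c) :
    Function.Surjective f := by
  intro p
  by_contra hp
  obtain ⟨q, hq⟩ := BK.null_of_miss f p (fun x hx => hp ⟨x, hx⟩)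
  obtain ⟨H⟩ := hq.trans hf
  have H0 : ∀ x, H (0, x) = q := fun x => H.apply_zero x
  have H1 : ∀ x, H (1, x) = c x := fun x => H.apply_one x
  have hH : Continuous H := H.continuous
  refine BK.main_abs BK.MM BK.UU ⟨fun y => H y * (H (y.1, (1, 1)))⁻¹, ?_⟩ BK.MM_cont BK.MM_det (fun a z => rfl) ?_ ?_
  · exact hH.mul (hH.comp (by fun_prop)).inv
  · intro x
    show H (0, x) * (H (0, (1, 1)))⁻¹ = 1
    rw [H0, H0, mul_inv_cancel]
  · intro a b
    show H (1, (a, b)) * (H (1, (1, 1)))⁻¹ = _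
    rw [H1, H1, hc, hc]; simp
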